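/- Let u ∈ C¹(Ω) satisfy the Lipschitz bound and let z ∈ C²(Ω) be a classical solution of the nondivergence-form equation Σ_{i,j=1,2} a_{ij}(∇εu)·XᵢXⱼz = 0 in Ω. (i) If there exist α ∈ (0,1) and p > 10/3 such that for every compact K ⊂⊂ Ω there is C > 0 with ‖u‖_{Cε^{1,α}(K)} + ‖Yz‖_{Lᵖ(K)} + ‖Yz‖_{Wε^{1,2}(K)} + ‖z‖_{Wε^{2,2}(K)} ≤ C, then for every compact K₁ ⊂⊂ K there is a constant C₁ > 0 depending only on K, C and M (independent of ε) with ‖z‖_{Wε^{2,10/3}(K₁)} ≤ C₁. (ii) If in addition ‖Y X_k z‖_{L⁴(K)} ≤ C' for k = 1,2 and α ≥ 1/4, then z ∈ Wε^{2,p}(K₁) for every p > 1, with norm bounded by a constant depending only on K, C, C', M and p. -/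

import Mathlib

open MeasureTheory Real Filter Topology

noncomputable section

/-- Partial derivative ∂ₓ₁ on ℝ². -/
def pd1 (f : ℝ × ℝ → ℝ) (p : ℝ × ℝ) : ℝ := fderiv ℝ f p (1, 0)

/-- Partial derivative ∂ₓ₂ on ℝ². -/
def pd2 (f : ℝ × ℝ → ℝ) (p : ℝ × ℝ) : ℝ := fderiv ℝ f p (0, 1)

/-- Partial derivative ∂ₓ₃ on ℝ³ = ℝ × ℝ × ℝ. -/
def pd3 (g : ℝ × ℝ × ℝ → ℝ) (q : ℝ × ℝ × ℝ) : ℝ := fderiv ℝ g q (0, 0, 1)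

/-- Vector field a·∂ₓ₁ + b·∂ₓ₂ with coefficients evaluated along the graph of u. -/
def VF (a b : ℝ × ℝ × ℝ → ℝ) (u : ℝ × ℝ → ℝ) (f : ℝ × ℝ → ℝ) (p : ℝ × ℝ) : ℝ :=
  a (p.1, p.2, u p) * pd1 f p + b (p.1, p.2, u p) * pd2 f p

/-- The nonlinear vector field X₁ = X_{1,u}. -/
def X1 (s11 s12 : ℝ × ℝ × ℝ → ℝ) (u : ℝ × ℝ → ℝ) : (ℝ × ℝ → ℝ) → ℝ × ℝ → ℝ :=
  VF s11 s12 u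

/-- The transverse vector field Y = X₂/ε (coefficients σ₂ʲ = ∂ₓ₃σ₁ʲ). -/
def Yf (s11 s12 : ℝ × ℝ × ℝ → ℝ) (u : ℝ × ℝ → ℝ) : (ℝ × ℝ → ℝ) → ℝ × ℝ → ℝ :=
  VF (pd3 s11) (pd3 s12) u

/-- The scaled vector field X₂ = ε·Y. -/
def X2 (s11 s12 : ℝ × ℝ × ℝ → ℝ) (ε : ℝ) (u : ℝ × ℝ → ℝ) (f : ℝ × ℝ → ℝ) (p : ℝ × ℝ) : ℝ :=
  ε * Yf s11 s12 u f p

/-- The pair (X₁, X₂) of vector fields. -/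
def XX (s11 s12 : ℝ × ℝ × ℝ → ℝ) (ε : ℝ) (u : ℝ × ℝ → ℝ) :
    Fin 2 → (ℝ × ℝ → ℝ) → ℝ × ℝ → ℝ :=
  ![X1 s11 s12 u, X2 s11 s12 ε u]

/-- |∇ε f| = |(X₁f, X₂f)|. -/
def gradN (s11 s12 : ℝ × ℝ × ℝ → ℝ) (ε : ℝ) (u f : ℝ × ℝ → ℝ) (p : ℝ × ℝ) : ℝ :=
  Real.sqrt ((X1 s11 s12 u f p) ^ 2 + (X2 s11 s12 ε u f p) ^ 2)

/-- The weight √(1+|∇εu|²). -/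
def Wt (s11 s12 : ℝ × ℝ × ℝ → ℝ) (ε : ℝ) (u : ℝ × ℝ → ℝ) (p : ℝ × ℝ) : ℝ :=
  Real.sqrt (1 + (gradN s11 s12 ε u u p) ^ 2)

/-- The regularized minimal surface operator L_{ε,u}u = Σᵢ Xᵢ(Xᵢu/√(1+|∇εu|²)). -/
def Lop (s11 s12 : ℝ × ℝ × ℝ → ℝ) (ε : ℝ) (u : ℝ × ℝ → ℝ) (p : ℝ × ℝ) : ℝ :=
  X1 s11 s12 u (fun q => X1 s11 s12 u u q / Wt s11 s12 ε u q) p +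
  X2 s11 s12 ε u (fun q => X2 s11 s12 ε u u q / Wt s11 s12 ε u q) p

/-- The coefficients a_{ij}(∇εu) = δ_{ij} − (Xᵢu)(Xⱼu)/(1+|∇εu|²). -/
def aC (s11 s12 : ℝ × ℝ × ℝ → ℝ) (ε : ℝ) (u : ℝ × ℝ → ℝ) (i j : Fin 2) (p : ℝ × ℝ) : ℝ :=
  (if i = j then 1 else 0) -
    XX s11 s12 ε u i u p * XX s11 s12 ε u j u p / (1 + (gradN s11 s12 ε u u p) ^ 2)

/-- The coefficients 𝒜_{ij} = a_{ij}(∇εu)/√(1+|∇εu|²). -/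
def AC (s11 s12 : ℝ × ℝ × ℝ → ℝ) (ε : ℝ) (u : ℝ × ℝ → ℝ) (i j : Fin 2) (p : ℝ × ℝ) : ℝ :=
  aC s11 s12 ε u i j p / Wt s11 s12 ε u p

/-- The linearized divergence–form operator M_{ε,u}z = Σ_{i,j} Xᵢ(𝒜_{ij}·Xⱼz). -/
def Mop (s11 s12 : ℝ × ℝ × ℝ → ℝ) (ε : ℝ) (u z : ℝ × ℝ → ℝ) (p : ℝ × ℝ) : ℝ :=
  ∑ i : Fin 2, ∑ j : Fin 2,
    XX s11 s12 ε u i (fun q => AC s11 s12 ε u i j q * XX s11 s12 ε u j z q) p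

/-- Iterated derivatives X_{i₁}⋯X_{i_k} z. -/
def iterX (s11 s12 : ℝ × ℝ × ℝ → ℝ) (ε : ℝ) (u : ℝ × ℝ → ℝ) :
    (k : ℕ) → (Fin k → Fin 2) → (ℝ × ℝ → ℝ) → ℝ × ℝ → ℝ
  | 0, _, z => z
  | k + 1, I, z => XX s11 s12 ε u (I 0) (iterX s11 s12 ε u k (fun j => I j.succ) z)

/-- |∇εᵏ z| : Euclidean norm of the vector of all k-fold iterated derivatives. -/
def gradkN (s11 s12 : ℝ × ℝ × ℝ → ℝ) (ε : ℝ) (u : ℝ × ℝ → ℝ) (k : ℕ) (z : ℝ × ℝ → ℝ)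
    (p : ℝ × ℝ) : ℝ :=
  Real.sqrt (∑ I : Fin k → Fin 2, (iterX s11 s12 ε u k I z p) ^ 2)

/-- Lᵖ norm over K. -/
def LpN (q : ℝ) (f : ℝ × ℝ → ℝ) (K : Set (ℝ × ℝ)) : ℝ :=
  (∫ p in K, |f p| ^ q) ^ (1 / q)

/-- Sobolev norm ‖z‖_{Wε^{m,q}(K)} = Σ_{k=0}^m ‖|∇εᵏz|‖_{Lᵠ(K)}. -/
def WN (s11 s12 : ℝ × ℝ × ℝ → ℝ) (ε : ℝ) (u : ℝ × ℝ → ℝ) (m : ℕ) (q : ℝ)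
    (z : ℝ × ℝ → ℝ) (K : Set (ℝ × ℝ)) : ℝ :=
  ∑ k ∈ Finset.range (m + 1), LpN q (gradkN s11 s12 ε u k z) K

/-- m₁ = ∂ₓ₁[σ₁¹(·,u)] + ∂ₓ₂[σ₁²(·,u)]. -/
def m1 (s11 s12 : ℝ × ℝ × ℝ → ℝ) (u : ℝ × ℝ → ℝ) (p : ℝ × ℝ) : ℝ :=
  pd1 (fun q => s11 (q.1, q.2, u q)) p + pd2 (fun q => s12 (q.1, q.2, u q)) p

/-- Euclidean gradient length |∇_E f|. -/
def egN (f : ℝ × ℝ → ℝ) (p : ℝ × ℝ) : ℝ :=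
  Real.sqrt ((pd1 f p) ^ 2 + (pd2 f p) ^ 2)

/-- A cutoff function in Ω: smooth, compactly supported in Ω, 0 ≤ φ ≤ 1. -/
def IsCutoff (Ω : Set (ℝ × ℝ)) (φ : ℝ × ℝ → ℝ) : Prop :=
  ContDiff ℝ (⊤ : ℕ∞) φ ∧ HasCompactSupport φ ∧ tsupport φ ⊆ Ω ∧ ∀ p, 0 ≤ φ p ∧ φ p ≤ 1

/-- A test function φ ∈ C∞_c(Ω). -/
def IsTest (Ω : Set (ℝ × ℝ)) (φ : ℝ × ℝ → ℝ) : Prop :=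
  ContDiff ℝ (⊤ : ℕ∞) φ ∧ HasCompactSupport φ ∧ tsupport φ ⊆ Ω

/-- The Lipschitz bound ‖X₁u‖_{L∞(Ω)} + ‖Yu‖_{L∞(Ω)} ≤ M. -/
def LipBound (s11 s12 : ℝ × ℝ × ℝ → ℝ) (Ω : Set (ℝ × ℝ)) (u : ℝ × ℝ → ℝ) (M : ℝ) : Prop :=
  ∀ p ∈ Ω, |X1 s11 s12 u u p| + |Yf s11 s12 u u p| ≤ M

/-- Rank condition |σ₁¹·∂ₓ₃σ₁² − σ₁²·∂ₓ₃σ₁¹| > 0. -/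
def RankCond (s11 s12 : ℝ × ℝ × ℝ → ℝ) : Prop :=
  ∀ q : ℝ × ℝ × ℝ, 0 < |s11 q * pd3 s12 q - s12 q * pd3 s11 q|

/-- Vanishing viscosity solution of the intrinsic minimal surface equation. -/
def IsVVSol (s11 s12 : ℝ × ℝ × ℝ → ℝ) (Ω : Set (ℝ × ℝ)) (u : ℝ × ℝ → ℝ) : Prop :=
  ∃ (εs : ℕ → ℝ) (us : ℕ → ℝ × ℝ → ℝ) (l : NNReal),
    (∀ n, 0 < εs n ∧ εs n ≤ 1) ∧ Tendsto εs atTop (𝓝 0) ∧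
    (∀ n, ContDiff ℝ (⊤ : ℕ∞) (us n)) ∧
    (∀ n, ∀ p ∈ Ω, Lop s11 s12 (εs n) (us n) p = 0) ∧
    (∀ n, LipschitzOnWith l (us n) Ω) ∧ (∀ n, ∀ p ∈ Ω, |us n p| ≤ l) ∧
    (∀ K ⊆ Ω, IsCompact K → TendstoUniformlyOn us u atTop K)

/-- The antisymmetric commutator coefficients ω^l_{j,k} with ω^l_{1,2} = ω^l. -/
def wAnti (ω : Fin 2 → ℝ × ℝ → ℝ) (l j k : Fin 2) (p : ℝ × ℝ) : ℝ :=
  if j = k then 0 else if j = 0 then ω l p else -(ω l p)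

/-- Euclidean Hölder class C^{1,α} on Ω. -/
def EuclC1Alpha (Ω : Set (ℝ × ℝ)) (α : ℝ) (h : ℝ × ℝ → ℝ) : Prop :=
  Differentiable ℝ h ∧
    ∃ H : ℝ, ∀ p ∈ Ω, ∀ q ∈ Ω, ‖fderiv ℝ h p - fderiv ℝ h q‖ ≤ H * dist p q ^ α

/-- Frozen first-order intrinsic Taylor polynomial P_{x₀}h. -/
def Pfroz (s11 s12 : ℝ × ℝ × ℝ → ℝ) (ε : ℝ) (u h : ℝ × ℝ → ℝ) (x0 x : ℝ × ℝ) : ℝ :=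
  h x0 +
    ((pd3 s12 (x0.1, x0.2, u x0) /
        (s11 (x0.1, x0.2, u x0) * pd3 s12 (x0.1, x0.2, u x0) -
          s12 (x0.1, x0.2, u x0) * pd3 s11 (x0.1, x0.2, u x0))) * (x - x0).1 -
      (pd3 s11 (x0.1, x0.2, u x0) /
        (s11 (x0.1, x0.2, u x0) * pd3 s12 (x0.1, x0.2, u x0) -
          s12 (x0.1, x0.2, u x0) * pd3 s11 (x0.1, x0.2, u x0))) * (x - x0).2) *
      X1 s11 s12 u h x0 +
    ((1 / ε) *
      ((s11 (x0.1, x0.2, u x0) /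
          (s11 (x0.1, x0.2, u x0) * pd3 s12 (x0.1, x0.2, u x0) -
            s12 (x0.1, x0.2, u x0) * pd3 s11 (x0.1, x0.2, u x0))) * (x - x0).2 -
        (s12 (x0.1, x0.2, u x0) /
          (s11 (x0.1, x0.2, u x0) * pd3 s12 (x0.1, x0.2, u x0) -
            s12 (x0.1, x0.2, u x0) * pd3 s11 (x0.1, x0.2, u x0))) * (x - x0).1)) *
      X2 s11 s12 ε u h x0

def Th (t : ℝ) : ℝ := Real.smoothTransition (1 - t)

lemma Th_contDiff : ContDiff ℝ (⊤ : ℕ∞) Th := by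
  unfold Th
  exact Real.smoothTransition.contDiff.comp (contDiff_const.sub contDiff_id)

lemma Th_zero {t : ℝ} (h : 1 ≤ t) : Th t = 0 := by
  unfold Th; exact Real.smoothTransition.zero_of_nonpos (by linarith)

lemma Th_nonneg (t : ℝ) : 0 ≤ Th t := Real.smoothTransition.nonneg _

lemma Th_le_one (t : ℝ) : Th t ≤ 1 := Real.smoothTransition.le_one _

lemma Th_at_zero : Th 0 = 1 := by
  unfold Th; exact Real.smoothTransition.one_of_one_le (by norm_num)

lemma dTh_zero {t : ℝ} (h : 1 < t) : deriv Th t = 0 := by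
  have : Th =ᶠ[𝓝 t] fun _ => (0:ℝ) := by
    filter_upwards [lt_mem_nhds h] with s hs using Th_zero hs.le
  rw [this.deriv_eq]; simp

def Hk (ζ : ℝ × ℝ) : ℝ := Th (ζ.1 ^ 2 + ζ.2 ^ 2)
def Hd (ζ : ℝ × ℝ) : ℝ := deriv Th (ζ.1 ^ 2 + ζ.2 ^ 2)

lemma big_of_norm {ζ : ℝ × ℝ} (h : 1 < ‖ζ‖) : 1 < ζ.1 ^ 2 + ζ.2 ^ 2 := by
  rw [Prod.norm_def] at h
  rcases lt_max_iff.1 h with h | h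
  · rw [Real.norm_eq_abs] at h
    have : 1 < ζ.1 ^ 2 := by rw [← sq_abs]; nlinarith
    nlinarith [sq_nonneg ζ.2]
  · rw [Real.norm_eq_abs] at h
    have : 1 < ζ.2 ^ 2 := by rw [← sq_abs]; nlinarith
    nlinarith [sq_nonneg ζ.1]

lemma Hk_zero {ζ : ℝ × ℝ} (h : 1 < ‖ζ‖) : Hk ζ = 0 := Th_zero (big_of_norm h).le
lemma Hd_zero {ζ : ℝ × ℝ} (h : 1 < ‖ζ‖) : Hd ζ = 0 := dTh_zero (big_of_norm h)

lemma Hk_contDiff : ContDiff ℝ (⊤ : ℕ∞) Hk := by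
  unfold Hk; exact Th_contDiff.comp (by fun_prop)

lemma Hd_cont : Continuous Hd := by
  unfold Hd
  exact (Th_contDiff.continuous_deriv (by simp)).comp (by fun_prop)

lemma cs_of {k : ℝ × ℝ → ℝ} (h : ∀ ζ, 1 < ‖ζ‖ → k ζ = 0) : HasCompactSupport k :=
  HasCompactSupport.intro (isCompact_closedBall (0 : ℝ × ℝ) 1) (fun ζ hζ => h ζ (by simpa using hζ))

lemma int_of {k f : ℝ × ℝ → ℝ} (hk : Continuous k) (h : ∀ ζ, 1 < ‖ζ‖ → k ζ = 0) (hf : Continuous f) :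
    Integrable (fun ζ => f ζ * k ζ) :=
  (hf.mul hk).integrable_of_hasCompactSupport (cs_of h).mul_left

lemma Hk_fderiv (ζ v : ℝ × ℝ) : fderiv ℝ Hk ζ v = (2 * ζ.1 * v.1 + 2 * ζ.2 * v.2) * Hd ζ := by
  have h1 : HasDerivAt Th (Hd ζ) (ζ.1 ^ 2 + ζ.2 ^ 2) :=
    ((Th_contDiff.differentiable (by simp)) _).hasDerivAt
  have h2 : HasFDerivAt (fun ζ : ℝ × ℝ => ζ.1 ^ 2 + ζ.2 ^ 2)
      ((2 * ζ.1) • ContinuousLinearMap.fst ℝ ℝ ℝ + (2 * ζ.2) • ContinuousLinearMap.snd ℝ ℝ ℝ) ζ := by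
    have a := (hasFDerivAt_fst (𝕜 := ℝ) (p := ζ)).pow 2
    have b := (hasFDerivAt_snd (𝕜 := ℝ) (p := ζ)).pow 2
    exact (a.fun_add b).congr_fderiv (by ext <;> simp)
  have := h1.comp_hasFDerivAt ζ h2
  have h3 : fderiv ℝ Hk ζ = _ := this.fderiv
  rw [h3]; simp; ring

/-- null Lagrangian identity -/
lemma nullL {p k : ℝ × ℝ → ℝ} (hp : ContDiff ℝ 1 p) (hk : ContDiff ℝ 2 k)
    (h : ∀ ζ, 1 < ‖ζ‖ → k ζ = 0) (v w : ℝ × ℝ) :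
    ∫ ζ, fderiv ℝ p ζ v * fderiv ℝ k ζ w = ∫ ζ, fderiv ℝ p ζ w * fderiv ℝ k ζ v := by
  have hcs : HasCompactSupport k := cs_of h
  have hk1 : ∀ w : ℝ × ℝ, ContDiff ℝ 1 (fun ζ => fderiv ℝ k ζ w) := fun w =>
    (hk.fderiv_right (m := 1) (by norm_num)).clm_apply contDiff_const
  have hcs1 : ∀ w : ℝ × ℝ, HasCompactSupport (fun ζ => fderiv ℝ k ζ w) := fun w =>
    hcs.fderiv_apply (𝕜 := ℝ) w
  have hp1 : ∀ w : ℝ × ℝ, Continuous (fun ζ => fderiv ℝ p ζ w) := fun w =>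
    (hp.continuous_fderiv (by simp)).clm_apply continuous_const
  have key : ∀ v w : ℝ × ℝ, ∫ ζ, fderiv ℝ p ζ v * fderiv ℝ k ζ w
      = - ∫ ζ, p ζ * fderiv ℝ (fderiv ℝ k) ζ v w := by
    intro v w
    have e : ∀ ζ, fderiv ℝ (fun ζ => fderiv ℝ k ζ w) ζ v = fderiv ℝ (fderiv ℝ k) ζ v w := by
      intro ζ
      have hd : DifferentiableAt ℝ (fderiv ℝ k) ζ :=
        (hk.fderiv_right (m := 1) (by norm_num)).differentiable (by simp) ζ
      rw [fderiv_clm_apply hd (by fun_prop)]; simp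
    have hc2 : Continuous (fun ζ => fderiv ℝ (fun ζ => fderiv ℝ k ζ w) ζ v) :=
      ((hk1 w).continuous_fderiv (by simp)).clm_apply continuous_const
    have := integral_mul_fderiv_eq_neg_fderiv_mul_of_integrable (μ := volume) (f := p)
      (g := fun ζ => fderiv ℝ k ζ w) (v := v)
      (((hp1 v).mul (hk1 w).continuous).integrable_of_hasCompactSupport (hcs1 w).mul_left)
      ((hp.continuous.mul hc2).integrable_of_hasCompactSupport
        ((hcs1 w).fderiv_apply (𝕜 := ℝ) v).mul_left)
      ((hp.continuous.mul (hk1 w).continuous).integrable_of_hasCompactSupport (hcs1 w).mul_left)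
      (fun x _ => hp.differentiable (by simp) x)
      (fun x _ => (hk1 w).differentiable (by simp) x)
    simp only [e] at this
    rw [this]; simp
  rw [key, key]
  congr 2
  ext ζ
  have hs : IsSymmSndFDerivAt ℝ k ζ := hk.contDiffAt.isSymmSndFDerivAt (by simp)
  rw [hs v w]

lemma ibp {p k : ℝ × ℝ → ℝ} (hp : ContDiff ℝ 1 p) (hk : ContDiff ℝ 1 k)
    (h : ∀ ζ, 1 < ‖ζ‖ → k ζ = 0) (v : ℝ × ℝ) :
    ∫ ζ, p ζ * fderiv ℝ k ζ v = - ∫ ζ, fderiv ℝ p ζ v * k ζ := by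
  have hcs : HasCompactSupport k := cs_of h
  have hp1 : Continuous (fun ζ => fderiv ℝ p ζ v) :=
    (hp.continuous_fderiv (by simp)).clm_apply continuous_const
  have hk1 : Continuous (fun ζ => fderiv ℝ k ζ v) :=
    (hk.continuous_fderiv (by simp)).clm_apply continuous_const
  exact integral_mul_fderiv_eq_neg_fderiv_mul_of_integrable 
      ((hp1.mul hk.continuous).integrable_of_hasCompactSupport hcs.mul_left)
      ((hp.continuous.mul hk1).integrable_of_hasCompactSupport
        (hcs.fderiv_apply (𝕜 := ℝ) v).mul_left)
      ((hp.continuous.mul hk.continuous).integrable_of_hasCompactSupport hcs.mul_left)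
      (fun x _ => hp.differentiable (by simp) x)
      (fun x _ => hk.differentiable (by simp) x)

lemma dInt {p k : ℝ × ℝ → ℝ} (hp : ContDiff ℝ 1 p) (hk : Continuous k)
    (h : ∀ ζ, 1 < ‖ζ‖ → k ζ = 0) (ρ : ℝ) :
    HasDerivAt (fun ρ : ℝ => ∫ ζ, p (ρ • ζ) * k ζ) (∫ ζ, fderiv ℝ p (ρ • ζ) ζ * k ζ) ρ := by
  have hpc := hp.continuous_fderiv (by simp)
  obtain ⟨C, hC⟩ := (isCompact_closedBall (0 : ℝ × ℝ) (|ρ| + 1)).exists_bound_of_continuousOn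
    hpc.continuousOn
  refine (hasDerivAt_integral_of_dominated_loc_of_deriv_le (μ := volume)
    (F := fun ρ ζ => p (ρ • ζ) * k ζ)
    (F' := fun ρ ζ => fderiv ℝ p (ρ • ζ) ζ * k ζ) (bound := fun ζ => C * |k ζ|)
    (Metric.ball_mem_nhds ρ one_pos) ?_ ?_ ?_ ?_ ?_ ?_).2
  · refine Eventually.of_forall fun ρ => Continuous.aestronglyMeasurable ?_
    have := hp.continuous
    fun_prop
  · exact int_of hk h (by have := hp.continuous; fun_prop)
  · refine Continuous.aestronglyMeasurable ?_
    exact ((hpc.comp (by fun_prop)).clm_apply continuous_id).mul hk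
  · refine Eventually.of_forall fun ζ s hs => ?_
    by_cases hz : 1 < ‖ζ‖
    · simp [h ζ hz]
    · push Not at hz
      rw [norm_mul, Real.norm_eq_abs (k ζ)]
      gcongr
      have hs' : |s| ≤ |ρ| + 1 := by
        have : |s - ρ| < 1 := by simpa [Real.dist_eq] using hs
        have := abs_sub_abs_le_abs_sub s ρ
        linarith
      have h1 : ‖fderiv ℝ p (s • ζ)‖ ≤ C := by
        apply hC
        simp only [Metric.mem_closedBall, dist_zero_right, norm_smul, Real.norm_eq_abs]
        nlinarith [abs_nonneg s, norm_nonneg ζ]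
      calc ‖fderiv ℝ p (s • ζ) ζ‖ ≤ ‖fderiv ℝ p (s • ζ)‖ * ‖ζ‖ := ContinuousLinearMap.le_opNorm _ _
        _ ≤ C * 1 := by gcongr; exact (norm_nonneg _).trans h1
        _ = C := mul_one C
  · have := int_of (k := fun ζ => |k ζ|) (f := fun _ => C) hk.abs (fun ζ hz => by simp [h ζ hz]) continuous_const
    exact this
  · refine Eventually.of_forall fun ζ s hs => ?_
    have h1 : HasFDerivAt p (fderiv ℝ p (s • ζ)) (s • ζ) := (hp.differentiable (by simp) _).hasFDerivAt
    have h2 : HasDerivAt (fun s : ℝ => s • ζ) ζ s := by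
      simpa using (hasDerivAt_id s).smul_const ζ
    exact (h1.comp_hasDerivAt s h2).mul_const _

lemma cH_pos : 0 < ∫ ζ, Hk ζ := by
  have hc := Hk_contDiff.continuous
  have h0 : Hk 0 ≠ 0 := by simp [Hk, Th_at_zero]
  exact hc.integral_pos_of_hasCompactSupport_nonneg_nonzero (cs_of fun ζ => Hk_zero)
    (fun ζ => Th_nonneg _) h0

lemma fd_smul {p : ℝ × ℝ → ℝ} (hp : ContDiff ℝ 1 p) (ρ : ℝ) (ζ v : ℝ × ℝ) :
    fderiv ℝ (fun ζ => p (ρ • ζ)) ζ v = ρ * fderiv ℝ p (ρ • ζ) v := by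
  have h1 : HasFDerivAt p (fderiv ℝ p (ρ • ζ)) (ρ • ζ) := (hp.differentiable (by simp) _).hasFDerivAt
  have h2 : HasFDerivAt (fun ζ : ℝ × ℝ => ρ • ζ) (ρ • ContinuousLinearMap.id ℝ (ℝ × ℝ)) ζ :=
    (hasFDerivAt_id ζ).const_smul ρ
  have h3 : HasFDerivAt (fun ζ => p (ρ • ζ)) _ ζ := h1.comp ζ h2
  rw [h3.fderiv]; simp

lemma k_fderiv_t (ζ : ℝ × ℝ) (v : ℝ × ℝ) :
    fderiv ℝ (fun ζ : ℝ × ℝ => ζ.2 * Hk ζ) ζ v = v.2 * Hk ζ + ζ.2 * fderiv ℝ Hk ζ v := by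
  rw [fderiv_fun_mul (by fun_prop) (Hk_contDiff.differentiable (by simp) ζ)]
  simp [fderiv_snd]; ring

lemma k_fderiv_s (ζ : ℝ × ℝ) (v : ℝ × ℝ) :
    fderiv ℝ (fun ζ : ℝ × ℝ => ζ.1 * Hk ζ) ζ v = v.1 * Hk ζ + ζ.1 * fderiv ℝ Hk ζ v := by
  rw [fderiv_fun_mul (by fun_prop) (Hk_contDiff.differentiable (by simp) ζ)]
  simp [fderiv_fst]; ring

/-- the mean -/
def MA (p q : ℝ × ℝ → ℝ) (ρ : ℝ) : ℝ :=
  ∫ ζ, (fderiv ℝ p (ρ • ζ) (1, 0) - fderiv ℝ q (ρ • ζ) (0, 1)) * Hk ζ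

lemma fd_cont {p : ℝ × ℝ → ℝ} (hp : ContDiff ℝ 1 p) (ρ : ℝ) (v : ℝ × ℝ) :
    Continuous fun ζ : ℝ × ℝ => fderiv ℝ p (ρ • ζ) v :=
  ((hp.continuous_fderiv (by simp)).comp (by fun_prop : Continuous fun ζ : ℝ × ℝ => ρ • ζ)).clm_apply
    continuous_const

lemma MA_cont {p q : ℝ × ℝ → ℝ} (hp : ContDiff ℝ 1 p) (hq : ContDiff ℝ 1 q) :
    Continuous (MA p q) := by
  have h := continuous_parametric_integral_of_continuous (μ := (volume : Measure (ℝ × ℝ)))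
    (f := fun (ρ : ℝ) (ζ : ℝ × ℝ) => (fderiv ℝ p (ρ • ζ) (1, 0) - fderiv ℝ q (ρ • ζ) (0, 1)) * Hk ζ)
    (s := Metric.closedBall 0 1) (by
      have h1 := hp.continuous_fderiv (by simp)
      have h2 := hq.continuous_fderiv (by simp)
      have h3 := Hk_contDiff.continuous
      have h4 : Continuous fun a : ℝ × (ℝ × ℝ) => a.1 • a.2 := by fun_prop
      exact (((h1.comp h4).clm_apply continuous_const).sub
        ((h2.comp h4).clm_apply continuous_const)).mul (h3.comp continuous_snd))
      (isCompact_closedBall _ _)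
  convert h using 2 with ρ
  unfold MA
  rw [setIntegral_eq_integral_of_forall_compl_eq_zero]
  intro ζ hζ
  rw [Hk_zero (by simpa using hζ), mul_zero]

lemma MA_deriv {p q : ℝ × ℝ → ℝ} (hp : ContDiff ℝ 1 p) (hq : ContDiff ℝ 1 q) {ρ : ℝ} (hρ : 0 < ρ) :
    HasDerivAt (MA p q) (-(2 / ρ) * ∫ ζ, ((fderiv ℝ p (ρ • ζ) (1, 0) + fderiv ℝ q (ρ • ζ) (0, 1)) *
      (ζ.1 ^ 2 - ζ.2 ^ 2) - 2 * ζ.1 * ζ.2 * (fderiv ℝ q (ρ • ζ) (1, 0) - fderiv ℝ p (ρ • ζ) (0, 1))) * Hd ζ) ρ := by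
  have hHc := Hk_contDiff.continuous
  set k1 : ℝ × ℝ → ℝ := fun ζ => 2 * ζ.1 * Hd ζ with hk1
  set k2 : ℝ × ℝ → ℝ := fun ζ => 2 * ζ.2 * Hd ζ with hk2
  have hHd := Hd_cont
  have hk1c : Continuous k1 := by fun_prop
  have hk2c : Continuous k2 := by fun_prop
  have hk1z : ∀ ζ, 1 < ‖ζ‖ → k1 ζ = 0 := fun ζ h => by simp [hk1, Hd_zero h]
  have hk2z : ∀ ζ, 1 < ‖ζ‖ → k2 ζ = 0 := fun ζ h => by simp [hk2, Hd_zero h]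
  have hps : ∀ ρ : ℝ, ContDiff ℝ 1 (fun ζ => p (ρ • ζ)) := fun ρ => hp.comp (by fun_prop)
  have hqs : ∀ ρ : ℝ, ContDiff ℝ 1 (fun ζ => q (ρ • ζ)) := fun ρ => hq.comp (by fun_prop)
  have hH1 : ContDiff ℝ 1 Hk := Hk_contDiff.of_le (by exact_mod_cast le_top)
  have hH2 : ContDiff ℝ 2 Hk := contDiff_infty.1 Hk_contDiff 2
  set J : ℝ → ℝ := fun ρ => (∫ ζ, p (ρ • ζ) * k1 ζ) - ∫ ζ, q (ρ • ζ) * k2 ζ with hJ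
  have eJ : ∀ ρ : ℝ, J ρ = -(ρ * MA p q ρ) := by
    intro ρ
    have a := ibp (hps ρ) hH1 (fun ζ => Hk_zero) (1, 0)
    have b := ibp (hqs ρ) hH1 (fun ζ => Hk_zero) (0, 1)
    simp only [Hk_fderiv, fd_smul hp, fd_smul hq, mul_one, mul_zero, add_zero, zero_add] at a b
    simp only [hJ, hk1, hk2, a, b, MA]
    have i1 := int_of hHc (fun ζ => Hk_zero) (fd_cont hp ρ (1, 0))
    have i2 := int_of hHc (fun ζ => Hk_zero) (fd_cont hq ρ (0, 1))
    simp only [mul_assoc, sub_mul]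
    rw [integral_const_mul, integral_const_mul, integral_sub i1 i2]; ring
  have dJ : HasDerivAt J ((∫ ζ, fderiv ℝ p (ρ • ζ) ζ * k1 ζ) - ∫ ζ, fderiv ℝ q (ρ • ζ) ζ * k2 ζ) ρ :=
    (dInt hp hk1c hk1z ρ).sub (dInt hq hk2c hk2z ρ)
  have dM : HasDerivAt (fun ρ => -(J ρ) / ρ) _ ρ := (dJ.neg).div (hasDerivAt_id ρ) hρ.ne'
  have ev : MA p q =ᶠ[𝓝 ρ] fun ρ => -(J ρ) / ρ := by
    filter_upwards [lt_mem_nhds hρ] with s hs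
    rw [eJ]; field_simp
  refine (dM.congr_of_eventuallyEq ev).congr_deriv ?_
  have hn1 := nullL (hps ρ) (k := fun ζ => ζ.2 * Hk ζ) (by fun_prop) (fun ζ h => by simp [Hk_zero h]) (1, 0) (0, 1)
  have hn2 := nullL (hqs ρ) (k := fun ζ => ζ.1 * Hk ζ) (by fun_prop) (fun ζ h => by simp [Hk_zero h]) (1, 0) (0, 1)
  simp only [k_fderiv_t, k_fderiv_s, Hk_fderiv, fd_smul hp, fd_smul hq, mul_one, mul_zero, add_zero,
    zero_add, one_mul, zero_mul, mul_assoc] at hn1 hn2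
  rw [integral_const_mul, integral_const_mul, mul_right_inj' hρ.ne'] at hn1 hn2
  have lin : ∀ (f : ℝ × ℝ → ℝ) (ζ : ℝ × ℝ), fderiv ℝ f (ρ • ζ) ζ
      = ζ.1 * fderiv ℝ f (ρ • ζ) (1, 0) + ζ.2 * fderiv ℝ f (ρ • ζ) (0, 1) := by
    intro f ζ
    have : ζ = ζ.1 • ((1 : ℝ), (0 : ℝ)) + ζ.2 • ((0 : ℝ), (1 : ℝ)) := by ext <;> simp
    conv_lhs => rw [show (fderiv ℝ f (ρ • ζ)) ζ = (fderiv ℝ f (ρ • ζ)) (ζ.1 • ((1 : ℝ), (0 : ℝ)) + ζ.2 • ((0 : ℝ), (1 : ℝ))) from by rw [← this]]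
    rw [map_add, map_smul, map_smul]; simp
  have p1 := fd_cont hp ρ (1, 0)
  have p2 := fd_cont hp ρ (0, 1)
  have q1 := fd_cont hq ρ (1, 0)
  have q2 := fd_cont hq ρ (0, 1)
  -- everything integrable
  have iH : ∀ {f : ℝ × ℝ → ℝ}, Continuous f → Integrable (fun ζ => f ζ * Hk ζ) := fun hf =>
    int_of hHc (fun ζ => Hk_zero) hf
  have iD : ∀ {f : ℝ × ℝ → ℝ}, Continuous f → Integrable (fun ζ => f ζ * Hd ζ) := fun hf =>
    int_of hHd (fun ζ => Hd_zero) hf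
  have key : -((∫ ζ, fderiv ℝ p (ρ • ζ) ζ * k1 ζ) - ∫ ζ, fderiv ℝ q (ρ • ζ) ζ * k2 ζ) - MA p q ρ
      = -2 * ∫ ζ, ((fderiv ℝ p (ρ • ζ) (1, 0) + fderiv ℝ q (ρ • ζ) (0, 1)) *
      (ζ.1 ^ 2 - ζ.2 ^ 2) - 2 * ζ.1 * ζ.2 * (fderiv ℝ q (ρ • ζ) (1, 0) - fderiv ℝ p (ρ • ζ) (0, 1))) * Hd ζ := by
    set P1 := fun ζ : ℝ × ℝ => fderiv ℝ p (ρ • ζ) (1, 0) with hP1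
    set P2 := fun ζ : ℝ × ℝ => fderiv ℝ p (ρ • ζ) (0, 1) with hP2
    set Q1 := fun ζ : ℝ × ℝ => fderiv ℝ q (ρ • ζ) (1, 0) with hQ1
    set Q2 := fun ζ : ℝ × ℝ => fderiv ℝ q (ρ • ζ) (0, 1) with hQ2
    have s1 : (∫ ζ, fderiv ℝ p (ρ • ζ) ζ * k1 ζ) = (∫ ζ, (P1 ζ * (2 * ζ.1 ^ 2)) * Hd ζ) + ∫ ζ, (P2 ζ * (2 * ζ.1 * ζ.2)) * Hd ζ := by
      rw [← integral_add (iD (by fun_prop)) (iD (by fun_prop))]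
      congr 1; ext ζ; rw [lin]; simp only [hk1, hP1, hP2]; ring
    have s2 : (∫ ζ, fderiv ℝ q (ρ • ζ) ζ * k2 ζ) = (∫ ζ, (Q2 ζ * (2 * ζ.2 ^ 2)) * Hd ζ) + ∫ ζ, (Q1 ζ * (2 * ζ.1 * ζ.2)) * Hd ζ := by
      rw [← integral_add (iD (by fun_prop)) (iD (by fun_prop))]
      congr 1; ext ζ; rw [lin]; simp only [hk2, hQ1, hQ2]; ring
    have s3 : MA p q ρ = (∫ ζ, P1 ζ * Hk ζ) - ∫ ζ, Q2 ζ * Hk ζ := by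
      rw [← integral_sub (iH (by fun_prop)) (iH (by fun_prop))]
      unfold MA
      congr 1; ext ζ; simp only [hP1, hQ2]; ring
    have s4 : (∫ ζ, P1 ζ * Hk ζ) + (∫ ζ, (P1 ζ * (2 * ζ.2 ^ 2)) * Hd ζ) = ∫ ζ, (P2 ζ * (2 * ζ.1 * ζ.2)) * Hd ζ := by
      rw [← integral_add (iH (by fun_prop)) (iD (by fun_prop))]
      refine Eq.trans ?_ (hn1.trans ?_)
      · congr 1; ext ζ; simp only [hP1]; ring
      · congr 1; ext ζ; simp only [hP2]; ring
    have s5 : (∫ ζ, Q2 ζ * Hk ζ) + (∫ ζ, (Q2 ζ * (2 * ζ.1 ^ 2)) * Hd ζ) = ∫ ζ, (Q1 ζ * (2 * ζ.1 * ζ.2)) * Hd ζ := by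
      rw [← integral_add (iH (by fun_prop)) (iD (by fun_prop))]
      refine Eq.trans ?_ (hn2.symm.trans ?_)
      · congr 1; ext ζ; simp only [hQ2]; ring
      · congr 1; ext ζ; simp only [hQ1]; ring
    have s6 : (∫ ζ, ((P1 ζ + Q2 ζ) * (ζ.1 ^ 2 - ζ.2 ^ 2) - 2 * ζ.1 * ζ.2 * (Q1 ζ - P2 ζ)) * Hd ζ)
      = (((∫ ζ, (P1 ζ * (2 * ζ.1 ^ 2)) * Hd ζ) - (∫ ζ, (P1 ζ * (2 * ζ.2 ^ 2)) * Hd ζ))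
      + ((∫ ζ, (Q2 ζ * (2 * ζ.1 ^ 2)) * Hd ζ) - ∫ ζ, (Q2 ζ * (2 * ζ.2 ^ 2)) * Hd ζ)) / 2
      - ((∫ ζ, (Q1 ζ * (2 * ζ.1 * ζ.2)) * Hd ζ) - ∫ ζ, (P2 ζ * (2 * ζ.1 * ζ.2)) * Hd ζ) := by
      rw [← integral_sub (iD (by fun_prop)) (iD (by fun_prop)), ← integral_sub (iD (by fun_prop)) (iD (by fun_prop)),
        ← integral_sub (iD (by fun_prop)) (iD (by fun_prop)), ← integral_add, ← integral_div, ← integral_sub]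
      · congr 1; ext ζ; ring
      · exact (((iD (by fun_prop)).sub (iD (by fun_prop))).add ((iD (by fun_prop)).sub (iD (by fun_prop)))).div_const 2
      · exact (iD (by fun_prop)).sub (iD (by fun_prop))
      · exact (iD (by fun_prop)).sub (iD (by fun_prop))
      · exact (iD (by fun_prop)).sub (iD (by fun_prop))
    change _ = -2 * ∫ ζ, ((P1 ζ + Q2 ζ) * (ζ.1 ^ 2 - ζ.2 ^ 2) - 2 * ζ.1 * ζ.2 * (Q1 ζ - P2 ζ)) * Hd ζ
    rw [s6, s1, s2, s3]
    linarith [s4, s5]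
  rw [show (-J) ρ = ρ * MA p q ρ by rw [Pi.neg_apply, eJ, neg_neg]]
  simp only [mul_one]
  have : -(2 / ρ) * ∫ ζ, ((fderiv ℝ p (ρ • ζ) (1, 0) + fderiv ℝ q (ρ • ζ) (0, 1)) *
      (ζ.1 ^ 2 - ζ.2 ^ 2) - 2 * ζ.1 * ζ.2 * (fderiv ℝ q (ρ • ζ) (1, 0) - fderiv ℝ p (ρ • ζ) (0, 1))) * Hd ζ
      = (-2 * ∫ ζ, ((fderiv ℝ p (ρ • ζ) (1, 0) + fderiv ℝ q (ρ • ζ) (0, 1)) *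
      (ζ.1 ^ 2 - ζ.2 ^ 2) - 2 * ζ.1 * ζ.2 * (fderiv ℝ q (ρ • ζ) (1, 0) - fderiv ℝ p (ρ • ζ) (0, 1))) * Hd ζ) / ρ := by ring
  rw [this, ← key]
  field_simp

lemma MA_deriv_bound {p q : ℝ × ℝ → ℝ} {γ N ρ : ℝ} (hγ : 0 < γ) (hN : 0 ≤ N)
    (hρ : 0 < ρ) (hρ1 : ρ ≤ 1)
    (hF1 : ∀ ζ : ℝ × ℝ, ‖ζ‖ ≤ 1 → |fderiv ℝ p ζ (1, 0) + fderiv ℝ q ζ (0, 1)| ≤ N * ‖ζ‖ ^ γ)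
    (hF2 : ∀ ζ : ℝ × ℝ, ‖ζ‖ ≤ 1 → |fderiv ℝ q ζ (1, 0) - fderiv ℝ p ζ (0, 1)| ≤ N * ‖ζ‖ ^ γ) :
    |-(2 / ρ) * ∫ ζ, ((fderiv ℝ p (ρ • ζ) (1, 0) + fderiv ℝ q (ρ • ζ) (0, 1)) *
      (ζ.1 ^ 2 - ζ.2 ^ 2) - 2 * ζ.1 * ζ.2 * (fderiv ℝ q (ρ • ζ) (1, 0) - fderiv ℝ p (ρ • ζ) (0, 1))) * Hd ζ|
    ≤ (6 * ∫ ζ, |Hd ζ|) * N * ρ ^ (γ - 1) := by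
  have hb : |∫ ζ, ((fderiv ℝ p (ρ • ζ) (1, 0) + fderiv ℝ q (ρ • ζ) (0, 1)) *
      (ζ.1 ^ 2 - ζ.2 ^ 2) - 2 * ζ.1 * ζ.2 * (fderiv ℝ q (ρ • ζ) (1, 0) - fderiv ℝ p (ρ • ζ) (0, 1))) * Hd ζ|
      ≤ ∫ ζ, (3 * (N * ρ ^ γ)) * |Hd ζ| := by
    rw [← Real.norm_eq_abs]
    refine norm_integral_le_of_norm_le ?_ (Eventually.of_forall fun ζ => ?_)
    · exact int_of (k := fun ζ => |Hd ζ|) (f := fun _ => 3 * (N * ρ ^ γ)) Hd_cont.abs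
        (fun ζ hz => by simp [Hd_zero hz]) continuous_const
    · rw [norm_mul, Real.norm_eq_abs, Real.norm_eq_abs]
      by_cases hz : 1 < ‖ζ‖
      · simp [Hd_zero hz]
      push Not at hz
      gcongr
      have hn : ‖ρ • ζ‖ ≤ ρ := by
        rw [norm_smul, Real.norm_eq_abs, abs_of_pos hρ]; nlinarith
      have hpw : ‖ρ • ζ‖ ^ γ ≤ ρ ^ γ := Real.rpow_le_rpow (norm_nonneg _) hn hγ.le
      have h1 := (hF1 (ρ • ζ) (hn.trans hρ1)).trans (mul_le_mul_of_nonneg_left hpw hN)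
      have h2 := (hF2 (ρ • ζ) (hn.trans hρ1)).trans (mul_le_mul_of_nonneg_left hpw hN)
      have z1 : |ζ.1| ≤ 1 := (norm_fst_le ζ).trans hz
      have z2 : |ζ.2| ≤ 1 := (norm_snd_le ζ).trans hz
      have e1 : |ζ.1 ^ 2 - ζ.2 ^ 2| ≤ 1 := by
        rw [abs_le] at *; constructor <;> nlinarith
      have e2 : |2 * ζ.1 * ζ.2| ≤ 2 := by
        rw [abs_mul, abs_mul, abs_two]; nlinarith [abs_nonneg ζ.1, abs_nonneg ζ.2]
      calc _ ≤ |fderiv ℝ p (ρ • ζ) (1, 0) + fderiv ℝ q (ρ • ζ) (0, 1)| * |ζ.1 ^ 2 - ζ.2 ^ 2|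
            + |2 * ζ.1 * ζ.2| * |fderiv ℝ q (ρ • ζ) (1, 0) - fderiv ℝ p (ρ • ζ) (0, 1)| := by
              rw [← abs_mul, ← abs_mul]; exact abs_sub _ _
        _ ≤ N * ρ ^ γ * 1 + 2 * (N * ρ ^ γ) := by gcongr
        _ = _ := by ring
  rw [integral_const_mul] at hb
  rw [abs_mul, abs_neg, abs_of_pos (by positivity : 0 < 2 / ρ), Real.rpow_sub_one hρ.ne']
  calc _ ≤ 2 / ρ * (3 * (N * ρ ^ γ) * ∫ ζ, |Hd ζ|) := by gcongr
    _ = _ := by field_simp; ring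

lemma lemR {γ : ℝ} (hγ : 0 < γ) : ∃ Cr : ℝ, 0 < Cr ∧ ∀ (p q : ℝ × ℝ → ℝ) (N : ℝ),
    ContDiff ℝ 1 p → ContDiff ℝ 1 q → 0 ≤ N →
    (∀ ζ : ℝ × ℝ, ‖ζ‖ ≤ 1 → |fderiv ℝ p ζ (1, 0) + fderiv ℝ q ζ (0, 1)| ≤ N * ‖ζ‖ ^ γ) →
    (∀ ζ : ℝ × ℝ, ‖ζ‖ ≤ 1 → |fderiv ℝ q ζ (1, 0) - fderiv ℝ p ζ (0, 1)| ≤ N * ‖ζ‖ ^ γ) →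
    |fderiv ℝ p 0 (1, 0) - fderiv ℝ q 0 (0, 1)| ≤
      Cr * ((∫ ζ in Metric.closedBall (0 : ℝ × ℝ) 1, |fderiv ℝ p ζ (1, 0) - fderiv ℝ q ζ (0, 1)|) + N) := by
  set C0 := 6 * ∫ ζ, |Hd ζ| with hC0
  have hC0n : 0 ≤ C0 := by have := integral_nonneg (μ := volume) (f := fun ζ => |Hd ζ|) (fun ζ => abs_nonneg _); positivity
  set cH := ∫ ζ, Hk ζ with hcH
  have hc : 0 < cH := cH_pos
  refine ⟨(1 + C0 / γ) / cH, by positivity, ?_⟩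
  intro p q N hp hq hN hF1 hF2
  have hcont := MA_cont hp hq
  have step : ∀ a : ℝ, 0 < a → a ≤ 1 → ‖MA p q 1 - MA p q a‖ ≤ C0 * N / γ := by
    intro a ha ha1
    have := image_norm_le_of_norm_deriv_right_le_deriv_boundary' (f := fun ρ => MA p q ρ - MA p q a)
      (a := a) (b := 1)
      (f' := fun ρ => -(2 / ρ) * ∫ ζ, ((fderiv ℝ p (ρ • ζ) (1, 0) + fderiv ℝ q (ρ • ζ) (0, 1)) *
      (ζ.1 ^ 2 - ζ.2 ^ 2) - 2 * ζ.1 * ζ.2 * (fderiv ℝ q (ρ • ζ) (1, 0) - fderiv ℝ p (ρ • ζ) (0, 1))) * Hd ζ)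
      (B := fun ρ => C0 * N / γ * (ρ ^ γ - a ^ γ)) (B' := fun ρ => C0 * N * ρ ^ (γ - 1))
      (by fun_prop) (fun x hx => ((MA_deriv hp hq (ha.trans_le hx.1)).sub_const _).hasDerivWithinAt)
      (by simp) ?_ ?_ ?_ (x := 1) ⟨ha1, le_refl _⟩
    · refine this.trans ?_
      simp only [Real.one_rpow]
      have : 0 ≤ a ^ γ := by positivity
      have h2 : 0 ≤ C0 * N / γ := by positivity
      nlinarith
    · refine ContinuousOn.mul continuousOn_const (ContinuousOn.sub ?_ continuousOn_const)
      exact (Real.continuous_rpow_const hγ.le).continuousOn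
    · intro x hx
      have hx0 := ha.trans_le hx.1
      have := (((Real.hasDerivAt_rpow_const (p := γ) (Or.inl hx0.ne')).sub_const (a ^ γ)).const_mul (C0 * N / γ))
      refine (this.congr_deriv ?_).hasDerivWithinAt
      field_simp
    · intro x hx
      exact MA_deriv_bound hγ hN (ha.trans_le hx.1) hx.2.le hF1 hF2
  have step0 : ‖MA p q 1 - MA p q 0‖ ≤ C0 * N / γ := by
    have ht : Tendsto (fun a => ‖MA p q 1 - MA p q a‖) (𝓝[>] 0) (𝓝 ‖MA p q 1 - MA p q 0‖) :=
      ((by fun_prop : Continuous fun a => ‖MA p q 1 - MA p q a‖).tendsto 0).mono_left nhdsWithin_le_nhds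
    refine le_of_tendsto ht ?_
    have : Set.Ioc (0:ℝ) 1 ∈ 𝓝[>] (0:ℝ) := Ioc_mem_nhdsGT one_pos
    filter_upwards [this] with a ha using step a ha.1 ha.2
  have e0 : MA p q 0 = (fderiv ℝ p 0 (1, 0) - fderiv ℝ q 0 (0, 1)) * cH := by
    unfold MA; simp only [zero_smul]; rw [integral_const_mul]
  have e1 : |MA p q 1| ≤ ∫ ζ in Metric.closedBall (0 : ℝ × ℝ) 1, |fderiv ℝ p ζ (1, 0) - fderiv ℝ q ζ (0, 1)| := by
    have hcc : Continuous fun ζ : ℝ × ℝ => |fderiv ℝ p ζ (1, 0) - fderiv ℝ q ζ (0, 1)| := by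
      have h1 := fd_cont hp 1 (1, 0)
      have h2 := fd_cont hq 1 (0, 1)
      simp only [one_smul] at h1 h2
      exact (h1.sub h2).abs
    have : MA p q 1 = ∫ ζ in Metric.closedBall (0 : ℝ × ℝ) 1, (fderiv ℝ p ζ (1, 0) - fderiv ℝ q ζ (0, 1)) * Hk ζ := by
      unfold MA
      rw [setIntegral_eq_integral_of_forall_compl_eq_zero]
      · simp only [one_smul]
      intro ζ hζ
      rw [Hk_zero (by simpa using hζ), mul_zero]
    rw [this, ← Real.norm_eq_abs]
    refine norm_integral_le_of_norm_le (hcc.continuousOn.integrableOn_compact (isCompact_closedBall _ _))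
      (Eventually.of_forall fun ζ => ?_)
    rw [norm_mul, Real.norm_eq_abs, Real.norm_eq_abs]
    have h1 : |Hk ζ| ≤ 1 := by unfold Hk; rw [abs_of_nonneg (Th_nonneg _)]; exact Th_le_one _
    exact mul_le_of_le_one_right (abs_nonneg _) h1
  have e2 : |fderiv ℝ p 0 (1, 0) - fderiv ℝ q 0 (0, 1)| * cH ≤ |MA p q 1| + C0 * N / γ := by
    rw [← abs_of_pos hc, ← abs_mul, ← e0]
    rw [Real.norm_eq_abs] at step0
    have := abs_sub_abs_le_abs_sub (MA p q 0) (MA p q 1)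
    rw [abs_sub_comm] at step0; linarith
  set I := ∫ ζ in Metric.closedBall (0 : ℝ × ℝ) 1, |fderiv ℝ p ζ (1, 0) - fderiv ℝ q ζ (0, 1)|
  have hI : 0 ≤ I := (abs_nonneg _).trans e1
  rw [div_mul_eq_mul_div, le_div_iff₀ hc]
  calc _ ≤ I + C0 * N / γ := by linarith
    _ ≤ _ := by
      have : 0 ≤ C0 / γ * I := by positivity
      have e : C0 * N / γ = C0 / γ * N := by ring
      rw [e]; nlinarith

/-- version with both A and B, and with nonzero values at the origin -/
lemma lemR2 {γ : ℝ} (hγ : 0 < γ) : ∃ Cr : ℝ, 0 < Cr ∧ ∀ (p q : ℝ × ℝ → ℝ) (N κ1 κ2 : ℝ),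
    ContDiff ℝ 1 p → ContDiff ℝ 1 q → 0 ≤ N →
    (∀ ζ : ℝ × ℝ, ‖ζ‖ ≤ 1 → |fderiv ℝ p ζ (1, 0) + fderiv ℝ q ζ (0, 1) - κ1| ≤ N * ‖ζ‖ ^ γ) →
    (∀ ζ : ℝ × ℝ, ‖ζ‖ ≤ 1 → |fderiv ℝ q ζ (1, 0) - fderiv ℝ p ζ (0, 1) - κ2| ≤ N * ‖ζ‖ ^ γ) →
    |fderiv ℝ p 0 (1, 0) - fderiv ℝ q 0 (0, 1)| ≤
      Cr * ((∫ ζ in Metric.closedBall (0 : ℝ × ℝ) 1, |fderiv ℝ p ζ (1, 0) - fderiv ℝ q ζ (0, 1)|) + N + |κ1|) ∧ 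
    |fderiv ℝ q 0 (1, 0) + fderiv ℝ p 0 (0, 1)| ≤
      Cr * ((∫ ζ in Metric.closedBall (0 : ℝ × ℝ) 1, |fderiv ℝ q ζ (1, 0) + fderiv ℝ p ζ (0, 1)|) + N + |κ2|) := by
  obtain ⟨Cr, hCr, h⟩ := lemR hγ
  have gen : ∃ Cr : ℝ, 0 < Cr ∧ ∀ (p q : ℝ × ℝ → ℝ) (N κ1 κ2 : ℝ),
    ContDiff ℝ 1 p → ContDiff ℝ 1 q → 0 ≤ N →
    (∀ ζ : ℝ × ℝ, ‖ζ‖ ≤ 1 → |fderiv ℝ p ζ (1, 0) + fderiv ℝ q ζ (0, 1) - κ1| ≤ N * ‖ζ‖ ^ γ) →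
    (∀ ζ : ℝ × ℝ, ‖ζ‖ ≤ 1 → |fderiv ℝ q ζ (1, 0) - fderiv ℝ p ζ (0, 1) - κ2| ≤ N * ‖ζ‖ ^ γ) →
    |fderiv ℝ p 0 (1, 0) - fderiv ℝ q 0 (0, 1)| ≤
      Cr * ((∫ ζ in Metric.closedBall (0 : ℝ × ℝ) 1, |fderiv ℝ p ζ (1, 0) - fderiv ℝ q ζ (0, 1)|) + N + |κ1|) := by
    set V := (volume (Metric.closedBall (0 : ℝ × ℝ) 1)).toReal with hV
    have hVn : 0 ≤ V := ENNReal.toReal_nonneg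
    refine ⟨Cr * (1 + V) + 1, by positivity, ?_⟩
    intro p q N κ1 κ2 hp hq hN h1 h2
    have hp' : ContDiff ℝ 1 (fun ζ : ℝ × ℝ => p ζ - κ1 * ζ.1) := by fun_prop
    have hq' : ContDiff ℝ 1 (fun ζ : ℝ × ℝ => q ζ - κ2 * ζ.1) := by fun_prop
    have fdl : ∀ (f : ℝ × ℝ → ℝ) (κ : ℝ), ContDiff ℝ 1 f → ∀ ζ v : ℝ × ℝ,
        fderiv ℝ (fun ζ : ℝ × ℝ => f ζ - κ * ζ.1) ζ v = fderiv ℝ f ζ v - κ * v.1 := by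
      intro f κ hf ζ v
      rw [fderiv_fun_sub (hf.differentiable (by simp) ζ) (by fun_prop)]
      rw [fderiv_const_mul (by fun_prop)]
      simp [fderiv_fst]
    have := h _ _ N hp' hq' hN
    simp only [fdl p κ1 hp, fdl q κ2 hq, mul_one, mul_zero, sub_zero] at this
    have := this (fun ζ hζ => by convert h1 ζ hζ using 2; ring) (fun ζ hζ => by convert h2 ζ hζ using 2; ring)
    set I := ∫ ζ in Metric.closedBall (0 : ℝ × ℝ) 1, |fderiv ℝ p ζ (1, 0) - fderiv ℝ q ζ (0, 1)| with hI
    have hcc : Continuous fun ζ : ℝ × ℝ => fderiv ℝ p ζ (1, 0) - fderiv ℝ q ζ (0, 1) := by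
      have h1 := fd_cont hp 1 (1, 0)
      have h2 := fd_cont hq 1 (0, 1)
      simp only [one_smul] at h1 h2
      exact h1.sub h2
    have hle : (∫ ζ in Metric.closedBall (0 : ℝ × ℝ) 1, |fderiv ℝ p ζ (1, 0) - κ1 - fderiv ℝ q ζ (0, 1)|) ≤ I + V * |κ1| := by
      have i1 := hcc.abs.continuousOn.integrableOn_compact (μ := volume) (isCompact_closedBall (0 : ℝ × ℝ) 1)
      have i2 : IntegrableOn (fun _ : ℝ × ℝ => |κ1|) (Metric.closedBall 0 1) volume :=
        continuous_const.continuousOn.integrableOn_compact (isCompact_closedBall (0 : ℝ × ℝ) 1)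
      calc _ ≤ ∫ ζ in Metric.closedBall (0 : ℝ × ℝ) 1, (|fderiv ℝ p ζ (1, 0) - fderiv ℝ q ζ (0, 1)| + |κ1|) := by
            refine setIntegral_mono ?_ (i1.add i2) ?_
            · refine (Continuous.continuousOn ?_).integrableOn_compact (isCompact_closedBall (0 : ℝ × ℝ) 1)
              have : Continuous fun ζ : ℝ × ℝ => |fderiv ℝ p ζ (1, 0) - fderiv ℝ q ζ (0, 1) - κ1| := by fun_prop
              exact this.congr (fun ζ => by congr 1; ring)
            · intro ζ
              have := abs_sub (fderiv ℝ p ζ (1, 0) - fderiv ℝ q ζ (0, 1)) κ1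
              simp only
              rwa [show fderiv ℝ p ζ (1, 0) - κ1 - fderiv ℝ q ζ (0, 1) = fderiv ℝ p ζ (1, 0) - fderiv ℝ q ζ (0, 1) - κ1 by ring]
        _ = I + V * |κ1| := by
            rw [integral_add i1 i2, setIntegral_const]; rfl
    have hIn : 0 ≤ I := integral_nonneg fun _ => abs_nonneg _
    have a0 := abs_nonneg κ1
    have tri : |fderiv ℝ p 0 (1, 0) - fderiv ℝ q 0 (0, 1)| ≤ |fderiv ℝ p 0 (1, 0) - κ1 - fderiv ℝ q 0 (0, 1)| + |κ1| := by
      have := abs_add_le (fderiv ℝ p 0 (1, 0) - κ1 - fderiv ℝ q 0 (0, 1)) κ1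
      rwa [show fderiv ℝ p 0 (1, 0) - κ1 - fderiv ℝ q 0 (0, 1) + κ1 = fderiv ℝ p 0 (1, 0) - fderiv ℝ q 0 (0, 1) by ring] at this
    calc _ ≤ Cr * ((I + V * |κ1|) + N) + |κ1| := by
            refine tri.trans (add_le_add_left (this.trans ?_) _)
            gcongr
      _ ≤ _ := by
        have : 0 ≤ Cr * V * I := by positivity
        have : 0 ≤ Cr * V * N := by positivity
        have : 0 ≤ Cr * |κ1| := by positivity
        nlinarith
  obtain ⟨Cr, hCr, h⟩ := gen
  refine ⟨Cr, hCr, fun p q N κ1 κ2 hp hq hN h1 h2 => ⟨h p q N κ1 κ2 hp hq hN h1 h2, ?_⟩⟩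
  have hneg : ∀ ζ v : ℝ × ℝ, fderiv ℝ (fun ζ => - p ζ) ζ v = - fderiv ℝ p ζ v := by
    intro ζ v; rw [fderiv_fun_neg]; rfl
  have := h q (fun ζ => - p ζ) N κ2 (-κ1) hq hp.neg hN
  simp only [hneg, sub_neg_eq_add] at this
  refine this (fun ζ hζ => by simpa [sub_eq_add_neg] using h2 ζ hζ) (fun ζ hζ => ?_)
  have := h1 ζ hζ
  rw [← abs_neg]
  convert this using 2; ring

lemma abs_cross_le {a b : ℝ × ℝ} {A B : ℝ} (ha : ‖a‖ ≤ A) (hb : ‖b‖ ≤ B) :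
    |a.1 * b.2 - a.2 * b.1| ≤ 2 * A * B := by
  have a1 : |a.1| ≤ A := (norm_fst_le a).trans ha
  have a2 : |a.2| ≤ A := (norm_snd_le a).trans ha
  have b1 : |b.1| ≤ B := (norm_fst_le b).trans hb
  have b2 : |b.2| ≤ B := (norm_snd_le b).trans hb
  have hA : 0 ≤ A := (abs_nonneg _).trans a1
  calc _ ≤ |a.1| * |b.2| + |a.2| * |b.1| := by rw [← abs_mul, ← abs_mul]; exact abs_sub _ _
    _ ≤ A * B + A * B := by gcongr
    _ = _ := by ring

lemma dirB (l : ℝ × ℝ →L[ℝ] ℝ) (S T w : ℝ × ℝ) {L : ℝ} (hS : ‖S‖ ≤ L) (hT : ‖T‖ ≤ L)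
    (hd : 1 ≤ L * |S.1 * T.2 - S.2 * T.1|) :
    |l w| ≤ 2 * L ^ 2 * ‖w‖ * (|l S| + |l T|) := by
  have hL : 0 ≤ L := (norm_nonneg _).trans hS
  have e : (S.1 * T.2 - S.2 * T.1) • w = (w.1 * T.2 - w.2 * T.1) • S + (S.1 * w.2 - S.2 * w.1) • T := by
    ext <;> simp <;> ring
  have e2 : (S.1 * T.2 - S.2 * T.1) * l w = (w.1 * T.2 - w.2 * T.1) * l S + (S.1 * w.2 - S.2 * w.1) * l T := by
    have := congrArg l e
    simpa using this
  have h1 := abs_cross_le (le_refl ‖w‖) hT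
  have h2 := abs_cross_le hS (le_refl ‖w‖)
  have h3 : |S.1 * T.2 - S.2 * T.1| * |l w| ≤ 2 * L * ‖w‖ * (|l S| + |l T|) := by
    rw [← abs_mul, e2]
    calc _ ≤ |w.1 * T.2 - w.2 * T.1| * |l S| + |S.1 * w.2 - S.2 * w.1| * |l T| := by
            rw [← abs_mul, ← abs_mul]; exact abs_add_le _ _
      _ ≤ (2 * ‖w‖ * L) * |l S| + (2 * L * ‖w‖) * |l T| := by gcongr
      _ = _ := by ring
  calc |l w| = 1 * |l w| := by ring
    _ ≤ (L * |S.1 * T.2 - S.2 * T.1|) * |l w| := by gcongr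
    _ = L * (|S.1 * T.2 - S.2 * T.1| * |l w|) := by ring
    _ ≤ L * (2 * L * ‖w‖ * (|l S| + |l T|)) := by gcongr
    _ = _ := by ring

lemma chol {L a11 a12 a22 : ℝ} (hL : 1 ≤ L) (h11 : |a11| ≤ L) (h12 : |a12| ≤ L) (h22 : |a22| ≤ L)
    (hp : 1 ≤ L * a11) (hd : 1 ≤ L * (a11 * a22 - a12 ^ 2)) :
    ∃ l11 l21 l22 : ℝ, 0 < l11 ∧ 0 < l22 ∧ l11 ≤ L ^ 2 ∧ |l21| ≤ L ^ 2 ∧ l22 ≤ L ^ 2 ∧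
      1 ≤ L ^ 2 * l11 ∧ 1 ≤ L ^ 2 * l22 ∧ l11 * l11 = a11 ∧ l11 * l21 = a12 ∧ l21 * l21 + l22 * l22 = a22 := by
  have hL0 : 0 < L := by linarith
  have ha : 0 < a11 := by by_contra h; push Not at h; nlinarith
  have hdp : 0 < a11 * a22 - a12 ^ 2 := by by_contra h; push Not at h; nlinarith
  have h11' := (abs_le.1 h11).2
  have h22' := (abs_le.1 h22).2
  set l := √a11 with hl
  have hl0 : 0 < l := Real.sqrt_pos.2 ha
  have hll : l * l = a11 := Real.mul_self_sqrt ha.le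
  set m := √((a11 * a22 - a12 ^ 2) / a11) with hm
  have hm0 : 0 < m := Real.sqrt_pos.2 (by positivity)
  have hmm : m * m = (a11 * a22 - a12 ^ 2) / a11 := Real.mul_self_sqrt (by positivity)
  have hll1 : 1 ≤ L * l := by
    by_contra h; push Not at h
    have : (L * l) * (L * l) < 1 := by nlinarith [mul_pos hL0 hl0]
    have h3 : L * (L * a11) < 1 := by rw [← hll]; linarith
    nlinarith
  have hlL : l ≤ L := by
    by_contra h; push Not at h
    nlinarith
  have hmm2 : a12 / l * (a12 / l) + m * m = a22 := by
    rw [hmm]; field_simp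
    rw [show l ^ 2 = a11 by rw [← hll]; ring]; ring
  have hmL : m ≤ L := by
    by_contra h; push Not at h
    nlinarith [mul_self_nonneg (a12 / l)]
  have hm1 : 1 ≤ L * m := by
    have : 1 ≤ L ^ 2 * (m * m) := by
      rw [hmm, mul_div_assoc', le_div_iff₀ ha]
      nlinarith
    by_contra h; push Not at h
    have : (L * m) * (L * m) < 1 := by nlinarith [mul_pos hL0 hm0]
    nlinarith
  refine ⟨l, a12 / l, m, hl0, hm0, by nlinarith, ?_, by nlinarith, by nlinarith [mul_pos hL0 hl0], by nlinarith [mul_pos hL0 hm0], hll, by field_simp, hmm2⟩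
  rw [abs_div, abs_of_pos hl0, div_le_iff₀ hl0]
  nlinarith

def Dd (S T : ℝ × ℝ → ℝ × ℝ) (ε : ℝ) (v1 v2 : ℝ × ℝ → ℝ) (y : ℝ × ℝ) : ℝ :=
  |fderiv ℝ v1 y (S y)| + |fderiv ℝ v2 y (S y)| + |ε * fderiv ℝ v1 y (T y)| + |ε * fderiv ℝ v2 y (T y)|

structure Loc (L γ ε ω : ℝ) (x : ℝ × ℝ) (S T : ℝ × ℝ → ℝ × ℝ)
    (a11 a12 a22 e1 e2 v1 v2 : ℝ × ℝ → ℝ) : Prop where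
  hv1 : ContDiff ℝ 1 v1
  hv2 : ContDiff ℝ 1 v2
  cS : Continuous S
  cT : Continuous T
  hS : ∀ y ∈ Metric.closedBall x (ω / 2), ‖S y‖ ≤ L
  hT : ∀ y ∈ Metric.closedBall x (ω / 2), ‖T y‖ ≤ L
  hd : ∀ y ∈ Metric.closedBall x (ω / 2), 1 ≤ L * |(S y).1 * (T y).2 - (S y).2 * (T y).1|
  lS : ∀ y ∈ Metric.closedBall x (ω / 2), ‖S x - S y‖ ≤ L * ‖y - x‖
  lT : ∀ y ∈ Metric.closedBall x (ω / 2), ‖T x - T y‖ ≤ L * ‖y - x‖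
  b11 : |a11 x| ≤ L
  b12 : |a12 x| ≤ L
  b22 : |a22 x| ≤ L
  h11 : ∀ y ∈ Metric.closedBall x (ω / 2), |a11 x - a11 y| ≤ L * ‖y - x‖ ^ γ
  h12 : ∀ y ∈ Metric.closedBall x (ω / 2), |a12 x - a12 y| ≤ L * ‖y - x‖ ^ γ
  h22 : ∀ y ∈ Metric.closedBall x (ω / 2), |a22 x - a22 y| ≤ L * ‖y - x‖ ^ γ
  el : 1 ≤ L * a11 x
  ed : 1 ≤ L * (a11 x * a22 x - a12 x ^ 2)
  eq : ∀ y ∈ Metric.closedBall x (ω / 2), a11 y * fderiv ℝ v1 y (S y) + a12 y * fderiv ℝ v2 y (S y)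
    + a12 y * (ε * fderiv ℝ v1 y (T y)) + a22 y * (ε * fderiv ℝ v2 y (T y)) = 0
  cr : ∀ y ∈ Metric.closedBall x (ω / 2), fderiv ℝ v2 y (S y) - ε * fderiv ℝ v1 y (T y)
    = e1 y * (ε * v1 y) + e2 y * v2 y
  be1 : ∀ y ∈ Metric.closedBall x (ω / 2), |e1 y| ≤ L
  be2 : ∀ y ∈ Metric.closedBall x (ω / 2), |e2 y| ≤ L
  he1 : ∀ y ∈ Metric.closedBall x (ω / 2), |e1 y - e1 x| ≤ L * ε ^ (-(1/10) : ℝ) * ‖y - x‖ ^ γ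
  he2 : ∀ y ∈ Metric.closedBall x (ω / 2), |e2 y - e2 x| ≤ L * ε ^ (-(1/10) : ℝ) * ‖y - x‖ ^ γ
  hD : ∀ y ∈ Metric.closedBall x (ω / 2), Dd S T ε v1 v2 y ≤ 2 * Dd S T ε v1 v2 x

/-- freezing the fields at x -/
lemma frz {ε L : ℝ} (hε : 0 < ε) (hε1 : ε ≤ 1) (S T : ℝ × ℝ → ℝ × ℝ) (v : ℝ × ℝ → ℝ) {x y : ℝ × ℝ}
    (hL : 1 ≤ L) (hS : ‖S y‖ ≤ L) (hT : ‖T y‖ ≤ L) (hd : 1 ≤ L * |(S y).1 * (T y).2 - (S y).2 * (T y).1|)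
    (lS : ‖S x - S y‖ ≤ L * ‖y - x‖) (lT : ‖T x - T y‖ ≤ L * ‖y - x‖) {t E : ℝ} (ht : ‖y - x‖ ≤ t * ε)
    (hE : |fderiv ℝ v y (S y)| + |ε * fderiv ℝ v y (T y)| ≤ E) :
    |fderiv ℝ v y (S x) - fderiv ℝ v y (S y)| ≤ 2 * L ^ 3 * t * E ∧
    |ε * fderiv ℝ v y (T x) - ε * fderiv ℝ v y (T y)| ≤ 2 * L ^ 3 * t * E := by
  have hE0 : 0 ≤ E := le_trans (by positivity) hE
  have ht0 : 0 ≤ t := by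
    by_contra h; push Not at h
    nlinarith [norm_nonneg (y - x)]
  have key : |fderiv ℝ v y (S y)| + |fderiv ℝ v y (T y)| ≤ E / ε := by
    rw [le_div_iff₀ hε]
    rw [abs_mul, abs_of_pos hε] at hE
    nlinarith [abs_nonneg (fderiv ℝ v y (S y))]
  have gen : ∀ w : ℝ × ℝ, ‖w‖ ≤ L * ‖y - x‖ → |fderiv ℝ v y w| ≤ 2 * L ^ 3 * t * E := by
    intro w hw
    have h := dirB (fderiv ℝ v y) (S y) (T y) w hS hT hd
    calc _ ≤ 2 * L ^ 2 * ‖w‖ * (|fderiv ℝ v y (S y)| + |fderiv ℝ v y (T y)|) := h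
      _ ≤ 2 * L ^ 2 * (L * (t * ε)) * (E / ε) := by gcongr; exact hw.trans (by gcongr)
      _ = _ := by field_simp
  constructor
  · rw [← map_sub]; exact gen _ lS
  · rw [← mul_sub, ← map_sub, abs_mul, abs_of_pos hε]
    have := gen _ lT
    nlinarith [abs_nonneg (fderiv ℝ v y (T x - T y))]

lemma alg_up {Λ l11 l21 l22 s1 s2 t1 t2 : ℝ} (hΛ : 1 ≤ Λ) (h1 : |l11| ≤ Λ) (h2 : |l21| ≤ Λ) (h3 : |l22| ≤ Λ) :
    |(l11 * (l11 * s1 + l21 * t1) + l21 * (l11 * s2 + l21 * t2)) - l22 * (l22 * t2)| ≤ 3 * Λ ^ 2 * (|s1| + |s2| + |t1| + |t2|) ∧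
    |l22 * (l11 * s2 + l21 * t2) + (l11 * (l22 * t1) + l21 * (l22 * t2))| ≤ 3 * Λ ^ 2 * (|s1| + |s2| + |t1| + |t2|) := by
  have m : ∀ a b c : ℝ, |a| ≤ Λ → |b| ≤ Λ → |a * (b * c)| ≤ Λ ^ 2 * |c| := by
    intro a b c ha hb
    rw [abs_mul, abs_mul]
    calc _ ≤ Λ * (Λ * |c|) := by gcongr
      _ = _ := by ring
  have p1 : 0 ≤ Λ ^ 2 * |s1| := by positivity
  have p2 : 0 ≤ Λ ^ 2 * |s2| := by positivity
  have p3 : 0 ≤ Λ ^ 2 * |t1| := by positivity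
  have p4 : 0 ≤ Λ ^ 2 * |t2| := by positivity
  constructor
  · have a1 := abs_le.1 (m l11 l11 s1 h1 h1)
    have a2 := abs_le.1 (m l11 l21 t1 h1 h2)
    have a3 := abs_le.1 (m l21 l11 s2 h2 h1)
    have a4 := abs_le.1 (m l21 l21 t2 h2 h2)
    have a5 := abs_le.1 (m l22 l22 t2 h3 h3)
    rw [abs_le]; constructor <;> nlinarith
  · have a1 := abs_le.1 (m l22 l11 s2 h3 h1)
    have a2 := abs_le.1 (m l22 l21 t2 h3 h2)
    have a3 := abs_le.1 (m l11 l22 t1 h1 h3)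
    have a4 := abs_le.1 (m l21 l22 t2 h2 h3)
    rw [abs_le]; constructor <;> nlinarith

lemma div_b {Λ l x : ℝ} (hl : 0 < l) (h : 1 ≤ Λ * l) : |x| ≤ Λ * |l * x| := by
  rw [abs_mul, abs_of_pos hl, ← mul_assoc]
  nlinarith [abs_nonneg x]

lemma alg_down {Λ l11 l21 l22 s1 s2 t1 t2 A B F1 F2 : ℝ} (hΛ : 1 ≤ Λ) (h10 : 0 < l11) (h30 : 0 < l22)
    (h2 : |l21| ≤ Λ) (h1i : 1 ≤ Λ * l11) (h3i : 1 ≤ Λ * l22)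
    (hA : (l11 * (l11 * s1 + l21 * t1) + l21 * (l11 * s2 + l21 * t2)) - l22 * (l22 * t2) = A)
    (hF1 : (l11 * (l11 * s1 + l21 * t1) + l21 * (l11 * s2 + l21 * t2)) + l22 * (l22 * t2) = F1)
    (hB : l22 * (l11 * s2 + l21 * t2) + (l11 * (l22 * t1) + l21 * (l22 * t2)) = B)
    (hF2 : l22 * (l11 * s2 + l21 * t2) - (l11 * (l22 * t1) + l21 * (l22 * t2)) = F2) :
    |s1| + |s2| + |t1| + |t2| ≤ 12 * Λ ^ 6 * (|A| + |B| + |F1| + |F2|) := by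
  set m := |A| + |B| + |F1| + |F2| with hm
  have hm0 : 0 ≤ m := by positivity
  have hΛ0 : 0 < Λ := by linarith
  have A1 := abs_le.1 (le_refl |A|)
  have B1 := abs_le.1 (le_refl |B|)
  have C1 := abs_le.1 (le_refl |F1|)
  have D1 := abs_le.1 (le_refl |F2|)
  have q1 : |l22 * (l11 * s2 + l21 * t2)| ≤ m := by rw [abs_le]; constructor <;> linarith [abs_nonneg A, abs_nonneg B, abs_nonneg F1, abs_nonneg F2]
  have q2 : |l22 * (l22 * t2)| ≤ m := by rw [abs_le]; constructor <;> linarith [abs_nonneg A, abs_nonneg B, abs_nonneg F1, abs_nonneg F2]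
  have q3 : |l11 * (l11 * s1 + l21 * t1) + l21 * (l11 * s2 + l21 * t2)| ≤ m := by rw [abs_le]; constructor <;> linarith [abs_nonneg A, abs_nonneg B, abs_nonneg F1, abs_nonneg F2]
  have q4 : |l11 * (l22 * t1) + l21 * (l22 * t2)| ≤ m := by rw [abs_le]; constructor <;> linarith [abs_nonneg A, abs_nonneg B, abs_nonneg F1, abs_nonneg F2]
  have pw : ∀ i j : ℕ, i ≤ j → Λ ^ i * m ≤ Λ ^ j * m := fun i j h => by gcongr
  have l2P : |l11 * s2 + l21 * t2| ≤ Λ * m := (div_b h30 h3i).trans (by gcongr)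
  have l2Q : |l22 * t2| ≤ Λ * m := (div_b h30 h3i).trans (by gcongr)
  have two : ∀ X Y Z : ℝ, |l11 * X + l21 * Y| ≤ Z → |X| ≤ Λ * (Z + Λ * |Y|) := by
    intro X Y Z h
    have h' : |l11 * X| ≤ Z + Λ * |Y| := by
      have e : l11 * X = (l11 * X + l21 * Y) - l21 * Y := by ring
      rw [e]
      calc _ ≤ |l11 * X + l21 * Y| + |l21 * Y| := abs_sub _ _
        _ ≤ Z + Λ * |Y| := by rw [abs_mul l21]; gcongr
    exact (div_b h10 h1i).trans (by gcongr)
  have l1P : |l11 * s1 + l21 * t1| ≤ 2 * (Λ ^ 3 * m) := by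
    have := two _ _ _ q3
    have h5 : Λ * (m + Λ * |l11 * s2 + l21 * t2|) ≤ Λ * (m + Λ * (Λ * m)) := by gcongr
    have := pw 1 3 (by norm_num)
    linarith
  have l1Q : |l22 * t1| ≤ 2 * (Λ ^ 3 * m) := by
    have := two _ _ _ q4
    have h5 : Λ * (m + Λ * |l22 * t2|) ≤ Λ * (m + Λ * (Λ * m)) := by gcongr
    have := pw 1 3 (by norm_num)
    linarith
  have bt1 : |t1| ≤ Λ * (2 * (Λ ^ 3 * m)) := (div_b h30 h3i).trans (by gcongr)
  have bt2 : |t2| ≤ Λ * (Λ * m) := (div_b h30 h3i).trans (by gcongr)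
  have bs1 : |s1| ≤ Λ * (2 * (Λ ^ 3 * m) + Λ * (Λ * (2 * (Λ ^ 3 * m)))) := (two _ _ _ l1P).trans (by gcongr)
  have bs2 : |s2| ≤ Λ * (Λ * m + Λ * (Λ * (Λ * m))) := (two _ _ _ l2P).trans (by gcongr)
  have := pw 4 6 (by norm_num)
  have := pw 2 6 (by norm_num)
  have : 0 ≤ Λ ^ 6 * m := by positivity
  linarith

section
variable {L γ ε ω : ℝ} {x : ℝ × ℝ} {S T : ℝ × ℝ → ℝ × ℝ} {a11 a12 a22 e1 e2 v1 v2 : ℝ × ℝ → ℝ}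

def Dfz (S T : ℝ × ℝ → ℝ × ℝ) (ε : ℝ) (v1 v2 : ℝ × ℝ → ℝ) (x y : ℝ × ℝ) : ℝ :=
  |fderiv ℝ v1 y (S x)| + |fderiv ℝ v2 y (S x)| + |ε * fderiv ℝ v1 y (T x)| + |ε * fderiv ℝ v2 y (T x)|

set_option maxHeartbeats 1000000 in
lemma Loc.pt (h : Loc L γ ε ω x S T a11 a12 a22 e1 e2 v1 v2) (hε : 0 < ε) (hε1 : ε ≤ 1) (hL : 1 ≤ L)
    (hγ : 0 < γ) (hγ1 : γ ≤ 1) (hω : 0 < ω)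
    {y : ℝ × ℝ} (hy : y ∈ Metric.closedBall x (ω / 2)) {t : ℝ} (ht0 : 0 ≤ t) (ht1 : t ≤ 1) (ht : ‖y - x‖ ≤ t * ε) :
    Dfz S T ε v1 v2 x y ≤ 5 * L ^ 3 * Dd S T ε v1 v2 y ∧
    |a11 x * fderiv ℝ v1 y (S x) + a12 x * (fderiv ℝ v2 y (S x) + (ε * fderiv ℝ v1 y (T x))) + a22 x * (ε * fderiv ℝ v2 y (T x))|
      ≤ 10 * L ^ 4 * t ^ γ * Dd S T ε v1 v2 x ∧
    |fderiv ℝ v2 y (S x) - (ε * fderiv ℝ v1 y (T x)) - (e1 x * (ε * v1 x) + e2 x * v2 x)|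
      ≤ 4 * L ^ 3 * t ^ γ * Dd S T ε v1 v2 x + L * ε ^ (-(1/10) : ℝ) * t ^ γ * (ε * |v1 x| + |v2 x|)
        + L * (ε * |v1 y - v1 x| + |v2 y - v2 x|) := by
  have hD := h.hD y hy
  have hxB : x ∈ Metric.closedBall x (ω / 2) := Metric.mem_closedBall_self (by linarith)
  have heq := h.eq y hy
  have hcr := h.cr y hy
  set D := Dd S T ε v1 v2 x
  obtain ⟨f1, f2⟩ := frz hε hε1 S T v1 hL (h.hS y hy) (h.hT y hy) (h.hd y hy) (h.lS y hy) (h.lT y hy) ht (le_refl _)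
  obtain ⟨f3, f4⟩ := frz hε hε1 S T v2 hL (h.hS y hy) (h.hT y hy) (h.hd y hy) (h.lS y hy) (h.lT y hy) ht (le_refl _)
  have htg : t ≤ t ^ γ := Real.self_le_rpow_of_le_one ht0 ht1 hγ1
  have htg0 : 0 ≤ t ^ γ := by positivity
  have hη : ‖y - x‖ ^ γ ≤ t ^ γ := Real.rpow_le_rpow (norm_nonneg _) (ht.trans (by nlinarith)) hγ.le
  have h11 := (h.h11 y hy).trans (mul_le_mul_of_nonneg_left hη (by linarith))
  have h12 := (h.h12 y hy).trans (mul_le_mul_of_nonneg_left hη (by linarith))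
  have h22 := (h.h22 y hy).trans (mul_le_mul_of_nonneg_left hη (by linarith))
  have he1 := (h.he1 y hy).trans (mul_le_mul_of_nonneg_left hη (by positivity))
  have he2 := (h.he2 y hy).trans (mul_le_mul_of_nonneg_left hη (by positivity))
  have be1 := h.be1 y hy
  have be2 := h.be2 y hy
  have b11 := h.b11
  have b12 := h.b12
  have b22 := h.b22
  unfold Dfz
  unfold Dd at *
  set α1 := fderiv ℝ v1 y (S y)
  set α2 := fderiv ℝ v2 y (S y)
  set β1 := ε * fderiv ℝ v1 y (T y)
  set β2 := ε * fderiv ℝ v2 y (T y)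
  set s1 := fderiv ℝ v1 y (S x)
  set s2 := fderiv ℝ v2 y (S x)
  set t1 := ε * fderiv ℝ v1 y (T x)
  set t2 := ε * fderiv ℝ v2 y (T x)
  have E1 : 0 ≤ |α1| + |β1| := by positivity
  have E2 : 0 ≤ |α2| + |β2| := by positivity
  have q : 2 * L ^ 3 * t ≤ 2 * L ^ 3 * t ^ γ := by gcongr
  have q1 : 2 * L ^ 3 * t ≤ 2 * L ^ 3 := by nlinarith [pow_pos (by linarith : 0 < L) 3]
  have L3 : 1 ≤ L ^ 3 := one_le_pow₀ hL
  have DE : |α1| + |α2| + |β1| + |β2| = (|α1| + |β1|) + (|α2| + |β2|) := by ring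
  rw [DE] at hD ⊢
  set F1 := |α1| + |β1| with hF1
  set F2 := |α2| + |β2| with hF2
  refine ⟨?_, ?_, ?_⟩
  · have g1 : |s1| ≤ |α1| + |s1 - α1| := by have := abs_add_le α1 (s1 - α1); simpa using this
    have g2 : |s2| ≤ |α2| + |s2 - α2| := by have := abs_add_le α2 (s2 - α2); simpa using this
    have g3 : |t1| ≤ |β1| + |t1 - β1| := by have := abs_add_le β1 (t1 - β1); simpa using this
    have g4 : |t2| ≤ |β2| + |t2 - β2| := by have := abs_add_le β2 (t2 - β2); simpa using this
    have r1 : 2 * L ^ 3 * t * F1 ≤ 2 * L ^ 3 * F1 := mul_le_mul_of_nonneg_right q1 E1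
    have r2 : 2 * L ^ 3 * t * F2 ≤ 2 * L ^ 3 * F2 := mul_le_mul_of_nonneg_right q1 E2
    nlinarith
  · have e : a11 x * s1 + a12 x * (s2 + t1) + a22 x * t2 =
      (a11 x * (s1 - α1) + a12 x * (s2 - α2) + a12 x * (t1 - β1) + a22 x * (t2 - β2)) +
      ((a11 x - a11 y) * α1 + (a12 x - a12 y) * α2 + (a12 x - a12 y) * β1 + (a22 x - a22 y) * β2) := by
      linear_combination heq
    rw [e]
    have bd : ∀ {a b A B : ℝ}, |a| ≤ A → |b| ≤ B → |a * b| ≤ A * B := by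
      intro a b A B ha hb
      rw [abs_mul]; exact mul_le_mul ha hb (abs_nonneg _) ((abs_nonneg _).trans ha)
    have c1 := abs_le.1 (bd b11 f1)
    have c2 := abs_le.1 (bd b12 f3)
    have c3 := abs_le.1 (bd b12 f2)
    have c4 := abs_le.1 (bd b22 f4)
    have d1 := abs_le.1 (bd h11 (le_refl |α1|))
    have d2 := abs_le.1 (bd h12 (le_refl |α2|))
    have d3 := abs_le.1 (bd h12 (le_refl |β1|))
    have d4 := abs_le.1 (bd h22 (le_refl |β2|))
    have fin : 2 * (L * (2 * L ^ 3 * t * F1)) + 2 * (L * (2 * L ^ 3 * t * F2)) + L * t ^ γ * (F1 + F2) ≤ 10 * L ^ 4 * t ^ γ * D := by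
      calc _ = (4 * L ^ 4 * t + L * t ^ γ) * (F1 + F2) := by ring
        _ ≤ (4 * L ^ 4 * t ^ γ + L ^ 4 * t ^ γ) * (2 * D) := by
          gcongr
          exact le_self_pow₀ hL (by norm_num)
        _ = _ := by ring
    rw [abs_le]
    constructor <;> linarith
  · have e : s2 - t1 - (e1 x * (ε * v1 x) + e2 x * v2 x) = (s2 - α2) - (t1 - β1)
        + ((e1 y - e1 x) * (ε * v1 x) + (e2 y - e2 x) * v2 x)
        + (e1 y * (ε * (v1 y - v1 x)) + e2 y * (v2 y - v2 x)) := by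
      linear_combination hcr
    rw [e]
    have bd : ∀ {a b A B : ℝ}, |a| ≤ A → |b| ≤ B → |a * b| ≤ A * B := by
      intro a b A B ha hb
      rw [abs_mul]; exact mul_le_mul ha hb (abs_nonneg _) ((abs_nonneg _).trans ha)
    have ae : ∀ z : ℝ, |ε * z| ≤ ε * |z| := fun z => by rw [abs_mul, abs_of_pos hε]
    have c1 := abs_le.1 f3
    have c2 := abs_le.1 f2
    have d1 := abs_le.1 (bd he1 (ae (v1 x)))
    have d2 := abs_le.1 (bd he2 (le_refl |v2 x|))
    have d3 := abs_le.1 (bd be1 (ae (v1 y - v1 x)))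
    have d4 := abs_le.1 (bd be2 (le_refl |v2 y - v2 x|))
    have fin : 2 * L ^ 3 * t * F1 + 2 * L ^ 3 * t * F2 ≤ 4 * L ^ 3 * t ^ γ * D := by
      calc _ = 2 * L ^ 3 * t * (F1 + F2) := by ring
        _ ≤ 2 * L ^ 3 * t ^ γ * (2 * D) := by gcongr
        _ = _ := by ring
    rw [abs_le]
    constructor <;> linarith
end

def Psi (x : ℝ × ℝ) (r : ℝ) (P Q : ℝ × ℝ) (ζ : ℝ × ℝ) : ℝ × ℝ := x + r • (ζ.1 • P + ζ.2 • Q)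

lemma Psi_contDiff (x : ℝ × ℝ) (r : ℝ) (P Q : ℝ × ℝ) : ContDiff ℝ 1 (Psi x r P Q) := by
  unfold Psi; fun_prop

lemma Psi_zero (x : ℝ × ℝ) (r : ℝ) (P Q : ℝ × ℝ) : Psi x r P Q 0 = x := by simp [Psi]

lemma Psi_fderiv {v : ℝ × ℝ → ℝ} (hv : ContDiff ℝ 1 v) (x : ℝ × ℝ) (r : ℝ) (P Q ζ w : ℝ × ℝ) :
    fderiv ℝ (fun ζ => v (Psi x r P Q ζ)) ζ w =
      r * (w.1 * fderiv ℝ v (Psi x r P Q ζ) P + w.2 * fderiv ℝ v (Psi x r P Q ζ) Q) := by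
  have h1 : HasFDerivAt v (fderiv ℝ v (Psi x r P Q ζ)) (Psi x r P Q ζ) := (hv.differentiable (by simp) _).hasFDerivAt
  have h2 : HasFDerivAt (Psi x r P Q) (r • ((ContinuousLinearMap.fst ℝ ℝ ℝ).smulRight P +
      (ContinuousLinearMap.snd ℝ ℝ ℝ).smulRight Q)) ζ := by
    unfold Psi
    exact (((hasFDerivAt_fst.smul_const P).add (hasFDerivAt_snd.smul_const Q)).const_smul r).const_add x
  have h3 : HasFDerivAt (fun ζ => v (Psi x r P Q ζ)) _ ζ := h1.comp ζ h2
  rw [h3.fderiv]; simp; ring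

lemma Psi_dist (x : ℝ × ℝ) {r : ℝ} (hr : 0 ≤ r) {P Q : ℝ × ℝ} {p q : ℝ} (hP : ‖P‖ ≤ p) (hQ : ‖Q‖ ≤ q) (ζ : ℝ × ℝ) :
    ‖Psi x r P Q ζ - x‖ ≤ r * (‖ζ‖ * (p + q)) := by
  unfold Psi
  rw [add_sub_cancel_left, norm_smul, Real.norm_eq_abs, abs_of_nonneg hr]
  gcongr
  calc _ ≤ ‖ζ.1 • P‖ + ‖ζ.2 • Q‖ := norm_add_le _ _
    _ ≤ ‖ζ‖ * p + ‖ζ‖ * q := by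
      rw [norm_smul, norm_smul]; gcongr
      · exact norm_fst_le ζ
      · exact norm_snd_le ζ
    _ = _ := by ring

lemma Dd_cont {S T : ℝ × ℝ → ℝ × ℝ} {v1 v2 : ℝ × ℝ → ℝ} (ε : ℝ) (cS : Continuous S) (cT : Continuous T)
    (h1 : ContDiff ℝ 1 v1) (h2 : ContDiff ℝ 1 v2) : Continuous (Dd S T ε v1 v2) := by
  unfold Dd
  have a1 := h1.continuous_fderiv (by simp)
  have a2 := h2.continuous_fderiv (by simp)
  exact ((((a1.clm_apply cS).abs.add (a2.clm_apply cS).abs).add (((a1.clm_apply cT).const_mul ε).abs)).add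
    ((a2.clm_apply cT).const_mul ε).abs)

lemma Dd_nonneg (S T : ℝ × ℝ → ℝ × ℝ) (v1 v2 : ℝ × ℝ → ℝ) (ε : ℝ) (y : ℝ × ℝ) : 0 ≤ Dd S T ε v1 v2 y := by
  unfold Dd; positivity

/-- final absorption arithmetic -/
lemma absorb {L Cr V θg D ID A0 B0 F1 F2 κ IA IB N w IW th w0 : ℝ} (hL : 1 ≤ L) (hCr : 0 < Cr) (hV : 0 < V)
    (hth0 : 0 ≤ th) (hth : th ≤ θg) (hθ1 : θg ≤ 1) (hD : 0 ≤ D) (hw : 0 ≤ w) (hID : 0 ≤ ID) (hIW : 0 ≤ IW)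
    (h1 : D ≤ 12 * (L ^ 2) ^ 6 * (A0 + B0 + F1 + F2)) (hF1 : F1 = 0) (hF2 : F2 ≤ κ)
    (hA : A0 ≤ Cr * (IA + N + 0)) (hB : B0 ≤ Cr * (IB + N + κ)) (hIA : IA ≤ 15 * L ^ 7 * ID)
    (hIB : IB ≤ 15 * L ^ 7 * ID) (hN : N = 44 * L ^ 10 * θg * (D + w)) (hκ : κ ≤ L ^ 5 * w0) (hw0 : w0 ≤ w)
    (hw1 : w ≤ 1 / V * IW + 40 * L ^ 5 * th * D) :
    D ≤ (360 * Cr * L ^ 19 + 1056 * Cr * L ^ 22 + (1056 * Cr * L ^ 22 + 12 * (Cr + 1) * L ^ 17) * (1 / V) +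
      40 * L ^ 5 * (1056 * Cr * L ^ 22 + 12 * (Cr + 1) * L ^ 17)) * (ID + IW + θg * D) := by
  have hL0 : 0 < L := by linarith
  have hκ' : κ ≤ L ^ 5 * w := hκ.trans (by gcongr)
  have g0 : 0 ≤ θg := hth0.trans hth
  have s1 : D ≤ 12 * L ^ 12 * (Cr * (30 * L ^ 7 * ID + 2 * (44 * L ^ 10 * θg * (D + w))) + (Cr + 1) * (L ^ 5 * w)) := by
    calc D ≤ 12 * (L ^ 2) ^ 6 * (A0 + B0 + F1 + F2) := h1
      _ = 12 * L ^ 12 * (A0 + B0 + F2) := by rw [hF1]; ring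
      _ ≤ 12 * L ^ 12 * (Cr * (15 * L ^ 7 * ID + N + 0) + Cr * (15 * L ^ 7 * ID + N + L ^ 5 * w) + L ^ 5 * w) := by
        gcongr
        · exact hA.trans (by gcongr)
        · exact hB.trans (by gcongr)
        · exact hF2.trans hκ'
      _ = _ := by rw [hN]; ring
  have s2 : L ^ 22 * θg * w ≤ L ^ 22 * 1 * w := by gcongr
  have s3 : D ≤ 360 * Cr * L ^ 19 * ID + 1056 * Cr * L ^ 22 * (θg * D) + (1056 * Cr * L ^ 22 + 12 * (Cr + 1) * L ^ 17) * w := by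
    have := mul_le_mul_of_nonneg_left s2 hCr.le
    linarith
  have s4 : w ≤ 1 / V * IW + 40 * L ^ 5 * (θg * D) := by
    have : 40 * L ^ 5 * th * D ≤ 40 * L ^ 5 * θg * D := by gcongr
    linarith
  set K1 := 360 * Cr * L ^ 19
  set K2 := 1056 * Cr * L ^ 22
  set K3 := K2 + 12 * (Cr + 1) * L ^ 17
  have k1 : 0 ≤ K1 := by positivity
  have k2 : 0 ≤ K2 := by positivity
  have k3 : 0 ≤ K3 := by positivity
  have s5 := mul_le_mul_of_nonneg_left s4 k3
  have gD : 0 ≤ θg * D := by positivity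
  have n1 : 0 ≤ K1 * IW := by positivity
  have n2 : 0 ≤ K1 * (θg * D) := by positivity
  have n3 : 0 ≤ K2 * IW := by positivity
  have n4 : 0 ≤ K2 * ID := by positivity
  have n5 : 0 ≤ K3 * (1 / V) * ID := by positivity
  have n6 : 0 ≤ K3 * (1 / V) * (θg * D) := by positivity
  have n7 : 0 ≤ 40 * L ^ 5 * K3 * ID := by positivity
  have n8 : 0 ≤ 40 * L ^ 5 * K3 * IW := by positivity
  linarith

set_option maxHeartbeats 2000000 in
lemma core {γ L : ℝ} (hγ : 0 < γ) (hγ1 : γ ≤ 1) (hL : 1 ≤ L) : ∃ C5 : ℝ, 0 < C5 ∧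
    ∀ θ : ℝ, 0 < θ → θ ≤ 1 / 2 → ∀ (ε ω : ℝ) (x : ℝ × ℝ) (S T : ℝ × ℝ → ℝ × ℝ) (a11 a12 a22 e1 e2 v1 v2 : ℝ × ℝ → ℝ),
    0 < ε → ε ≤ 1 → 0 < ω → ω ≤ 1 → Loc L γ ε ω x S T a11 a12 a22 e1 e2 v1 v2 →
    ∃ P Q : ℝ × ℝ, ε ≤ L ^ 5 * |P.1 * Q.2 - P.2 * Q.1| ∧
      (∀ ζ : ℝ × ℝ, ‖ζ‖ ≤ 1 → Psi x (θ / (3 * L ^ 3) * ε * ω) P Q ζ ∈ Metric.closedBall x (ω / 2)) ∧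
      Dd S T ε v1 v2 x ≤ C5 * ((∫ ζ in Metric.closedBall (0 : ℝ × ℝ) 1, Dd S T ε v1 v2 (Psi x (θ / (3 * L ^ 3) * ε * ω) P Q ζ))
        + ε ^ (-(1/10) : ℝ) * (∫ ζ in Metric.closedBall (0 : ℝ × ℝ) 1,
          (ε * |v1 (Psi x (θ / (3 * L ^ 3) * ε * ω) P Q ζ)| + |v2 (Psi x (θ / (3 * L ^ 3) * ε * ω) P Q ζ)|))
        + θ ^ γ * Dd S T ε v1 v2 x) := by
  obtain ⟨Cr, hCr, hR⟩ := lemR2 hγ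
  have hL0 : 0 < L := by linarith
  set V := volume.real (Metric.closedBall (0 : ℝ × ℝ) 1) with hV
  have hVp : 0 < V := ENNReal.toReal_pos (Metric.measure_closedBall_pos _ _ one_pos).ne'
    (isCompact_closedBall _ _).measure_lt_top.ne
  refine ⟨360 * Cr * L ^ 19 + 1056 * Cr * L ^ 22 + (1056 * Cr * L ^ 22 + 12 * (Cr + 1) * L ^ 17) * (1 / V) +
    40 * L ^ 5 * (1056 * Cr * L ^ 22 + 12 * (Cr + 1) * L ^ 17), ?_, fun θ hθ hθ2 ε ω x S T a11 a12 a22 e1 e2 v1 v2 hε hε1 hω hω1 h => ?_⟩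
  rotate_left
  · obtain ⟨l11, l21, l22, h110, h220, h11, h21, h22, h11i, h22i, c1, c2, c3⟩ := chol hL h.b11 h.b12 h.b22 h.el h.ed
    have a11' : |l11| ≤ L ^ 2 := by rwa [abs_of_pos h110]
    have a22' : |l22| ≤ L ^ 2 := by rwa [abs_of_pos h220]
    have hxB : x ∈ Metric.closedBall x (ω / 2) := Metric.mem_closedBall_self (by linarith)
    set r := θ / (3 * L ^ 3) * ε * ω with hr
    have hr0 : 0 < r := by positivity
    have L3 : 1 ≤ L ^ 3 := one_le_pow₀ hL
    have hrθ : r ≤ θ * ε := by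
      rw [hr]
      calc _ ≤ θ / (3 * L ^ 3) * ε * 1 := by gcongr
        _ ≤ θ * ε := by
          rw [mul_one]; gcongr
          exact div_le_self hθ.le (by linarith)
    set P := l11 • S x + (l21 * ε) • T x with hP
    set Q := (l22 * ε) • T x with hQ
    have nS := h.hS x hxB
    have nT := h.hT x hxB
    have nP : ‖P‖ ≤ 2 * L ^ 3 := by
      calc _ ≤ ‖l11 • S x‖ + ‖(l21 * ε) • T x‖ := norm_add_le _ _
        _ = |l11| * ‖S x‖ + |l21| * ε * ‖T x‖ := by rw [norm_smul, norm_smul, Real.norm_eq_abs, Real.norm_eq_abs, abs_mul, abs_of_pos hε]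
        _ ≤ L ^ 2 * L + L ^ 2 * 1 * L := by gcongr
        _ = _ := by ring
    have nQ : ‖Q‖ ≤ L ^ 3 := by
      rw [hQ, norm_smul, Real.norm_eq_abs, abs_mul, abs_of_pos hε]
      calc _ ≤ L ^ 2 * 1 * L := by gcongr
        _ = _ := by ring
    have dist1 : ∀ ζ, ‖Psi x r P Q ζ - x‖ ≤ θ * ε * ω * ‖ζ‖ := by
      intro ζ
      refine (Psi_dist x hr0.le nP nQ ζ).trans_eq ?_
      rw [hr]; field_simp; ring
    have inB : ∀ ζ : ℝ × ℝ, ‖ζ‖ ≤ 1 → Psi x r P Q ζ ∈ Metric.closedBall x (ω / 2) := by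
      intro ζ hζ
      rw [mem_closedBall_iff_norm]
      refine (dist1 ζ).trans ?_
      calc _ ≤ 1 / 2 * 1 * ω * 1 := by gcongr
        _ = _ := by ring
    have dist2 : ∀ ζ, ‖Psi x r P Q ζ - x‖ ≤ (θ * ‖ζ‖) * ε := by
      intro ζ
      refine (dist1 ζ).trans ?_
      calc _ ≤ θ * ε * 1 * ‖ζ‖ := by gcongr
        _ = _ := by ring
    have tb : ∀ ζ : ℝ × ℝ, ‖ζ‖ ≤ 1 → θ * ‖ζ‖ ≤ 1 := by
      intro ζ hζ; nlinarith [norm_nonneg ζ]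
    set D := Dd S T ε v1 v2 x with hDdef
    have hD0 : 0 ≤ D := Dd_nonneg _ _ _ _ _ _
    have pt := fun (ζ : ℝ × ℝ) (hζ : ‖ζ‖ ≤ 1) => h.pt hε hε1 hL hγ hγ1 hω (inB ζ hζ) (by positivity) (tb ζ hζ) (dist2 ζ)
    have lP : ∀ (v : ℝ × ℝ → ℝ) (y : ℝ × ℝ), fderiv ℝ v y P = l11 * fderiv ℝ v y (S x) + l21 * (ε * fderiv ℝ v y (T x)) := by
      intro v y; rw [hP, map_add, map_smul, map_smul]; simp only [smul_eq_mul]; ring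
    have lQ : ∀ (v : ℝ × ℝ → ℝ) (y : ℝ × ℝ), fderiv ℝ v y Q = l22 * (ε * fderiv ℝ v y (T x)) := by
      intro v y; rw [hQ, map_smul]; simp only [smul_eq_mul]; ring
    have frzD : ∀ ζ : ℝ × ℝ, ‖ζ‖ ≤ 1 → Dfz S T ε v1 v2 x (Psi x r P Q ζ) ≤ 10 * L ^ 3 * D := by
      intro ζ hζ
      calc _ ≤ 5 * L ^ 3 * Dd S T ε v1 v2 (Psi x r P Q ζ) := (pt ζ hζ).1
        _ ≤ 5 * L ^ 3 * (2 * D) := by gcongr; exact h.hD _ (inB ζ hζ)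
        _ = _ := by ring
    -- mean value
    have mv : ∀ v : ℝ × ℝ → ℝ, ContDiff ℝ 1 v → (∀ y, |fderiv ℝ v y (S x)| + |ε * fderiv ℝ v y (T x)| ≤ Dfz S T ε v1 v2 x y) →
        ∀ ζ : ℝ × ℝ, ‖ζ‖ ≤ 1 → |v (Psi x r P Q ζ) - v x| ≤ 20 * L ^ 5 * r * D * ‖ζ‖ := by
      intro v hv hvD ζ hζ
      have hc : ContDiff ℝ 1 (fun ζ => v (Psi x r P Q ζ)) := hv.comp (Psi_contDiff _ _ _ _)
      have := (convex_closedBall (0 : ℝ × ℝ) 1).norm_image_sub_le_of_norm_fderiv_le (𝕜 := ℝ)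
        (f := fun ζ => v (Psi x r P Q ζ)) (C := 20 * L ^ 5 * r * D)
        (fun ξ _ => hc.differentiable (by simp) ξ) (fun ξ hξ => ?_) (x := 0) (y := ζ) (by simp) (by simpa using hζ)
      · simpa [Psi_zero] using this
      · refine ContinuousLinearMap.opNorm_le_bound _ (by positivity) fun w => ?_
        have hξ' : ‖ξ‖ ≤ 1 := by simpa using hξ
        rw [Psi_fderiv hv, Real.norm_eq_abs, abs_mul, abs_of_pos hr0]
        have b := (hvD (Psi x r P Q ξ)).trans (frzD ξ hξ')
        have w1 : |w.1| ≤ ‖w‖ := norm_fst_le w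
        have w2 : |w.2| ≤ ‖w‖ := norm_snd_le w
        rw [lP, lQ]
        set s := fderiv ℝ v (Psi x r P Q ξ) (S x)
        set t := ε * fderiv ℝ v (Psi x r P Q ξ) (T x)
        have b1 : |l11 * s + l21 * t| ≤ L ^ 2 * (|s| + |t|) := by
          calc _ ≤ |l11| * |s| + |l21| * |t| := by rw [← abs_mul, ← abs_mul]; exact abs_add_le _ _
            _ ≤ L ^ 2 * |s| + L ^ 2 * |t| := by gcongr
            _ = _ := by ring
        have b2 : |l22 * t| ≤ L ^ 2 * (|s| + |t|) := by
          rw [abs_mul]; 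
          calc _ ≤ L ^ 2 * |t| := by gcongr
            _ ≤ _ := by gcongr; linarith [abs_nonneg s]
        calc _ ≤ r * (|w.1| * |l11 * s + l21 * t| + |w.2| * |l22 * t|) := by
                gcongr; rw [← abs_mul, ← abs_mul]; exact abs_add_le _ _
          _ ≤ r * (‖w‖ * (L ^ 2 * (10 * L ^ 3 * D)) + ‖w‖ * (L ^ 2 * (10 * L ^ 3 * D))) := by
                gcongr
                · exact b1.trans (by gcongr)
                · exact b2.trans (by gcongr)
          _ = _ := by ring
    have mv1 := mv v1 h.hv1 (fun y => by
      unfold Dfz; linarith [abs_nonneg (fderiv ℝ v2 y (S x)), abs_nonneg (ε * fderiv ℝ v2 y (T x))])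
    have mv2 := mv v2 h.hv2 (fun y => by
      unfold Dfz; linarith [abs_nonneg (fderiv ℝ v1 y (S x)), abs_nonneg (ε * fderiv ℝ v1 y (T x))])
    have mvW : ∀ ζ : ℝ × ℝ, ‖ζ‖ ≤ 1 → ε * |v1 (Psi x r P Q ζ) - v1 x| + |v2 (Psi x r P Q ζ) - v2 x| ≤ 40 * L ^ 5 * (θ * ‖ζ‖) * ε * D := by
      intro ζ hζ
      have m1 := mv1 ζ hζ
      have m2 := mv2 ζ hζ
      have : ε * |v1 (Psi x r P Q ζ) - v1 x| ≤ 1 * |v1 (Psi x r P Q ζ) - v1 x| := by gcongr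
      have : 40 * L ^ 5 * r * D * ‖ζ‖ ≤ 40 * L ^ 5 * (θ * ε) * D * ‖ζ‖ := by gcongr
      linarith
    set W0 := ε * |v1 x| + |v2 x| with hW0
    have hW0n : 0 ≤ W0 := by positivity
    set E := ε ^ (-(1/10) : ℝ) with hE
    have hE1 : 1 ≤ E := Real.one_le_rpow_of_pos_of_le_one_of_nonpos hε hε1 (by norm_num)
    have hEε : E * ε ≤ 1 := by
      rw [hE]; nth_rewrite 2 [← Real.rpow_one ε]
      rw [← Real.rpow_add hε]
      exact Real.rpow_le_one hε.le hε1 (by norm_num)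
    set p : ℝ × ℝ → ℝ := fun ζ => (1 / r * l11) * v1 (Psi x r P Q ζ) + (1 / r * l21) * v2 (Psi x r P Q ζ) with hp
    set q : ℝ × ℝ → ℝ := fun ζ => (1 / r * l22) * v2 (Psi x r P Q ζ) with hq
    have hc1 : ContDiff ℝ 1 (fun ζ => v1 (Psi x r P Q ζ)) := h.hv1.comp (Psi_contDiff _ _ _ _)
    have hc2 : ContDiff ℝ 1 (fun ζ => v2 (Psi x r P Q ζ)) := h.hv2.comp (Psi_contDiff _ _ _ _)
    have hpc : ContDiff ℝ 1 p := (contDiff_const.mul hc1).add (contDiff_const.mul hc2)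
    have hqc : ContDiff ℝ 1 q := contDiff_const.mul hc2
    have fp : ∀ ζ w : ℝ × ℝ, fderiv ℝ p ζ w = l11 * (w.1 * fderiv ℝ v1 (Psi x r P Q ζ) P + w.2 * fderiv ℝ v1 (Psi x r P Q ζ) Q)
        + l21 * (w.1 * fderiv ℝ v2 (Psi x r P Q ζ) P + w.2 * fderiv ℝ v2 (Psi x r P Q ζ) Q) := by
      intro ζ w
      have d1 := hc1.differentiable (by simp) ζ
      have d2 := hc2.differentiable (by simp) ζ
      rw [hp, fderiv_fun_add (d1.const_mul _) (d2.const_mul _), fderiv_const_mul d1, fderiv_const_mul d2]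
      simp only [ContinuousLinearMap.add_apply, ContinuousLinearMap.smul_apply, smul_eq_mul]
      rw [Psi_fderiv h.hv1, Psi_fderiv h.hv2]; field_simp
    have fq : ∀ ζ w : ℝ × ℝ, fderiv ℝ q ζ w = l22 * (w.1 * fderiv ℝ v2 (Psi x r P Q ζ) P + w.2 * fderiv ℝ v2 (Psi x r P Q ζ) Q) := by
      intro ζ w
      have d2 := hc2.differentiable (by simp) ζ
      rw [hq, fderiv_const_mul d2]
      simp only [ContinuousLinearMap.smul_apply, smul_eq_mul]
      rw [Psi_fderiv h.hv2]; field_simp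
    set κ := l11 * l22 * (e1 x * (ε * v1 x) + e2 x * v2 x) with hκ
    set N := 44 * L ^ 10 * θ ^ γ * (D + E * W0) with hN
    have hN0 : 0 ≤ N := by positivity
    have res := hR p q N 0 κ hpc hqc hN0
    have PS : ∀ ζ, fderiv ℝ p ζ (1, 0) = l11 * (l11 * fderiv ℝ v1 (Psi x r P Q ζ) (S x) + l21 * (ε * fderiv ℝ v1 (Psi x r P Q ζ) (T x)))
      + l21 * (l11 * fderiv ℝ v2 (Psi x r P Q ζ) (S x) + l21 * (ε * fderiv ℝ v2 (Psi x r P Q ζ) (T x))) := by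
      intro ζ; rw [fp, lP, lP]; ring
    have PT : ∀ ζ, fderiv ℝ p ζ (0, 1) = l11 * (l22 * (ε * fderiv ℝ v1 (Psi x r P Q ζ) (T x)))
      + l21 * (l22 * (ε * fderiv ℝ v2 (Psi x r P Q ζ) (T x))) := by
      intro ζ; rw [fp, lQ, lQ]; ring
    have QS : ∀ ζ, fderiv ℝ q ζ (1, 0) = l22 * (l11 * fderiv ℝ v2 (Psi x r P Q ζ) (S x) + l21 * (ε * fderiv ℝ v2 (Psi x r P Q ζ) (T x))) := by
      intro ζ; rw [fq, lP]; ring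
    have QT : ∀ ζ, fderiv ℝ q ζ (0, 1) = l22 * (l22 * (ε * fderiv ℝ v2 (Psi x r P Q ζ) (T x))) := by
      intro ζ; rw [fq, lQ]; ring
    have tg : ∀ ζ : ℝ × ℝ, (θ * ‖ζ‖) ^ γ = θ ^ γ * ‖ζ‖ ^ γ := fun ζ => Real.mul_rpow hθ.le (norm_nonneg _)
    have F1b : ∀ ζ : ℝ × ℝ, ‖ζ‖ ≤ 1 → |fderiv ℝ p ζ (1, 0) + fderiv ℝ q ζ (0, 1) - 0| ≤ N * ‖ζ‖ ^ γ := by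
      intro ζ hζ
      have := (pt ζ hζ).2.1
      rw [PS, QT, sub_zero]
      refine le_trans (le_of_eq ?_) (this.trans ?_)
      · rw [← c1, ← c2, ← c3]; congr 1; ring
      · rw [tg, hN]
        have L4 : L ^ 4 ≤ L ^ 10 := pow_le_pow_right₀ hL (by norm_num)
        have g0 : 0 ≤ θ ^ γ * ‖ζ‖ ^ γ := by positivity
        calc _ = 10 * L ^ 4 * (θ ^ γ * ‖ζ‖ ^ γ) * (D + 0) := by ring
          _ ≤ 44 * L ^ 10 * (θ ^ γ * ‖ζ‖ ^ γ) * (D + E * W0) := by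
            gcongr
            · norm_num
            · positivity
          _ = _ := by ring
    have F2b : ∀ ζ : ℝ × ℝ, ‖ζ‖ ≤ 1 → |fderiv ℝ q ζ (1, 0) - fderiv ℝ p ζ (0, 1) - κ| ≤ N * ‖ζ‖ ^ γ := by
      intro ζ hζ
      have b := (pt ζ hζ).2.2
      have bw := mvW ζ hζ
      rw [QS, PT, hκ]
      rw [tg] at b
      have htt : θ * ‖ζ‖ ≤ θ ^ γ * ‖ζ‖ ^ γ := by
        rw [← tg]; exact Real.self_le_rpow_of_le_one (by positivity) (tb ζ hζ) hγ1
      set G := θ ^ γ * ‖ζ‖ ^ γ with hG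
      have hG0 : 0 ≤ G := by positivity
      have e : l22 * (l11 * fderiv ℝ v2 (Psi x r P Q ζ) (S x) + l21 * (ε * fderiv ℝ v2 (Psi x r P Q ζ) (T x))) -
          (l11 * (l22 * (ε * fderiv ℝ v1 (Psi x r P Q ζ) (T x))) + l21 * (l22 * (ε * fderiv ℝ v2 (Psi x r P Q ζ) (T x)))) -
          l11 * l22 * (e1 x * (ε * v1 x) + e2 x * v2 x) = l11 * l22 * (fderiv ℝ v2 (Psi x r P Q ζ) (S x) -
          ε * fderiv ℝ v1 (Psi x r P Q ζ) (T x) - (e1 x * (ε * v1 x) + e2 x * v2 x)) := by ring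
      rw [e, abs_mul, abs_mul]
      calc _ ≤ L ^ 2 * L ^ 2 * (4 * L ^ 3 * G * D + L * E * G * W0 + L * (40 * L ^ 5 * G * 1 * D)) := by
              gcongr
              refine b.trans ?_
              gcongr
              refine bw.trans ?_
              gcongr
        _ = 4 * L ^ 7 * (G * D) + L ^ 5 * (G * (E * W0)) + 40 * L ^ 10 * (G * D) := by ring
        _ ≤ 4 * L ^ 10 * (G * D) + 44 * L ^ 10 * (G * (E * W0)) + 40 * L ^ 10 * (G * D) := by
              have hE0 : 0 ≤ E := by linarith
              have L5 : L ^ 5 ≤ 44 * L ^ 10 := (pow_le_pow_right₀ hL (by norm_num : 5 ≤ 10)).trans (by linarith [pow_pos hL0 10])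
              gcongr
              norm_num
        _ = N * ‖ζ‖ ^ γ := by rw [hN, hG]; ring
    obtain ⟨rA, rB⟩ := res F1b F2b
    have cD : Continuous fun ζ => Dd S T ε v1 v2 (Psi x r P Q ζ) :=
      (Dd_cont ε h.cS h.cT h.hv1 h.hv2).comp (Psi_contDiff _ _ _ _).continuous
    have iD : IntegrableOn (fun ζ => Dd S T ε v1 v2 (Psi x r P Q ζ)) (Metric.closedBall (0 : ℝ × ℝ) 1) :=
      cD.continuousOn.integrableOn_compact (isCompact_closedBall _ _)
    set ID := ∫ ζ in Metric.closedBall (0 : ℝ × ℝ) 1, Dd S T ε v1 v2 (Psi x r P Q ζ) with hID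
    set IW := ∫ ζ in Metric.closedBall (0 : ℝ × ℝ) 1, (ε * |v1 (Psi x r P Q ζ)| + |v2 (Psi x r P Q ζ)|) with hIW
    have ID0 : 0 ≤ ID := integral_nonneg fun ζ => Dd_nonneg _ _ _ _ _ _
    have IW0 : 0 ≤ IW := integral_nonneg fun ζ => by positivity
    have ABint : ∀ f : ℝ × ℝ → ℝ, Continuous f → (∀ ζ, ‖ζ‖ ≤ 1 → |f ζ| ≤ 3 * (L ^ 2) ^ 2 * Dfz S T ε v1 v2 x (Psi x r P Q ζ)) →
        (∫ ζ in Metric.closedBall (0 : ℝ × ℝ) 1, |f ζ|) ≤ 15 * L ^ 7 * ID := by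
      intro f hf hb
      rw [hID, ← integral_const_mul]
      refine setIntegral_mono_on (hf.abs.continuousOn.integrableOn_compact (isCompact_closedBall _ _)) (iD.const_mul _)
        Metric.isClosed_closedBall.measurableSet fun ζ hζ => ?_
      have hζ' : ‖ζ‖ ≤ 1 := by simpa using hζ
      calc _ ≤ _ := hb ζ hζ'
        _ ≤ 3 * (L ^ 2) ^ 2 * (5 * L ^ 3 * Dd S T ε v1 v2 (Psi x r P Q ζ)) := by gcongr; exact (pt ζ hζ').1
        _ = _ := by ring
    have fdc : ∀ (f : ℝ × ℝ → ℝ), ContDiff ℝ 1 f → ∀ w : ℝ × ℝ, Continuous fun ζ => fderiv ℝ f ζ w := by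
      intro f hf w
      have := fd_cont hf 1 w; simpa only [one_smul] using this
    have hIA := ABint (fun ζ => fderiv ℝ p ζ (1, 0) - fderiv ℝ q ζ (0, 1)) ((fdc p hpc _).sub (fdc q hqc _)) (by
      intro ζ hζ
      rw [PS, QT]
      exact (alg_up (one_le_pow₀ hL) a11' h21 a22').1)
    have hIB := ABint (fun ζ => fderiv ℝ q ζ (1, 0) + fderiv ℝ p ζ (0, 1)) ((fdc q hqc _).add (fdc p hpc _)) (by
      intro ζ hζ
      rw [QS, PT]
      exact (alg_up (one_le_pow₀ hL) a11' h21 a22').2)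
    have z0 : ‖(0 : ℝ × ℝ)‖ ≤ 1 := by simp
    have F10 : |fderiv ℝ p 0 (1, 0) + fderiv ℝ q 0 (0, 1)| = 0 := by
      have := F1b 0 z0
      rw [norm_zero, Real.zero_rpow hγ.ne', mul_zero, sub_zero] at this
      exact le_antisymm this (abs_nonneg _)
    have F20 : |fderiv ℝ q 0 (1, 0) - fderiv ℝ p 0 (0, 1)| ≤ |κ| := by
      have := F2b 0 z0
      rw [norm_zero, Real.zero_rpow hγ.ne', mul_zero] at this
      have h0 := abs_nonpos_iff.1 this
      rw [sub_eq_zero.1 h0]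
    have down : D ≤ 12 * (L ^ 2) ^ 6 * (|fderiv ℝ p 0 (1, 0) - fderiv ℝ q 0 (0, 1)| + |fderiv ℝ q 0 (1, 0) + fderiv ℝ p 0 (0, 1)|
        + |fderiv ℝ p 0 (1, 0) + fderiv ℝ q 0 (0, 1)| + |fderiv ℝ q 0 (1, 0) - fderiv ℝ p 0 (0, 1)|) := by
      have := alg_down (s1 := fderiv ℝ v1 x (S x)) (s2 := fderiv ℝ v2 x (S x)) (t1 := ε * fderiv ℝ v1 x (T x)) (t2 := ε * fderiv ℝ v2 x (T x))
        (one_le_pow₀ hL : 1 ≤ L ^ 2) h110 h220 h21 h11i h22i rfl rfl rfl rfl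
      rw [PS, PT, QS, QT, Psi_zero]
      exact this
    have κb : |κ| ≤ L ^ 5 * W0 := by
      rw [hκ, abs_mul, abs_mul]
      have : |e1 x * (ε * v1 x) + e2 x * v2 x| ≤ L * W0 := by
        calc _ ≤ |e1 x * (ε * v1 x)| + |e2 x * v2 x| := abs_add_le _ _
          _ = |e1 x| * (ε * |v1 x|) + |e2 x| * |v2 x| := by rw [abs_mul, abs_mul, abs_mul, abs_of_pos hε]
          _ ≤ L * (ε * |v1 x|) + L * |v2 x| := by
            gcongr
            · exact h.be1 x hxB
            · exact h.be2 x hxB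
          _ = _ := by ring
      calc _ ≤ L ^ 2 * L ^ 2 * (L * W0) := by gcongr
        _ = _ := by ring
    have wb : E * W0 ≤ 1 / V * (E * IW) + 40 * L ^ 5 * θ * D := by
      have hle : V * (W0 - 40 * L ^ 5 * θ * ε * D) ≤ IW := by
        have e : V * (W0 - 40 * L ^ 5 * θ * ε * D) = ∫ ζ in Metric.closedBall (0 : ℝ × ℝ) 1, (W0 - 40 * L ^ 5 * θ * ε * D) := by
          rw [setIntegral_const]; rfl
        rw [e, hIW]
        refine setIntegral_mono_on (continuous_const.continuousOn.integrableOn_compact (isCompact_closedBall _ _))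
          (Continuous.continuousOn ?_ |>.integrableOn_compact (isCompact_closedBall _ _))
          Metric.isClosed_closedBall.measurableSet fun ζ hζ => ?_
        · exact (hc1.continuous.abs.const_mul ε).add hc2.continuous.abs
        · have hζ' : ‖ζ‖ ≤ 1 := by simpa using hζ
          have m := mvW ζ hζ'
          have m1 : |v1 x| ≤ |v1 (Psi x r P Q ζ)| + |v1 (Psi x r P Q ζ) - v1 x| := by
            have := abs_sub (v1 (Psi x r P Q ζ)) (v1 (Psi x r P Q ζ) - v1 x); simpa using this
          have m2 : |v2 x| ≤ |v2 (Psi x r P Q ζ)| + |v2 (Psi x r P Q ζ) - v2 x| := by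
            have := abs_sub (v2 (Psi x r P Q ζ)) (v2 (Psi x r P Q ζ) - v2 x); simpa using this
          have m3 : ε * |v1 x| ≤ ε * (|v1 (Psi x r P Q ζ)| + |v1 (Psi x r P Q ζ) - v1 x|) := by gcongr
          have m4 : 40 * L ^ 5 * (θ * ‖ζ‖) * ε * D ≤ 40 * L ^ 5 * (θ * 1) * ε * D := by gcongr
          rw [hW0]; linarith
      have hE0 : 0 < E := by linarith
      have h5 : W0 ≤ 1 / V * IW + 40 * L ^ 5 * θ * ε * D := by
        rw [one_div, inv_mul_eq_div, ← sub_le_iff_le_add, le_div_iff₀ hVp]; linarith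
      calc E * W0 ≤ E * (1 / V * IW + 40 * L ^ 5 * θ * ε * D) := by gcongr
        _ = 1 / V * (E * IW) + 40 * L ^ 5 * θ * (E * ε) * D := by ring
        _ ≤ 1 / V * (E * IW) + 40 * L ^ 5 * θ * 1 * D := by gcongr
        _ = _ := by ring
    refine ⟨P, Q, ?_, inB, ?_⟩
    · have e : P.1 * Q.2 - P.2 * Q.1 = l11 * l22 * ε * ((S x).1 * (T x).2 - (S x).2 * (T x).1) := by
        simp only [hP, hQ, Prod.fst_add, Prod.snd_add, Prod.smul_fst, Prod.smul_snd, smul_eq_mul]; ring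
      rw [e, abs_mul, abs_mul, abs_mul, abs_of_pos h110, abs_of_pos h220, abs_of_pos hε]
      have hd := h.hd x hxB
      set dd := |(S x).1 * (T x).2 - (S x).2 * (T x).1|
      calc ε = 1 * 1 * 1 * ε := by ring
        _ ≤ (L ^ 2 * l11) * (L ^ 2 * l22) * (L * dd) * ε := by gcongr
        _ = _ := by ring
    · exact absorb hL hCr hVp hθ.le (Real.self_le_rpow_of_le_one hθ.le (by linarith) hγ1) (Real.rpow_le_one hθ.le (by linarith) hγ.le)
        hD0 (by positivity) ID0 (by positivity) down F10 F20 (by simpa using rA) rB hIA hIB hN κb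
        (by nlinarith) wb
  · positivity

lemma LpN_nonneg (q : ℝ) (f : ℝ × ℝ → ℝ) (K : Set (ℝ × ℝ)) : 0 ≤ LpN q f K := by
  unfold LpN
  exact Real.rpow_nonneg (integral_nonneg fun _ => by positivity) _

lemma cont_abs_rpow {f : ℝ × ℝ → ℝ} (hf : Continuous f) {s : ℝ} (hs : 0 ≤ s) : Continuous fun y => |f y| ^ s :=
  hf.abs.rpow_const fun _ => Or.inr hs

lemma int_abs_rpow {f : ℝ × ℝ → ℝ} (hf : Continuous f) {s : ℝ} (hs : 0 ≤ s) {K : Set (ℝ × ℝ)} (hK : IsCompact K) :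
    IntegrableOn (fun y => |f y| ^ s) K :=
  (cont_abs_rpow hf hs).continuousOn.integrableOn_compact hK

lemma memLp_of_cont {f : ℝ × ℝ → ℝ} (hf : Continuous f) {K : Set (ℝ × ℝ)} (hK : IsCompact K) (s : ENNReal) :
    MemLp f s (volume.restrict K) := by
  haveI : IsFiniteMeasure (volume.restrict K) := ⟨by simpa using hK.measure_lt_top⟩
  obtain ⟨B, hB⟩ := hK.exists_bound_of_continuousOn hf.continuousOn
  refine MemLp.of_bound hf.aestronglyMeasurable B ?_
  exact (ae_restrict_iff' hK.measurableSet).2 (ae_of_all _ fun x hx => hB x hx)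

lemma hold1 {f : ℝ × ℝ → ℝ} (hf : Continuous f) {K : Set (ℝ × ℝ)} (hK : IsCompact K) {s : ℝ} (hs : 1 < s) :
    ∫ y in K, |f y| ≤ LpN s f K * (volume.real K) ^ (1 - 1 / s) := by
  have hpq : s.HolderConjugate (s / (s - 1)) := Real.HolderConjugate.conjExponent hs
  have h := integral_mul_le_Lp_mul_Lq_of_nonneg (μ := volume.restrict K) hpq (f := fun y => |f y|) (g := fun _ => (1 : ℝ))
    (ae_of_all _ fun _ => abs_nonneg _) (ae_of_all _ fun _ => zero_le_one)
    (memLp_of_cont hf.abs hK _) (memLp_of_cont continuous_const hK _)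
  have e : 1 / (s / (s - 1)) = 1 - 1 / s := by
    have : s ≠ 0 := by linarith
    have : s - 1 ≠ 0 := by linarith
    field_simp
  simp only [mul_one, Real.one_rpow, e] at h
  rw [integral_const] at h
  simpa [LpN, Measure.real] using h

lemma Psi_det (x : ℝ × ℝ) (r : ℝ) (P Q : ℝ × ℝ) :
    (r • ((ContinuousLinearMap.fst ℝ ℝ ℝ).smulRight P + (ContinuousLinearMap.snd ℝ ℝ ℝ).smulRight Q)).det
      = r ^ 2 * (P.1 * Q.2 - P.2 * Q.1) := by
  rw [ContinuousLinearMap.det, ← LinearMap.det_toMatrix (Module.Basis.finTwoProd ℝ), Matrix.det_fin_two]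
  simp [LinearMap.toMatrix_apply]
  ring

lemma Psi_cov {x : ℝ × ℝ} {r : ℝ} {P Q : ℝ × ℝ} (hr : 0 < r) (hd : P.1 * Q.2 - P.2 * Q.1 ≠ 0) {g : ℝ × ℝ → ℝ}
    (hg : Continuous g) (hg0 : ∀ y, 0 ≤ g y) {K : Set (ℝ × ℝ)} (hK : IsCompact K)
    (hin : ∀ ζ : ℝ × ℝ, ‖ζ‖ ≤ 1 → Psi x r P Q ζ ∈ K) :
    r ^ 2 * |P.1 * Q.2 - P.2 * Q.1| * ∫ ζ in Metric.closedBall (0 : ℝ × ℝ) 1, g (Psi x r P Q ζ) ≤ ∫ y in K, g y := by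
  have hder : ∀ ζ ∈ Metric.closedBall (0 : ℝ × ℝ) 1, HasFDerivWithinAt (Psi x r P Q)
      (r • ((ContinuousLinearMap.fst ℝ ℝ ℝ).smulRight P + (ContinuousLinearMap.snd ℝ ℝ ℝ).smulRight Q))
      (Metric.closedBall (0 : ℝ × ℝ) 1) ζ := by
    intro ζ _
    unfold Psi
    exact ((((hasFDerivAt_fst.smul_const P).add (hasFDerivAt_snd.smul_const Q)).const_smul r).const_add x).hasFDerivWithinAt
  have hinj : Set.InjOn (Psi x r P Q) (Metric.closedBall (0 : ℝ × ℝ) 1) := by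
    intro a _ b _ hab
    unfold Psi at hab
    have h1 := smul_right_injective (ℝ × ℝ) hr.ne' (add_left_cancel hab)
    have e1 := congrArg Prod.fst h1
    have e2 := congrArg Prod.snd h1
    simp at e1 e2
    ext
    · have : (a.1 - b.1) * (P.1 * Q.2 - P.2 * Q.1) = 0 := by linear_combination Q.2 * e1 - Q.1 * e2
      rcases mul_eq_zero.1 this with h | h
      · linarith
      · exact absurd h hd
    · have : (a.2 - b.2) * (P.1 * Q.2 - P.2 * Q.1) = 0 := by linear_combination P.1 * e2 - P.2 * e1
      rcases mul_eq_zero.1 this with h | h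
      · linarith
      · exact absurd h hd
  have h := integral_image_eq_integral_abs_det_fderiv_smul volume Metric.isClosed_closedBall.measurableSet hder hinj g
  rw [Psi_det x] at h
  simp only [smul_eq_mul, abs_mul, abs_of_pos (pow_pos hr 2)] at h
  rw [integral_const_mul] at h
  rw [← h]
  refine setIntegral_mono_set (hg.continuousOn.integrableOn_compact hK) (ae_of_all _ hg0) ?_
  refine HasSubset.Subset.eventuallyLE ?_
  rintro _ ⟨ζ, hζ, rfl⟩
  exact hin ζ (by simpa using hζ)

lemma avg {s c : ℝ} (hs : 2 ≤ s) (hc : 0 < c) : ∃ A : ℝ, 0 < A ∧ ∀ (x : ℝ × ℝ) (r : ℝ) (P Q : ℝ × ℝ) (ε ω : ℝ)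
    (f : ℝ × ℝ → ℝ) (K : Set (ℝ × ℝ)), 0 < ε → 0 < ω → ω ≤ 1 → 0 < r → c * ε ^ 3 * ω ^ 2 ≤ r ^ 2 * |P.1 * Q.2 - P.2 * Q.1| →
    Continuous f → IsCompact K → (∀ ζ : ℝ × ℝ, ‖ζ‖ ≤ 1 → Psi x r P Q ζ ∈ K) →
    ω * ∫ ζ in Metric.closedBall (0 : ℝ × ℝ) 1, |f (Psi x r P Q ζ)| ≤ A * ε ^ (-(3 / s)) * LpN s f K := by
  set V := volume.real (Metric.closedBall (0 : ℝ × ℝ) 1) with hV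
  have hVp : 0 < V := ENNReal.toReal_pos (Metric.measure_closedBall_pos _ _ one_pos).ne'
    (isCompact_closedBall _ _).measure_lt_top.ne
  refine ⟨c ^ (-(1 / s)) * V ^ (1 - 1 / s), by positivity, ?_⟩
  intro x r P Q ε ω f K hε hω hω1 hr hj hf hK hin
  have hs0 : 0 < s := by linarith
  have hd : P.1 * Q.2 - P.2 * Q.1 ≠ 0 := by
    intro h0
    rw [h0, abs_zero, mul_zero] at hj
    have : 0 < c * ε ^ 3 * ω ^ 2 := by positivity
    linarith
  have h1 := Psi_cov hr hd (cont_abs_rpow hf hs0.le) (fun y => by positivity) hK hin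
  have h2 := hold1 (f := fun ζ => f (Psi x r P Q ζ)) (hf.comp (Psi_contDiff x r P Q).continuous)
    (isCompact_closedBall (0 : ℝ × ℝ) 1) (s := s) (by linarith)
  set J := c * ε ^ 3 * ω ^ 2 with hJ
  have hJ0 : 0 < J := by positivity
  set I1 := ∫ ζ in Metric.closedBall (0 : ℝ × ℝ) 1, |f (Psi x r P Q ζ)| ^ s with hI1
  have I10 : 0 ≤ I1 := integral_nonneg fun _ => by positivity
  set I2 := ∫ y in K, |f y| ^ s with hI2
  have I20 : 0 ≤ I2 := integral_nonneg fun _ => by positivity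
  have h3 : I1 ≤ J⁻¹ * I2 := by
    rw [inv_mul_eq_div, le_div_iff₀ hJ0]
    calc _ = J * I1 := by ring
      _ ≤ _ := mul_le_mul_of_nonneg_right hj I10
      _ ≤ _ := h1
  have h4 : LpN s (fun ζ => f (Psi x r P Q ζ)) (Metric.closedBall (0 : ℝ × ℝ) 1) ≤ J ^ (-(1 / s)) * LpN s f K := by
    unfold LpN
    rw [Real.rpow_neg hJ0.le, ← Real.inv_rpow hJ0.le, ← Real.mul_rpow (by positivity) I20]
    exact Real.rpow_le_rpow I10 h3 (by positivity)
  have h5 : J ^ (-(1 / s)) = c ^ (-(1 / s)) * ε ^ (-(3 / s)) * ω ^ (-(2 / s)) := by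
    rw [hJ, Real.mul_rpow (by positivity) (by positivity), Real.mul_rpow (by positivity) (by positivity),
      ← Real.rpow_natCast, ← Real.rpow_natCast, ← Real.rpow_mul hε.le, ← Real.rpow_mul hω.le]
    congr 3 <;> push_cast <;> ring
  have h6 : ω * ω ^ (-(2 / s)) ≤ 1 := by
    nth_rewrite 1 [← Real.rpow_one ω]
    rw [← Real.rpow_add hω]
    refine Real.rpow_le_one hω.le hω1 ?_
    have : 2 / s ≤ 1 := by rw [div_le_one hs0]; exact hs
    linarith
  have hN := LpN_nonneg s f K
  calc _ ≤ ω * (J ^ (-(1 / s)) * LpN s f K * V ^ (1 - 1 / s)) := by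
        refine mul_le_mul_of_nonneg_left (h2.trans ?_) hω.le
        gcongr
    _ = (ω * ω ^ (-(2 / s))) * (c ^ (-(1 / s)) * V ^ (1 - 1 / s) * ε ^ (-(3 / s)) * LpN s f K) := by rw [h5]; ring
    _ ≤ 1 * (c ^ (-(1 / s)) * V ^ (1 - 1 / s) * ε ^ (-(3 / s)) * LpN s f K) := by gcongr
    _ = _ := by ring

def omg (K : Set (ℝ × ℝ)) (x : ℝ × ℝ) : ℝ := min 1 (Metric.infDist x Kᶜ)

lemma omg_cont (K : Set (ℝ × ℝ)) : Continuous (omg K) := continuous_const.min (Metric.continuous_infDist_pt _)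

lemma omg_ball {K : Set (ℝ × ℝ)} {x : ℝ × ℝ} (h : 0 < omg K x) : Metric.closedBall x (omg K x / 2) ⊆ K := by
  intro y hy
  by_contra hn
  have h1 : Metric.infDist x Kᶜ ≤ dist x y := Metric.infDist_le_dist_of_mem hn
  have h2 : omg K x ≤ Metric.infDist x Kᶜ := min_le_right _ _
  rw [Metric.mem_closedBall, dist_comm] at hy
  linarith

lemma omg_half {K : Set (ℝ × ℝ)} {x y : ℝ × ℝ} (hy : y ∈ Metric.closedBall x (omg K x / 2)) : omg K x / 2 ≤ omg K y := by
  have h2 : omg K x ≤ Metric.infDist x Kᶜ := min_le_right _ _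
  have h3 : omg K x ≤ 1 := min_le_left _ _
  have h0 : 0 ≤ omg K x := le_min zero_le_one Metric.infDist_nonneg
  have h1 : Metric.infDist x Kᶜ ≤ Metric.infDist y Kᶜ + dist x y := Metric.infDist_le_infDist_add_dist
  rw [Metric.mem_closedBall, dist_comm] at hy
  exact le_min (by linarith) (by linarith)

lemma core2 {γ L : ℝ} (hγ : 0 < γ) (hγ1 : γ ≤ 1) (hL : 1 ≤ L) : ∃ C5 : ℝ, 0 < C5 ∧ ∃ c : ℝ, 0 < c ∧
    ∀ (ε ω : ℝ) (x : ℝ × ℝ) (S T : ℝ × ℝ → ℝ × ℝ) (a11 a12 a22 e1 e2 v1 v2 : ℝ × ℝ → ℝ),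
    0 < ε → ε ≤ 1 → 0 < ω → ω ≤ 1 → Loc L γ ε ω x S T a11 a12 a22 e1 e2 v1 v2 →
    ∃ r, ∃ P Q : ℝ × ℝ, 0 < r ∧ c * ε ^ 3 * ω ^ 2 ≤ r ^ 2 * |P.1 * Q.2 - P.2 * Q.1| ∧
      (∀ ζ : ℝ × ℝ, ‖ζ‖ ≤ 1 → Psi x r P Q ζ ∈ Metric.closedBall x (ω / 2)) ∧
      Dd S T ε v1 v2 x ≤ C5 * ((∫ ζ in Metric.closedBall (0 : ℝ × ℝ) 1, Dd S T ε v1 v2 (Psi x r P Q ζ))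
        + ε ^ (-(1/10) : ℝ) * (∫ ζ in Metric.closedBall (0 : ℝ × ℝ) 1,
          (ε * |v1 (Psi x r P Q ζ)| + |v2 (Psi x r P Q ζ)|))) := by
  obtain ⟨C5, hC5, h⟩ := core hγ hγ1 hL
  have hL0 : 0 < L := by linarith
  set θ := min (1 / 2) ((1 / (2 * C5)) ^ (1 / γ)) with hθ
  have hθ0 : 0 < θ := lt_min (by norm_num) (by positivity)
  have hθg : C5 * θ ^ γ ≤ 1 / 2 := by
    have : θ ^ γ ≤ 1 / (2 * C5) := by
      calc θ ^ γ ≤ ((1 / (2 * C5)) ^ (1 / γ)) ^ γ := Real.rpow_le_rpow hθ0.le (min_le_right _ _) hγ.le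
        _ = _ := by rw [← Real.rpow_mul (by positivity), one_div_mul_cancel hγ.ne', Real.rpow_one]
    calc _ ≤ C5 * (1 / (2 * C5)) := by gcongr
      _ = 1 / 2 := by field_simp
  refine ⟨2 * C5, by positivity, (θ / (3 * L ^ 3)) ^ 2 / L ^ 5, by positivity, ?_⟩
  intro ε ω x S T a11 a12 a22 e1 e2 v1 v2 hε hε1 hω hω1 hl
  obtain ⟨P, Q, hd, hin, hb⟩ := h θ hθ0 (min_le_left _ _) ε ω x S T a11 a12 a22 e1 e2 v1 v2 hε hε1 hω hω1 hl
  refine ⟨_, P, Q, ?_, ?_, hin, ?_⟩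
  · positivity
  · rw [show (θ / (3 * L ^ 3)) ^ 2 / L ^ 5 * ε ^ 3 * ω ^ 2 = (θ / (3 * L ^ 3) * ε * ω) ^ 2 * (ε / L ^ 5) by ring]
    refine mul_le_mul_of_nonneg_left ?_ (by positivity)
    rw [div_le_iff₀ (by positivity)]; linarith
  · have hD := Dd_nonneg S T v1 v2 ε x
    have := mul_le_mul_of_nonneg_right hθg hD
    linarith

set_option maxHeartbeats 1000000 in
lemma glob {γ L B s pp : ℝ} (hγ : 0 < γ) (hγ1 : γ ≤ 1) (hL : 1 ≤ L) (hB : 1 ≤ B) (hs : 2 ≤ s) (hpp : 10 / 3 ≤ pp) :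
    ∃ C6 : ℝ, 0 < C6 ∧
    ∀ (ε : ℝ) (K : Set (ℝ × ℝ)) (S T : ℝ × ℝ → ℝ × ℝ) (a11 a12 a22 e1 e2 v1 v2 F : ℝ × ℝ → ℝ),
    0 < ε → ε ≤ 1 → IsCompact K → Continuous S → Continuous T → ContDiff ℝ 1 v1 → ContDiff ℝ 1 v2 → Continuous F →
    (∀ (x : ℝ × ℝ) (ω : ℝ), 0 < ω → ω ≤ 1 → Metric.closedBall x (ω / 2) ⊆ K →
      (∀ y ∈ Metric.closedBall x (ω / 2), Dd S T ε v1 v2 y ≤ 2 * Dd S T ε v1 v2 x) →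
      Loc L γ ε ω x S T a11 a12 a22 e1 e2 v1 v2) →
    (∀ y ∈ K, Dd S T ε v1 v2 y ≤ B * (ε * |F y| + (ε * |v1 y| + |v2 y|))) →
    LpN s F K ≤ B → LpN pp (fun y => ε * |v1 y| + |v2 y|) K ≤ B * ε →
    ∀ x ∈ K, omg K x * Dd S T ε v1 v2 x ≤ C6 * (ε ^ (1 - 3 / s) + 1) := by
  obtain ⟨C5, hC5, c, hc, h⟩ := core2 hγ hγ1 hL
  obtain ⟨A1, hA1, hav1⟩ := avg hs hc
  obtain ⟨A2, hA2, hav2⟩ := avg (s := pp) (by linarith) hc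
  refine ⟨C5 * (B * (A1 * B) + (B + 1) * (A2 * B)), by positivity, ?_⟩
  intro ε K S T a11 a12 a22 e1 e2 v1 v2 F hε hε1 hK cS cT hv1 hv2 hF hloc hDd hFs hW x hx
  have cD := Dd_cont ε cS cT hv1 hv2
  obtain ⟨x0, hx0, hmax⟩ := hK.exists_isMaxOn ⟨x, hx⟩ ((omg_cont K).mul cD).continuousOn
  have hmax' : ∀ y ∈ K, omg K y * Dd S T ε v1 v2 y ≤ omg K x0 * Dd S T ε v1 v2 x0 := fun y hy => hmax hy
  refine (hmax' x hx).trans ?_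
  have h0 : 0 ≤ omg K x0 := le_min zero_le_one Metric.infDist_nonneg
  rcases h0.eq_or_lt with h00 | hpos
  · rw [← h00, zero_mul]; positivity
  set ω := omg K x0 with hω
  have hω1 : ω ≤ 1 := min_le_left _ _
  have hball := omg_ball hpos
  have hL' := hloc x0 ω hpos hω1 hball (by
    intro y hy
    have h1 := hmax' y (hball hy)
    have h2 := omg_half hy
    have h3 := mul_le_mul_of_nonneg_right h2 (Dd_nonneg S T v1 v2 ε y)
    have h4 : ω * Dd S T ε v1 v2 y ≤ ω * (2 * Dd S T ε v1 v2 x0) := by linarith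
    exact le_of_mul_le_mul_left h4 hpos)
  obtain ⟨r, P, Q, hr, hj, hin, hb⟩ := h ε ω x0 S T a11 a12 a22 e1 e2 v1 v2 hε hε1 hpos hω1 hL'
  have cW : Continuous fun y => ε * |v1 y| + |v2 y| :=
    (hv1.continuous.abs.const_mul ε).add hv2.continuous.abs
  have hinK : ∀ ζ : ℝ × ℝ, ‖ζ‖ ≤ 1 → Psi x0 r P Q ζ ∈ K := fun ζ hζ => hball (hin ζ hζ)
  have r1 := hav1 x0 r P Q ε ω F K hε hpos hω1 hr hj hF hK hinK
  have r2 := hav2 x0 r P Q ε ω _ K hε hpos hω1 hr hj cW hK hinK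
  have cP := (Psi_contDiff x0 r P Q).continuous
  set IF := ∫ ζ in Metric.closedBall (0 : ℝ × ℝ) 1, |F (Psi x0 r P Q ζ)| with hIF
  have eW : (∫ ζ in Metric.closedBall (0 : ℝ × ℝ) 1, |(ε * |v1 (Psi x0 r P Q ζ)| + |v2 (Psi x0 r P Q ζ)| : ℝ)|) =
      ∫ ζ in Metric.closedBall (0 : ℝ × ℝ) 1, (ε * |v1 (Psi x0 r P Q ζ)| + |v2 (Psi x0 r P Q ζ)|) := by
    congr 1; ext ζ; exact abs_of_nonneg (by positivity)
  rw [eW] at r2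
  set IW := ∫ ζ in Metric.closedBall (0 : ℝ × ℝ) 1, (ε * |v1 (Psi x0 r P Q ζ)| + |v2 (Psi x0 r P Q ζ)|) with hIW
  have IW0 : 0 ≤ IW := integral_nonneg fun ζ => by positivity
  have hID : (∫ ζ in Metric.closedBall (0 : ℝ × ℝ) 1, Dd S T ε v1 v2 (Psi x0 r P Q ζ)) ≤ B * (ε * IF + IW) := by
    have i1 : IntegrableOn (fun ζ => |F (Psi x0 r P Q ζ)|) (Metric.closedBall (0 : ℝ × ℝ) 1) :=
      (hF.comp cP).abs.continuousOn.integrableOn_compact (isCompact_closedBall _ _)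
    have i2 : IntegrableOn (fun ζ => ε * |v1 (Psi x0 r P Q ζ)| + |v2 (Psi x0 r P Q ζ)|) (Metric.closedBall (0 : ℝ × ℝ) 1) :=
      (cW.comp cP).continuousOn.integrableOn_compact (isCompact_closedBall _ _)
    rw [hIF, hIW, ← integral_const_mul, ← integral_add (i1.const_mul ε) i2, ← integral_const_mul]
    refine setIntegral_mono_on ((cD.comp cP).continuousOn.integrableOn_compact (isCompact_closedBall _ _))
      (((i1.const_mul ε).add i2).const_mul B) Metric.isClosed_closedBall.measurableSet fun ζ hζ => ?_
    exact hDd _ (hinK ζ (by simpa using hζ))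
  set E := ε ^ (-(1/10) : ℝ) with hE
  have hE1 : 1 ≤ E := Real.one_le_rpow_of_pos_of_le_one_of_nonpos hε hε1 (by norm_num)
  have q1 : ε * (ω * IF) ≤ A1 * B * ε ^ (1 - 3 / s) := by
    calc _ ≤ ε * (A1 * ε ^ (-(3 / s)) * B) := by
          refine mul_le_mul_of_nonneg_left (r1.trans ?_) hε.le
          gcongr
      _ = A1 * B * (ε ^ (1 : ℝ) * ε ^ (-(3 / s))) := by rw [Real.rpow_one]; ring
      _ = _ := by rw [← Real.rpow_add hε]; ring_nf
  have q2 : E * (ω * IW) ≤ A2 * B := by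
    calc _ ≤ E * (A2 * ε ^ (-(3 / pp)) * (B * ε)) := by
          refine mul_le_mul_of_nonneg_left (r2.trans ?_) (by linarith)
          gcongr
      _ = A2 * B * (E * ε ^ (-(3 / pp)) * ε ^ (1 : ℝ)) := by rw [Real.rpow_one]; ring
      _ = A2 * B * ε ^ (-(1/10) + -(3 / pp) + 1) := by rw [hE, ← Real.rpow_add hε, ← Real.rpow_add hε]
      _ ≤ A2 * B * 1 := by
          gcongr
          refine Real.rpow_le_one hε.le hε1 ?_
          have : 3 / pp ≤ 9 / 10 := by
            rw [div_le_div_iff₀ (by linarith) (by norm_num)]; linarith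
          linarith
      _ = _ := by ring
  have q3 : ω * IW ≤ A2 * B := by
    have : 1 * (ω * IW) ≤ E * (ω * IW) := by gcongr
    linarith
  calc ω * Dd S T ε v1 v2 x0 ≤ ω * (C5 * (B * (ε * IF + IW) + E * IW)) := by
        refine mul_le_mul_of_nonneg_left (hb.trans ?_) hpos.le
        gcongr
    _ = C5 * (B * (ε * (ω * IF)) + B * (ω * IW) + E * (ω * IW)) := by ring
    _ ≤ C5 * (B * (A1 * B * ε ^ (1 - 3 / s)) + B * (A2 * B) + A2 * B) := by gcongr
    _ ≤ C5 * (B * (A1 * B) + (B + 1) * (A2 * B)) * (ε ^ (1 - 3 / s) + 1) := by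
        have z : 0 ≤ ε ^ (1 - 3 / s) := by positivity
        have n1 : 0 ≤ C5 * (B * (A1 * B)) := by positivity
        have n2 : 0 ≤ C5 * ((B + 1) * (A2 * B)) * ε ^ (1 - 3 / s) := by positivity
        linarith

def gr (u : ℝ × ℝ → ℝ) (y : ℝ × ℝ) : ℝ × ℝ × ℝ := (y.1, y.2, u y)
def SS (a b : ℝ × ℝ × ℝ → ℝ) (u : ℝ × ℝ → ℝ) (y : ℝ × ℝ) : ℝ × ℝ := (a (gr u y), b (gr u y))

lemma lin2 (l : ℝ × ℝ →L[ℝ] ℝ) (a b : ℝ) : l (a, b) = a * l (1, 0) + b * l (0, 1) := by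
  have : ((a, b) : ℝ × ℝ) = a • (1, 0) + b • (0, 1) := by ext <;> simp
  rw [this, map_add, map_smul, map_smul]; simp

lemma VF_eq (a b : ℝ × ℝ × ℝ → ℝ) (u f : ℝ × ℝ → ℝ) (y : ℝ × ℝ) : VF a b u f y = fderiv ℝ f y (SS a b u y) := by
  unfold VF SS pd1 pd2 gr; exact (lin2 _ _ _).symm

lemma X1_eq (s11 s12 : ℝ × ℝ × ℝ → ℝ) (u f : ℝ × ℝ → ℝ) (y : ℝ × ℝ) :
    X1 s11 s12 u f y = fderiv ℝ f y (SS s11 s12 u y) := VF_eq _ _ _ _ _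
lemma Yf_eq (s11 s12 : ℝ × ℝ × ℝ → ℝ) (u f : ℝ × ℝ → ℝ) (y : ℝ × ℝ) :
    Yf s11 s12 u f y = fderiv ℝ f y (SS (pd3 s11) (pd3 s12) u y) := VF_eq _ _ _ _ _
lemma X2_eq (s11 s12 : ℝ × ℝ × ℝ → ℝ) (ε : ℝ) (u f : ℝ × ℝ → ℝ) (y : ℝ × ℝ) :
    X2 s11 s12 ε u f y = ε * fderiv ℝ f y (SS (pd3 s11) (pd3 s12) u y) := by unfold X2; rw [Yf_eq]

lemma pd3_contDiff {s : ℝ × ℝ × ℝ → ℝ} (hs : ContDiff ℝ (⊤ : ℕ∞) s) : ContDiff ℝ (⊤ : ℕ∞) (pd3 s) := by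
  unfold pd3
  exact (hs.fderiv_right (m := (⊤ : ℕ∞)) (by simp)).clm_apply contDiff_const

lemma gr_contDiff {u : ℝ × ℝ → ℝ} (hu : ContDiff ℝ 1 u) : ContDiff ℝ 1 (gr u) := by
  unfold gr; fun_prop

lemma c1 {E F : Type*} [NormedAddCommGroup E] [NormedSpace ℝ E] [NormedAddCommGroup F] [NormedSpace ℝ F] {s : E → F} (hs : ContDiff ℝ (⊤ : ℕ∞) s) : ContDiff ℝ 1 s :=
  hs.of_le (by exact_mod_cast le_top)

lemma SS_contDiff {a b : ℝ × ℝ × ℝ → ℝ} {u : ℝ × ℝ → ℝ} (ha : ContDiff ℝ 1 a) (hb : ContDiff ℝ 1 b) (hu : ContDiff ℝ 1 u) :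
    ContDiff ℝ 1 (SS a b u) := by
  unfold SS
  exact (ha.comp (gr_contDiff hu)).prodMk (hb.comp (gr_contDiff hu))

lemma VF_contDiff {a b : ℝ × ℝ × ℝ → ℝ} {u z : ℝ × ℝ → ℝ} (ha : ContDiff ℝ 1 a) (hb : ContDiff ℝ 1 b) (hu : ContDiff ℝ 1 u)
    (hz : ContDiff ℝ 2 z) : ContDiff ℝ 1 (VF a b u z) := by
  rw [show VF a b u z = fun y => fderiv ℝ z y (SS a b u y) from funext (VF_eq _ _ _ _)]
  exact (hz.fderiv_right (m := 1) (by norm_num)).clm_apply (SS_contDiff ha hb hu)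

lemma VF_cont {a b : ℝ × ℝ × ℝ → ℝ} {u z : ℝ × ℝ → ℝ} (ha : ContDiff ℝ 1 a) (hb : ContDiff ℝ 1 b) (hu : ContDiff ℝ 1 u)
    (hz : ContDiff ℝ 1 z) : Continuous (VF a b u z) := by
  rw [show VF a b u z = fun y => fderiv ℝ z y (SS a b u y) from funext (VF_eq _ _ _ _)]
  exact (hz.continuous_fderiv (by simp)).clm_apply (SS_contDiff ha hb hu).continuous

lemma SS_fderiv {a b : ℝ × ℝ × ℝ → ℝ} {u : ℝ × ℝ → ℝ} (ha : ContDiff ℝ 1 a) (hb : ContDiff ℝ 1 b) (hu : ContDiff ℝ 1 u)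
    (y w : ℝ × ℝ) : fderiv ℝ (SS a b u) y w =
      (fderiv ℝ a (gr u y) (w.1, w.2, fderiv ℝ u y w), fderiv ℝ b (gr u y) (w.1, w.2, fderiv ℝ u y w)) := by
  have h1 : HasFDerivAt u (fderiv ℝ u y) y := (hu.differentiable (by simp) y).hasFDerivAt
  have h2 : HasFDerivAt (gr u) ((ContinuousLinearMap.fst ℝ ℝ ℝ).prod ((ContinuousLinearMap.snd ℝ ℝ ℝ).prod (fderiv ℝ u y))) y :=
    hasFDerivAt_fst.prodMk (hasFDerivAt_snd.prodMk h1)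
  have h3 := ((ha.differentiable (by simp) (gr u y)).hasFDerivAt).comp y h2
  have h4 := ((hb.differentiable (by simp) (gr u y)).hasFDerivAt).comp y h2
  have h5 : HasFDerivAt (SS a b u) _ y := h3.prodMk h4
  rw [h5.fderiv]; rfl

lemma VF_fderiv {a b : ℝ × ℝ × ℝ → ℝ} {u z : ℝ × ℝ → ℝ} (ha : ContDiff ℝ 1 a) (hb : ContDiff ℝ 1 b) (hu : ContDiff ℝ 1 u)
    (hz : ContDiff ℝ 2 z) (y w : ℝ × ℝ) : fderiv ℝ (VF a b u z) y w =
      fderiv ℝ (fderiv ℝ z) y w (SS a b u y) + fderiv ℝ z y (fderiv ℝ (SS a b u) y w) := by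
  rw [show VF a b u z = fun y => fderiv ℝ z y (SS a b u y) from funext (VF_eq _ _ _ _)]
  have h1 : DifferentiableAt ℝ (fderiv ℝ z) y := (hz.fderiv_right (m := 1) (by norm_num)).differentiable (by simp) y
  have h2 : DifferentiableAt ℝ (SS a b u) y := (SS_contDiff ha hb hu).differentiable (by simp) y
  rw [fderiv_clm_apply h1 h2]
  simp [add_comm]

abbrev E5 := (ℝ × ℝ × ℝ) × ℝ × ℝ

def bfun (s11 s12 s : ℝ × ℝ × ℝ → ℝ) (Q : E5) : ℝ :=
  fderiv ℝ (pd3 s) Q.1 (s11 Q.1, s12 Q.1, Q.2.1) - fderiv ℝ s Q.1 (pd3 s11 Q.1, pd3 s12 Q.1, Q.2.2)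
def dt (s11 s12 : ℝ × ℝ × ℝ → ℝ) (q : ℝ × ℝ × ℝ) : ℝ := s11 q * pd3 s12 q - s12 q * pd3 s11 q
def be1 (s11 s12 : ℝ × ℝ × ℝ → ℝ) (Q : E5) : ℝ :=
  (bfun s11 s12 s11 Q * pd3 s12 Q.1 - bfun s11 s12 s12 Q * pd3 s11 Q.1) / dt s11 s12 Q.1
def be2 (s11 s12 : ℝ × ℝ × ℝ → ℝ) (Q : E5) : ℝ :=
  (s11 Q.1 * bfun s11 s12 s12 Q - s12 Q.1 * bfun s11 s12 s11 Q) / dt s11 s12 Q.1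
def Phi (s11 s12 : ℝ × ℝ × ℝ → ℝ) (u : ℝ × ℝ → ℝ) (y : ℝ × ℝ) : E5 :=
  (gr u y, X1 s11 s12 u u y, Yf s11 s12 u u y)

lemma bfun_contDiff {s11 s12 s : ℝ × ℝ × ℝ → ℝ} (h1 : ContDiff ℝ (⊤ : ℕ∞) s11) (h2 : ContDiff ℝ (⊤ : ℕ∞) s12)
    (h3 : ContDiff ℝ (⊤ : ℕ∞) s) : ContDiff ℝ 1 (bfun s11 s12 s) := by
  have f1 : ContDiff ℝ 1 (fderiv ℝ (pd3 s)) := c1 ((pd3_contDiff h3).fderiv_right (m := (⊤ : ℕ∞)) (by simp))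
  have f2 : ContDiff ℝ 1 (fderiv ℝ s) := c1 (h3.fderiv_right (m := (⊤ : ℕ∞)) (by simp))
  have p : ContDiff ℝ 1 (fun Q : E5 => Q.1) := contDiff_fst
  have p1 : ContDiff ℝ 1 (fun Q : E5 => Q.2.1) := contDiff_fst.comp contDiff_snd
  have p2 : ContDiff ℝ 1 (fun Q : E5 => Q.2.2) := contDiff_snd.comp contDiff_snd
  unfold bfun
  refine ContDiff.sub ((f1.comp p).clm_apply ?_) ((f2.comp p).clm_apply ?_)
  · exact ((c1 h1).comp p).prodMk (((c1 h2).comp p).prodMk p1)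
  · exact ((c1 (pd3_contDiff h1)).comp p).prodMk (((c1 (pd3_contDiff h2)).comp p).prodMk p2)

lemma dt_contDiff {s11 s12 : ℝ × ℝ × ℝ → ℝ} (h1 : ContDiff ℝ (⊤ : ℕ∞) s11) (h2 : ContDiff ℝ (⊤ : ℕ∞) s12) :
    ContDiff ℝ 1 (dt s11 s12) := by
  unfold dt
  exact ((c1 h1).mul (c1 (pd3_contDiff h2))).sub ((c1 h2).mul (c1 (pd3_contDiff h1)))

lemma dt_ne {s11 s12 : ℝ × ℝ × ℝ → ℝ} (h : RankCond s11 s12) (q : ℝ × ℝ × ℝ) : dt s11 s12 q ≠ 0 := abs_pos.1 (h q)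

lemma be1_contDiff {s11 s12 : ℝ × ℝ × ℝ → ℝ} (h1 : ContDiff ℝ (⊤ : ℕ∞) s11) (h2 : ContDiff ℝ (⊤ : ℕ∞) s12)
    (h : RankCond s11 s12) : ContDiff ℝ 1 (be1 s11 s12) := by
  have p : ContDiff ℝ 1 (fun Q : E5 => Q.1) := contDiff_fst
  unfold be1
  refine ContDiff.div ?_ ((dt_contDiff h1 h2).comp p) fun Q => dt_ne h _
  exact ((bfun_contDiff h1 h2 h1).mul ((c1 (pd3_contDiff h2)).comp p)).sub ((bfun_contDiff h1 h2 h2).mul ((c1 (pd3_contDiff h1)).comp p))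

lemma be2_contDiff {s11 s12 : ℝ × ℝ × ℝ → ℝ} (h1 : ContDiff ℝ (⊤ : ℕ∞) s11) (h2 : ContDiff ℝ (⊤ : ℕ∞) s12)
    (h : RankCond s11 s12) : ContDiff ℝ 1 (be2 s11 s12) := by
  have p : ContDiff ℝ 1 (fun Q : E5 => Q.1) := contDiff_fst
  unfold be2
  refine ContDiff.div ?_ ((dt_contDiff h1 h2).comp p) fun Q => dt_ne h _
  exact (((c1 h1).comp p).mul (bfun_contDiff h1 h2 h2)).sub (((c1 h2).comp p).mul (bfun_contDiff h1 h2 h1))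

lemma commXY {s11 s12 : ℝ × ℝ × ℝ → ℝ} (h1 : ContDiff ℝ (⊤ : ℕ∞) s11) (h2 : ContDiff ℝ (⊤ : ℕ∞) s12)
    (h : RankCond s11 s12) {u z : ℝ × ℝ → ℝ} (hu : ContDiff ℝ 1 u) (hz : ContDiff ℝ 2 z) (y : ℝ × ℝ) :
    X1 s11 s12 u (Yf s11 s12 u z) y - Yf s11 s12 u (X1 s11 s12 u z) y =
      be1 s11 s12 (Phi s11 s12 u y) * X1 s11 s12 u z y + be2 s11 s12 (Phi s11 s12 u y) * Yf s11 s12 u z y := by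
  have g1 := c1 (pd3_contDiff h1)
  have g2 := c1 (pd3_contDiff h2)
  have sym : IsSymmSndFDerivAt ℝ z y := (hz.contDiffAt).isSymmSndFDerivAt (by simp)
  rw [X1_eq s11 s12 u (Yf s11 s12 u z), Yf_eq s11 s12 u (X1 s11 s12 u z)]
  unfold Yf X1
  rw [VF_fderiv g1 g2 hu hz, VF_fderiv (c1 h1) (c1 h2) hu hz, sym _ _]
  rw [SS_fderiv g1 g2 hu, SS_fderiv (c1 h1) (c1 h2) hu]
  rw [VF_eq, VF_eq]
  have key : ((fderiv ℝ (pd3 s11) (gr u y) ((SS s11 s12 u y).1, (SS s11 s12 u y).2, fderiv ℝ u y (SS s11 s12 u y)),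
      fderiv ℝ (pd3 s12) (gr u y) ((SS s11 s12 u y).1, (SS s11 s12 u y).2, fderiv ℝ u y (SS s11 s12 u y))) : ℝ × ℝ)
      - (fderiv ℝ s11 (gr u y) ((SS (pd3 s11) (pd3 s12) u y).1, (SS (pd3 s11) (pd3 s12) u y).2, fderiv ℝ u y (SS (pd3 s11) (pd3 s12) u y)),
      fderiv ℝ s12 (gr u y) ((SS (pd3 s11) (pd3 s12) u y).1, (SS (pd3 s11) (pd3 s12) u y).2, fderiv ℝ u y (SS (pd3 s11) (pd3 s12) u y)))
      = be1 s11 s12 (Phi s11 s12 u y) • SS s11 s12 u y + be2 s11 s12 (Phi s11 s12 u y) • SS (pd3 s11) (pd3 s12) u y := by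
    have hd := dt_ne h (gr u y)
    have e1 : ∀ s, bfun s11 s12 s (Phi s11 s12 u y) = fderiv ℝ (pd3 s) (gr u y) ((SS s11 s12 u y).1, (SS s11 s12 u y).2, fderiv ℝ u y (SS s11 s12 u y))
      - fderiv ℝ s (gr u y) ((SS (pd3 s11) (pd3 s12) u y).1, (SS (pd3 s11) (pd3 s12) u y).2, fderiv ℝ u y (SS (pd3 s11) (pd3 s12) u y)) := by
      intro s
      unfold bfun Phi; rw [X1_eq, Yf_eq]; rfl
    have e2 := e1 s11
    have e3 := e1 s12
    rw [Prod.mk_sub_mk, ← e2, ← e3]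
    unfold be1 be2
    have e4 : (Phi s11 s12 u y).1 = gr u y := rfl
    rw [e4]
    ext
    · simp only [Prod.fst_add, Prod.smul_fst, smul_eq_mul, SS]; field_simp; unfold dt; ring
    · simp only [Prod.snd_add, Prod.smul_snd, smul_eq_mul, SS]; field_simp; unfold dt; ring
  have := congrArg (fderiv ℝ z y) key
  rw [map_sub, map_add, map_smul, map_smul] at this
  simp only [smul_eq_mul] at this
  linarith

/-- C¹ functions are bounded and Lipschitz on balls -/
lemma c1_bd {E : Type*} [NormedAddCommGroup E] [NormedSpace ℝ E] [ProperSpace E] {G : E → ℝ} (hG : ContDiff ℝ 1 G) (R : ℝ) :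
    ∃ Λ : ℝ, ∀ L, Λ ≤ L → (∀ p ∈ Metric.closedBall (0 : E) R, |G p| ≤ L) ∧
      ∀ p ∈ Metric.closedBall (0 : E) R, ∀ q ∈ Metric.closedBall (0 : E) R, |G p - G q| ≤ L * ‖p - q‖ := by
  have hc : IsCompact (Metric.closedBall (0 : E) R) := isCompact_closedBall _ _
  obtain ⟨B1, h1⟩ := hc.exists_bound_of_continuousOn hG.continuous.continuousOn
  obtain ⟨B2, h2⟩ := hc.exists_bound_of_continuousOn (hG.continuous_fderiv (by simp)).continuousOn
  refine ⟨max B1 B2, fun L hL => ⟨fun p hp => ((h1 p hp).trans (le_max_left _ _)).trans hL, fun p hp q hq => ?_⟩⟩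
  exact (convex_closedBall (0 : E) R).norm_image_sub_le_of_norm_fderiv_le (𝕜 := ℝ) (f := G)
    (fun ξ _ => hG.differentiable (by simp) ξ) (fun ξ hξ => ((h2 ξ hξ).trans (le_max_right _ _)).trans hL) hq hp

structure Hyp (s11 s12 : ℝ × ℝ × ℝ → ℝ) (M α C ε : ℝ) (K : Set (ℝ × ℝ)) (u z : ℝ × ℝ → ℝ) : Prop where
  hε : 0 < ε
  hε1 : ε ≤ 1
  hu : ContDiff ℝ 1 u
  hz : ContDiff ℝ 2 z
  lip : ∀ p ∈ K, |X1 s11 s12 u u p| + |Yf s11 s12 u u p| ≤ M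
  eqn : ∀ q ∈ K, ∑ i : Fin 2, ∑ j : Fin 2,
            aC s11 s12 ε u i j q * XX s11 s12 ε u i (XX s11 s12 ε u j z) q = 0
  bd : ∀ q ∈ K, |u q| + |X1 s11 s12 u u q| + |X2 s11 s12 ε u u q| ≤ C
  hol : ∀ q ∈ K, ∀ r ∈ K,
          |X1 s11 s12 u u q - X1 s11 s12 u u r| +
            |X2 s11 s12 ε u u q - X2 s11 s12 ε u u r| ≤ C * dist q r ^ α

def a11f (ν : ℝ × ℝ) : ℝ := 1 - ν.1 * ν.1 / (1 + (ν.1 ^ 2 + ν.2 ^ 2))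
def a12f (ν : ℝ × ℝ) : ℝ := 0 - ν.1 * ν.2 / (1 + (ν.1 ^ 2 + ν.2 ^ 2))
def a22f (ν : ℝ × ℝ) : ℝ := 1 - ν.2 * ν.2 / (1 + (ν.1 ^ 2 + ν.2 ^ 2))

lemma den_pos (ν : ℝ × ℝ) : 0 < 1 + (ν.1 ^ 2 + ν.2 ^ 2) := by positivity

lemma a11f_contDiff : ContDiff ℝ 1 a11f := by
  unfold a11f
  exact contDiff_const.sub (ContDiff.div (by fun_prop) (by fun_prop) fun ν => (den_pos ν).ne')
lemma a12f_contDiff : ContDiff ℝ 1 a12f := by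
  unfold a12f
  exact contDiff_const.sub (ContDiff.div (by fun_prop) (by fun_prop) fun ν => (den_pos ν).ne')
lemma a22f_contDiff : ContDiff ℝ 1 a22f := by
  unfold a22f
  exact contDiff_const.sub (ContDiff.div (by fun_prop) (by fun_prop) fun ν => (den_pos ν).ne')

def nu (s11 s12 : ℝ × ℝ × ℝ → ℝ) (ε : ℝ) (u : ℝ × ℝ → ℝ) (y : ℝ × ℝ) : ℝ × ℝ := (X1 s11 s12 u u y, X2 s11 s12 ε u u y)

lemma gradN_sq (s11 s12 : ℝ × ℝ × ℝ → ℝ) (ε : ℝ) (u f : ℝ × ℝ → ℝ) (p : ℝ × ℝ) :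
    gradN s11 s12 ε u f p ^ 2 = X1 s11 s12 u f p ^ 2 + X2 s11 s12 ε u f p ^ 2 := by
  unfold gradN; exact Real.sq_sqrt (by positivity)

lemma eqn_expand (s11 s12 : ℝ × ℝ × ℝ → ℝ) (ε : ℝ) (u z : ℝ × ℝ → ℝ) (q : ℝ × ℝ) :
    ∑ i : Fin 2, ∑ j : Fin 2, aC s11 s12 ε u i j q * XX s11 s12 ε u i (XX s11 s12 ε u j z) q =
    a11f (nu s11 s12 ε u q) * X1 s11 s12 u (X1 s11 s12 u z) q + a12f (nu s11 s12 ε u q) * X1 s11 s12 u (X2 s11 s12 ε u z) q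
    + a12f (nu s11 s12 ε u q) * X2 s11 s12 ε u (X1 s11 s12 u z) q + a22f (nu s11 s12 ε u q) * X2 s11 s12 ε u (X2 s11 s12 ε u z) q := by
  simp only [Fin.sum_univ_two, aC, XX, gradN_sq, a11f, a12f, a22f, nu]
  simp
  ring

lemma interp {X A t : ℝ} (hA : 0 ≤ A) (ht : 0 ≤ t) (h1 : X ≤ A) (h2 : X ≤ A * t) : X ≤ A * t ^ (1 / 10 : ℝ) := by
  rcases le_total t 1 with h | h
  · exact h2.trans (by gcongr; exact Real.self_le_rpow_of_le_one ht h (by norm_num))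
  · exact h1.trans (le_mul_of_one_le_right hA (Real.one_le_rpow h (by norm_num)))

lemma ell {ν : ℝ × ℝ} {C : ℝ} (h : |ν.1| + |ν.2| ≤ C) :
    1 ≤ (1 + C ^ 2) * a11f ν ∧ 1 ≤ (1 + C ^ 2) * (a11f ν * a22f ν - a12f ν ^ 2) := by
  have hC : ν.1 ^ 2 + ν.2 ^ 2 ≤ C ^ 2 := by
    rw [← sq_abs ν.1, ← sq_abs ν.2]
    nlinarith [abs_nonneg ν.1, abs_nonneg ν.2]
  have hp := den_pos ν
  have e1 : a11f ν = (1 + ν.2 ^ 2) / (1 + (ν.1 ^ 2 + ν.2 ^ 2)) := by unfold a11f; field_simp; ring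
  have e2 : a11f ν * a22f ν - a12f ν ^ 2 = 1 / (1 + (ν.1 ^ 2 + ν.2 ^ 2)) := by unfold a11f a22f a12f; field_simp; ring
  rw [e2, e1, mul_div_assoc', mul_div_assoc', le_div_iff₀ hp, le_div_iff₀ hp]
  constructor <;> nlinarith [sq_nonneg ν.2, sq_nonneg C, mul_nonneg (sq_nonneg C) (sq_nonneg ν.2)]

lemma norm_lt2 {a b R : ℝ} (ha : |a| ≤ R) (hb : |b| ≤ R) : ‖((a, b) : ℝ × ℝ)‖ ≤ R := by
  rw [Prod.norm_mk]; exact max_le ha hb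

set_option maxHeartbeats 2000000 in
lemma uni {s11 s12 : ℝ × ℝ × ℝ → ℝ} (h1 : ContDiff ℝ (⊤ : ℕ∞) s11) (h2 : ContDiff ℝ (⊤ : ℕ∞) s12)
    (hr : RankCond s11 s12) (M α C : ℝ) (hα : 0 < α) (hα1 : α < 1) (hC : 0 < C) {K : Set (ℝ × ℝ)} (hK : IsCompact K) :
    ∃ L : ℝ, 1 ≤ L ∧ ∀ (ε : ℝ) (u z : ℝ × ℝ → ℝ), Hyp s11 s12 M α C ε K u z →
      (∀ y ∈ K, ‖SS s11 s12 u y‖ ≤ L ∧ ‖SS (pd3 s11) (pd3 s12) u y‖ ≤ L ∧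
        1 ≤ L * |(SS s11 s12 u y).1 * (SS (pd3 s11) (pd3 s12) u y).2 - (SS s11 s12 u y).2 * (SS (pd3 s11) (pd3 s12) u y).1| ∧
        |be1 s11 s12 (Phi s11 s12 u y)| ≤ L ∧ |be2 s11 s12 (Phi s11 s12 u y)| ≤ L ∧
        1 ≤ L * a11f (nu s11 s12 ε u y) ∧ |a12f (nu s11 s12 ε u y)| ≤ L ∧ |a22f (nu s11 s12 ε u y)| ≤ L) ∧
      (∀ (x : ℝ × ℝ) (ω : ℝ), 0 < ω → ω ≤ 1 → Metric.closedBall x (ω / 2) ⊆ K →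
      (∀ y ∈ Metric.closedBall x (ω / 2), Dd (SS s11 s12 u) (SS (pd3 s11) (pd3 s12) u) ε (X1 s11 s12 u z) (X2 s11 s12 ε u z) y
         ≤ 2 * Dd (SS s11 s12 u) (SS (pd3 s11) (pd3 s12) u) ε (X1 s11 s12 u z) (X2 s11 s12 ε u z) x) →
      Loc L (α / 10) ε ω x (SS s11 s12 u) (SS (pd3 s11) (pd3 s12) u) (fun y => a11f (nu s11 s12 ε u y))
        (fun y => a12f (nu s11 s12 ε u y)) (fun y => a22f (nu s11 s12 ε u y)) (fun y => be1 s11 s12 (Phi s11 s12 u y))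
        (fun y => be2 s11 s12 (Phi s11 s12 u y)) (X1 s11 s12 u z) (X2 s11 s12 ε u z)) := by
  obtain ⟨R0, hR0⟩ := hK.isBounded.exists_norm_le
  set R := max R0 (max C |M|) with hR
  have g1 := c1 (pd3_contDiff h1)
  have g2 := c1 (pd3_contDiff h2)
  obtain ⟨Λ1, b1⟩ := c1_bd (c1 h1) R
  obtain ⟨Λ2, b2⟩ := c1_bd (c1 h2) R
  obtain ⟨Λ3, b3⟩ := c1_bd g1 R
  obtain ⟨Λ4, b4⟩ := c1_bd g2 R
  obtain ⟨Λ5, b5⟩ := c1_bd (ContDiff.div (contDiff_const (c := (1 : ℝ))) (dt_contDiff h1 h2) (dt_ne hr)) R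
  obtain ⟨Λ6, b6⟩ := c1_bd (be1_contDiff h1 h2 hr) R
  obtain ⟨Λ7, b7⟩ := c1_bd (be2_contDiff h1 h2 hr) R
  obtain ⟨Λ8, b8⟩ := c1_bd a11f_contDiff R
  obtain ⟨Λ9, b9⟩ := c1_bd a12f_contDiff R
  obtain ⟨Λ10, b10⟩ := c1_bd a22f_contDiff R
  set L0 := 1 + |Λ1| + |Λ2| + |Λ3| + |Λ4| + |Λ5| + |Λ6| + |Λ7| + |Λ8| + |Λ9| + |Λ10| with hL0
  have hL01 : 1 ≤ L0 := by
    have : 0 ≤ |Λ1| + |Λ2| + |Λ3| + |Λ4| + |Λ5| + |Λ6| + |Λ7| + |Λ8| + |Λ9| + |Λ10| := by positivity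
    linarith
  have q1 := abs_nonneg Λ1
  have q2 := abs_nonneg Λ2
  have q3 := abs_nonneg Λ3
  have q4 := abs_nonneg Λ4
  have q5 := abs_nonneg Λ5
  have q6 := abs_nonneg Λ6
  have q7 := abs_nonneg Λ7
  have q8 := abs_nonneg Λ8
  have q9 := abs_nonneg Λ9
  have q10 := abs_nonneg Λ10
  specialize b1 L0 (by linarith [le_abs_self Λ1])
  specialize b2 L0 (by linarith [le_abs_self Λ2])
  specialize b3 L0 (by linarith [le_abs_self Λ3])
  specialize b4 L0 (by linarith [le_abs_self Λ4])
  specialize b5 L0 (by linarith [le_abs_self Λ5])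
  specialize b6 L0 (by linarith [le_abs_self Λ6])
  specialize b7 L0 (by linarith [le_abs_self Λ7])
  specialize b8 L0 (by linarith [le_abs_self Λ8])
  specialize b9 L0 (by linarith [le_abs_self Λ9])
  specialize b10 L0 (by linarith [le_abs_self Λ10])
  clear_value L0
  clear hL0 q1 q2 q3 q4 q5 q6 q7 q8 q9 q10
  set Lu := 1 + 2 * L0 ^ 2 * |M| with hLu
  have hLu1 : 1 ≤ Lu := by
    have : 0 ≤ 2 * L0 ^ 2 * |M| := by positivity
    linarith
  set L := L0 + L0 * Lu + L0 * C + (1 + C ^ 2) + 2 * L0 * (Lu + C) with hL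
  have p1 : 0 ≤ L0 * Lu := by positivity
  have p2 : 0 ≤ L0 * C := by positivity
  have p3 : 0 ≤ 1 + C ^ 2 := by positivity
  have p4 : 0 ≤ 2 * L0 * (Lu + C) := by positivity
  have l0 : L0 ≤ L := by linarith
  have l1 : L0 * Lu ≤ L := by linarith
  have l2 : L0 * C ≤ L := by linarith
  have l3 : 1 + C ^ 2 ≤ L := by linarith
  have l4 : 2 * L0 * (Lu + C) ≤ L := by linarith
  clear_value L
  refine ⟨L, by linarith, fun ε u z H => ?_⟩
  have hε := H.hε
  have hε1 := H.hε1
  have grR : ∀ y ∈ K, gr u y ∈ Metric.closedBall (0 : ℝ × ℝ × ℝ) R := by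
    intro y hy
    rw [mem_closedBall_zero_iff]
    have n := hR0 y hy
    have hRR : R0 ≤ R := le_max_left _ _
    have hCR : C ≤ R := (le_max_left _ _).trans (le_max_right _ _)
    have hb := H.bd y hy
    unfold gr
    rw [Prod.norm_mk]
    refine max_le (((norm_fst_le y).trans n).trans hRR) (norm_lt2 (((norm_snd_le y).trans n).trans hRR) ?_)
    linarith [abs_nonneg (X1 s11 s12 u u y), abs_nonneg (X2 s11 s12 ε u u y)]
  have PhR : ∀ y ∈ K, Phi s11 s12 u y ∈ Metric.closedBall (0 : E5) R := by
    intro y hy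
    have n := grR y hy
    rw [mem_closedBall_zero_iff] at n ⊢
    have hl := H.lip y hy
    have hM : M ≤ R := (le_abs_self M).trans ((le_max_right _ _).trans (le_max_right _ _))
    unfold Phi
    rw [Prod.norm_mk]
    refine max_le n (norm_lt2 ?_ ?_)
    · linarith [abs_nonneg (Yf s11 s12 u u y)]
    · linarith [abs_nonneg (X1 s11 s12 u u y)]
  have nuC : ∀ y ∈ K, |(nu s11 s12 ε u y).1| + |(nu s11 s12 ε u y).2| ≤ C := by
    intro y hy
    have hb := H.bd y hy
    unfold nu; dsimp only
    linarith [abs_nonneg (u y)]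
  have nuR : ∀ y ∈ K, nu s11 s12 ε u y ∈ Metric.closedBall (0 : ℝ × ℝ) R := by
    intro y hy
    rw [mem_closedBall_zero_iff]
    have hCR : C ≤ R := (le_max_left _ _).trans (le_max_right _ _)
    have := nuC y hy
    exact norm_lt2 (a := (nu s11 s12 ε u y).1) (b := (nu s11 s12 ε u y).2)
      (by linarith [abs_nonneg (nu s11 s12 ε u y).2]) (by linarith [abs_nonneg (nu s11 s12 ε u y).1])
  have bS : ∀ y ∈ K, ‖SS s11 s12 u y‖ ≤ L0 := fun y hy => norm_lt2 (b1.1 _ (grR y hy)) (b2.1 _ (grR y hy))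
  have bT : ∀ y ∈ K, ‖SS (pd3 s11) (pd3 s12) u y‖ ≤ L0 := fun y hy => norm_lt2 (b3.1 _ (grR y hy)) (b4.1 _ (grR y hy))
  have bd : ∀ y ∈ K, 1 ≤ L0 * |(SS s11 s12 u y).1 * (SS (pd3 s11) (pd3 s12) u y).2 - (SS s11 s12 u y).2 * (SS (pd3 s11) (pd3 s12) u y).1| := by
    intro y hy
    have : |1 / dt s11 s12 (gr u y)| ≤ L0 := b5.1 _ (grR y hy)
    rw [abs_div, abs_one, div_le_iff₀ (abs_pos.2 (dt_ne hr _))] at this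
    exact this
  have bu : ∀ y ∈ K, ‖fderiv ℝ u y‖ ≤ Lu := by
    intro y hy
    refine ContinuousLinearMap.opNorm_le_bound _ (by linarith) fun w => ?_
    have h := dirB (fderiv ℝ u y) _ _ w (bS y hy) (bT y hy) (bd y hy)
    have hl := H.lip y hy
    rw [X1_eq, Yf_eq] at hl
    calc _ ≤ _ := h
      _ ≤ 2 * L0 ^ 2 * ‖w‖ * |M| := by gcongr; exact hl.trans (le_abs_self M)
      _ = (2 * L0 ^ 2 * |M|) * ‖w‖ := by ring
      _ ≤ _ := by gcongr; linarith
  have w1 : ∀ y ∈ K, |a11f (nu s11 s12 ε u y)| ≤ L0 := fun y hy => b8.1 _ (nuR y hy)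
  refine ⟨fun y hy => ⟨(bS y hy).trans l0, (bT y hy).trans l0, (bd y hy).trans (by gcongr), (b6.1 _ (PhR y hy)).trans l0,
    (b7.1 _ (PhR y hy)).trans l0, ?_, (b9.1 _ (nuR y hy)).trans l0, (b10.1 _ (nuR y hy)).trans l0⟩, ?_⟩
  · have h := (ell (nuC y hy)).1
    have : 0 ≤ a11f (nu s11 s12 ε u y) := by
      by_contra hn; push Not at hn
      nlinarith [mul_nonpos_of_nonneg_of_nonpos p3 hn.le]
    exact h.trans (by gcongr)
  intro x ω hω hω1 hball hD
  have hx : x ∈ K := hball (Metric.mem_closedBall_self (by linarith))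
  have d1 : ∀ y ∈ Metric.closedBall x (ω / 2), ‖y - x‖ ≤ 1 := by
    intro y hy
    rw [mem_closedBall_iff_norm] at hy; linarith
  have dα : ∀ y ∈ Metric.closedBall x (ω / 2), ‖y - x‖ ^ α ≤ ‖y - x‖ ^ (α / 10) := fun y hy =>
    Real.rpow_le_rpow_of_exponent_ge' (norm_nonneg _) (d1 y hy) (by positivity) (by linarith)
  have dgr : ∀ y ∈ Metric.closedBall x (ω / 2), ‖gr u x - gr u y‖ ≤ Lu * ‖y - x‖ := by
    intro y hy
    have hu : |u x - u y| ≤ Lu * ‖y - x‖ := by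
      have := (convex_closedBall x (ω / 2)).norm_image_sub_le_of_norm_fderiv_le (𝕜 := ℝ) (f := u)
        (fun ξ _ => H.hu.differentiable (by simp) ξ) (fun ξ hξ => bu ξ (hball hξ)) hy (Metric.mem_closedBall_self (by linarith))
      rwa [norm_sub_rev x y] at this
    have hx1 : ‖x - y‖ ≤ Lu * ‖y - x‖ := by
      rw [norm_sub_rev]; exact le_mul_of_one_le_left (norm_nonneg _) hLu1
    unfold gr
    rw [Prod.mk_sub_mk, Prod.mk_sub_mk, Prod.norm_mk]
    exact max_le ((norm_fst_le (x - y)).trans hx1) (norm_lt2 ((norm_snd_le (x - y)).trans hx1) hu)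
  have dnu : ∀ y ∈ Metric.closedBall x (ω / 2), |(nu s11 s12 ε u x).1 - (nu s11 s12 ε u y).1| +
      |(nu s11 s12 ε u x).2 - (nu s11 s12 ε u y).2| ≤ C * ‖y - x‖ ^ α := by
    intro y hy
    have := H.hol x hx y (hball hy)
    rwa [dist_comm, dist_eq_norm] at this
  have dnu' : ∀ y ∈ Metric.closedBall x (ω / 2), ‖nu s11 s12 ε u x - nu s11 s12 ε u y‖ ≤ C * ‖y - x‖ ^ α := by
    intro y hy
    have := dnu y hy
    exact norm_lt2 (by linarith [abs_nonneg ((nu s11 s12 ε u x).2 - (nu s11 s12 ε u y).2)])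
      (by linarith [abs_nonneg ((nu s11 s12 ε u x).1 - (nu s11 s12 ε u y).1)])
  have dPh : ∀ y ∈ Metric.closedBall x (ω / 2), ‖Phi s11 s12 u y - Phi s11 s12 u x‖ ≤ (Lu + C) * (ε⁻¹ * ‖y - x‖ ^ α) := by
    intro y hy
    have hn := dnu y hy
    have hg := dgr y hy
    have hi : 1 ≤ ε⁻¹ := (one_le_inv₀ hε).2 hε1
    have n0 := norm_nonneg (y - x)
    have hp0 : 0 ≤ ‖y - x‖ ^ α := by positivity
    have hda : ‖y - x‖ ≤ ‖y - x‖ ^ α := Real.self_le_rpow_of_le_one n0 (d1 y hy) hα1.le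
    have hda2 : ‖y - x‖ ^ α ≤ ε⁻¹ * ‖y - x‖ ^ α := le_mul_of_one_le_left hp0 hi
    have k1 : Lu * ‖y - x‖ ≤ (Lu + C) * (ε⁻¹ * ‖y - x‖ ^ α) := by
      calc _ ≤ Lu * (ε⁻¹ * ‖y - x‖ ^ α) := by gcongr; linarith
        _ ≤ _ := by gcongr; linarith
    have k2 : C * ‖y - x‖ ^ α ≤ (Lu + C) * (ε⁻¹ * ‖y - x‖ ^ α) := by
      gcongr; linarith
    have k3 : ε⁻¹ * (C * ‖y - x‖ ^ α) ≤ (Lu + C) * (ε⁻¹ * ‖y - x‖ ^ α) := by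
      calc _ = C * (ε⁻¹ * ‖y - x‖ ^ α) := by ring
        _ ≤ _ := by gcongr; linarith
    unfold Phi
    rw [Prod.mk_sub_mk, Prod.mk_sub_mk, Prod.norm_mk]
    unfold nu at hn
    dsimp only at hn
    refine max_le ?_ (norm_lt2 ?_ ?_)
    · exact (norm_sub_rev (gr u y) (gr u x)).trans_le (hg.trans k1)
    · rw [abs_sub_comm]
      refine le_trans ?_ k2
      linarith [abs_nonneg (X2 s11 s12 ε u u x - X2 s11 s12 ε u u y)]
    · refine le_trans ?_ k3
      rw [abs_sub_comm, ← div_eq_inv_mul, le_div_iff₀ hε]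
      have e : |Yf s11 s12 u u x - Yf s11 s12 u u y| * ε = |X2 s11 s12 ε u u x - X2 s11 s12 ε u u y| := by
        unfold X2; rw [← mul_sub, abs_mul, abs_of_pos hε]; ring
      rw [e]
      linarith [abs_nonneg (X1 s11 s12 u u x - X1 s11 s12 u u y)]
  have holA : ∀ f : ℝ × ℝ → ℝ, (∀ p ∈ Metric.closedBall (0 : ℝ × ℝ) R, ∀ q ∈ Metric.closedBall (0 : ℝ × ℝ) R, |f p - f q| ≤ L0 * ‖p - q‖) →
      ∀ y ∈ Metric.closedBall x (ω / 2), |f (nu s11 s12 ε u x) - f (nu s11 s12 ε u y)| ≤ L * ‖y - x‖ ^ (α / 10) := by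
    intro f hf y hy
    calc _ ≤ _ := hf _ (nuR x hx) _ (nuR y (hball hy))
      _ ≤ L0 * (C * ‖y - x‖ ^ (α / 10)) := by
        gcongr; exact (dnu' y hy).trans (by gcongr ?_ * ?_; exact dα y hy)
      _ = (L0 * C) * ‖y - x‖ ^ (α / 10) := by ring
      _ ≤ _ := by gcongr
  have holB : ∀ f : E5 → ℝ, (∀ p ∈ Metric.closedBall (0 : E5) R, |f p| ≤ L0) → (∀ p ∈ Metric.closedBall (0 : E5) R, ∀ q ∈ Metric.closedBall (0 : E5) R, |f p - f q| ≤ L0 * ‖p - q‖) →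
      ∀ y ∈ Metric.closedBall x (ω / 2), |f (Phi s11 s12 u y) - f (Phi s11 s12 u x)| ≤ L * ε ^ (-(1/10) : ℝ) * ‖y - x‖ ^ (α / 10) := by
    intro f hf0 hf y hy
    have n0 := norm_nonneg (y - x)
    have i1 : |f (Phi s11 s12 u y) - f (Phi s11 s12 u x)| ≤ L := by
      have z1 := hf0 _ (PhR x hx)
      have z2 := hf0 _ (PhR y (hball hy))
      have z3 := abs_sub (f (Phi s11 s12 u y)) (f (Phi s11 s12 u x))
      nlinarith
    have i2 : |f (Phi s11 s12 u y) - f (Phi s11 s12 u x)| ≤ L * (ε⁻¹ * ‖y - x‖ ^ α) := by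
      calc _ ≤ _ := hf _ (PhR y (hball hy)) _ (PhR x hx)
        _ ≤ L0 * ((Lu + C) * (ε⁻¹ * ‖y - x‖ ^ α)) := by gcongr; exact dPh y hy
        _ = (L0 * (Lu + C)) * (ε⁻¹ * ‖y - x‖ ^ α) := by ring
        _ ≤ _ := by gcongr; linarith
    have := interp (by linarith) (by positivity) i1 i2
    rw [Real.mul_rpow (by positivity) (by positivity), ← Real.rpow_mul n0, Real.inv_rpow hε.le, ← Real.rpow_neg hε.le, ← mul_assoc] at this
    rwa [show α * (1 / 10) = α / 10 by ring] at this
  have hv1 : ContDiff ℝ 1 (X1 s11 s12 u z) := VF_contDiff (c1 h1) (c1 h2) H.hu H.hz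
  have hvY : ContDiff ℝ 1 (Yf s11 s12 u z) := VF_contDiff g1 g2 H.hu H.hz
  have hv2 : ContDiff ℝ 1 (X2 s11 s12 ε u z) := contDiff_const.mul hvY
  have lipS : ∀ a b : ℝ × ℝ × ℝ → ℝ, (∀ p ∈ Metric.closedBall (0 : ℝ × ℝ × ℝ) R, ∀ q ∈ Metric.closedBall (0 : ℝ × ℝ × ℝ) R, |a p - a q| ≤ L0 * ‖p - q‖) →
      (∀ p ∈ Metric.closedBall (0 : ℝ × ℝ × ℝ) R, ∀ q ∈ Metric.closedBall (0 : ℝ × ℝ × ℝ) R, |b p - b q| ≤ L0 * ‖p - q‖) →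
      ∀ y ∈ Metric.closedBall x (ω / 2), ‖SS a b u x - SS a b u y‖ ≤ L * ‖y - x‖ := by
    intro a b ha hb y hy
    have k : L0 * ‖gr u x - gr u y‖ ≤ L * ‖y - x‖ := by
      calc _ ≤ L0 * (Lu * ‖y - x‖) := by gcongr; exact dgr y hy
        _ = (L0 * Lu) * ‖y - x‖ := by ring
        _ ≤ _ := by gcongr
    exact norm_lt2 ((ha _ (grR x hx) _ (grR y (hball hy))).trans k) ((hb _ (grR x hx) _ (grR y (hball hy))).trans k)
  have el := ell (nuC x hx)
  have pos1 : 0 ≤ a11f (nu s11 s12 ε u x) := by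
    by_contra hn; push Not at hn
    nlinarith [mul_nonpos_of_nonneg_of_nonpos p3 hn.le]
  have pos2 : 0 ≤ a11f (nu s11 s12 ε u x) * a22f (nu s11 s12 ε u x) - a12f (nu s11 s12 ε u x) ^ 2 := by
    by_contra hn; push Not at hn
    nlinarith [mul_nonpos_of_nonneg_of_nonpos p3 hn.le]
  refine ⟨hv1, hv2, (SS_contDiff (c1 h1) (c1 h2) H.hu).continuous, (SS_contDiff g1 g2 H.hu).continuous,
    fun y hy => (bS y (hball hy)).trans l0, fun y hy => (bT y (hball hy)).trans l0, fun y hy => (bd y (hball hy)).trans (by gcongr),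
    lipS _ _ b1.2 b2.2, lipS _ _ b3.2 b4.2, (w1 x hx).trans l0, (b9.1 _ (nuR x hx)).trans l0, (b10.1 _ (nuR x hx)).trans l0,
    holA _ b8.2, holA _ b9.2, holA _ b10.2, el.1.trans (by gcongr), el.2.trans (by gcongr), ?_, ?_,
    fun y hy => (b6.1 _ (PhR y (hball hy))).trans l0, fun y hy => (b7.1 _ (PhR y (hball hy))).trans l0,
    holB _ b6.1 b6.2, holB _ b7.1 b7.2, hD⟩
  · intro y hy
    have := H.eqn y (hball hy)
    rw [eqn_expand] at this
    rwa [X1_eq s11 s12 u (X1 s11 s12 u z), X1_eq s11 s12 u (X2 s11 s12 ε u z), X2_eq s11 s12 ε u (X1 s11 s12 u z),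
      X2_eq s11 s12 ε u (X2 s11 s12 ε u z)] at this
  · intro y hy
    have e := commXY h1 h2 hr H.hu H.hz y
    rw [X1_eq s11 s12 u (Yf s11 s12 u z), Yf_eq s11 s12 u (X1 s11 s12 u z)] at e
    have e2 : fderiv ℝ (X2 s11 s12 ε u z) y (SS s11 s12 u y) = ε * fderiv ℝ (Yf s11 s12 u z) y (SS s11 s12 u y) := by
      have : X2 s11 s12 ε u z = fun p => ε * Yf s11 s12 u z p := rfl
      rw [this, fderiv_const_mul (hvY.differentiable (by simp) y)]; simp
    rw [e2]
    unfold X2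
    linear_combination ε * e

lemma LpN_e {q : ℝ} (hq : 0 < q) {f : ℝ × ℝ → ℝ} (hf : Continuous f) {K : Set (ℝ × ℝ)} (hK : IsCompact K) :
    ENNReal.ofReal (LpN q f K) = eLpNorm f (ENNReal.ofReal q) (volume.restrict K) := by
  rw [MemLp.eLpNorm_eq_integral_rpow_norm (by simpa using hq) (by simp) (memLp_of_cont hf hK _)]
  simp [LpN, ENNReal.toReal_ofReal hq.le]

lemma LpN_le_iff {q : ℝ} (hq : 0 < q) {f : ℝ × ℝ → ℝ} (hf : Continuous f) {K : Set (ℝ × ℝ)} (hK : IsCompact K)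
    {B : ℝ} (hB : 0 ≤ B) :
    LpN q f K ≤ B ↔ eLpNorm f (ENNReal.ofReal q) (volume.restrict K) ≤ ENNReal.ofReal B := by
  rw [← LpN_e hq hf hK, ENNReal.ofReal_le_ofReal_iff hB]

lemma LpN_mono {q : ℝ} (hq : 0 < q) {f g : ℝ × ℝ → ℝ} (hf : Continuous f) (hg : Continuous g)
    {K : Set (ℝ × ℝ)} (hK : IsCompact K) (h : ∀ y ∈ K, |f y| ≤ |g y|) : LpN q f K ≤ LpN q g K := by
  rw [LpN_le_iff hq hf hK (LpN_nonneg _ _ _), LpN_e hq hg hK]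
  apply eLpNorm_mono_ae
  filter_upwards [ae_restrict_mem hK.measurableSet] with y hy
  exact h y hy

lemma LpN_add {q : ℝ} (hq : 1 ≤ q) {f g : ℝ × ℝ → ℝ} (hf : Continuous f) (hg : Continuous g)
    {K : Set (ℝ × ℝ)} (hK : IsCompact K) : LpN q (fun y => f y + g y) K ≤ LpN q f K + LpN q g K := by
  have hq0 : 0 < q := by linarith
  have hfg : Continuous (fun y => f y + g y) := hf.add hg
  rw [LpN_le_iff hq0 hfg hK (add_nonneg (LpN_nonneg _ _ _) (LpN_nonneg _ _ _)),
    ENNReal.ofReal_add (LpN_nonneg _ _ _) (LpN_nonneg _ _ _), LpN_e hq0 hf hK, LpN_e hq0 hg hK]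
  exact eLpNorm_add_le hf.aestronglyMeasurable hg.aestronglyMeasurable (by simpa using hq)

lemma LpN_cmul {q : ℝ} (hq : 0 < q) {f : ℝ × ℝ → ℝ} (hf : Continuous f) (c : ℝ)
    {K : Set (ℝ × ℝ)} (hK : IsCompact K) : LpN q (fun y => c * f y) K = |c| * LpN q f K := by
  unfold LpN
  have : ∀ y, |c * f y| ^ q = |c| ^ q * |f y| ^ q := fun y => by
    rw [abs_mul, Real.mul_rpow (abs_nonneg _) (abs_nonneg _)]
  simp_rw [this]
  rw [integral_const_mul, Real.mul_rpow (by positivity) (by positivity), ← Real.rpow_mul (abs_nonneg _)]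
  rw [mul_one_div_cancel hq.ne', Real.rpow_one]

lemma LpN_sub {q : ℝ} (hq : 0 < q) {f : ℝ × ℝ → ℝ} (hf : Continuous f)
    {K K' : Set (ℝ × ℝ)} (hK : IsCompact K) (hK' : IsCompact K') (h : K' ⊆ K) : LpN q f K' ≤ LpN q f K := by
  rw [LpN_le_iff hq hf hK' (LpN_nonneg _ _ _), LpN_e hq hf hK]
  exact eLpNorm_mono_measure _ (Measure.restrict_mono h le_rfl)

lemma LpN_exp {q q' : ℝ} (hq : 0 < q) (hqq : q ≤ q') {K : Set (ℝ × ℝ)} (hK : IsCompact K) :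
    ∃ A : ℝ, 0 < A ∧ ∀ f : ℝ × ℝ → ℝ, Continuous f → LpN q f K ≤ A * LpN q' f K := by
  set e : ℝ := 1 / (ENNReal.ofReal q).toReal - 1 / (ENNReal.ofReal q').toReal
  have he : 0 ≤ e := by
    simp only [e, ENNReal.toReal_ofReal hq.le, ENNReal.toReal_ofReal (hq.le.trans hqq)]
    have := one_div_le_one_div_of_le hq hqq
    linarith
  have hfin : (volume.restrict K Set.univ) ^ e ≠ ⊤ := by
    apply ENNReal.rpow_ne_top_of_nonneg he
    simpa using hK.measure_lt_top.ne
  refine ⟨((volume.restrict K Set.univ) ^ e).toReal + 1, by positivity, fun f hf => ?_⟩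
  rw [LpN_le_iff hq hf hK (mul_nonneg (by positivity) (LpN_nonneg _ _ _)),
    ENNReal.ofReal_mul (by positivity), LpN_e (hq.trans_le hqq) hf hK, mul_comm]
  refine (eLpNorm_le_eLpNorm_mul_rpow_measure_univ (ENNReal.ofReal_le_ofReal hqq) hf.aestronglyMeasurable).trans ?_
  gcongr
  rw [ENNReal.le_ofReal_iff_toReal_le hfin (by positivity)]
  linarith

lemma sob2 {K K' : Set (ℝ × ℝ)} (hK : IsCompact K) (hK' : IsCompact K') (hsub : K' ⊆ interior K) {q : ℝ}
    (hq : 2 ≤ q) : ∃ A : ℝ, 0 < A ∧ ∀ f : ℝ × ℝ → ℝ, ContDiff ℝ 1 f →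
      LpN q f K' ≤ A * (LpN 2 f K + LpN 2 (fun y => ‖fderiv ℝ f y‖) K) := by
  obtain ⟨φ, hφ, hr, h0, h1⟩ := exists_contMDiff_zero_iff_one_iff_of_isClosed (n := 1) (modelWithCornersSelf ℝ (ℝ × ℝ))
    (isOpen_interior (s := K)).isClosed_compl hK'.isClosed
    (Set.disjoint_left.2 fun x hx hx' => hx (hsub hx'))
  have hφ' : ContDiff ℝ 1 φ := hφ.contDiff
  have hφb : ∀ x, |φ x| ≤ 1 := fun x => by
    have := hr (Set.mem_range_self x)
    rw [abs_of_nonneg this.1]; exact this.2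
  have hφd : Continuous (fderiv ℝ φ) := hφ'.continuous_fderiv (by norm_num)
  obtain ⟨D, hD⟩ := hK.exists_bound_of_continuousOn hφd.continuousOn
  set D' := max D 1
  obtain ⟨c, hc⟩ : ∃ c : NNReal, ∀ g : ℝ × ℝ → ℝ, ContDiff ℝ 1 g → g.support ⊆ K →
      eLpNorm g (ENNReal.ofReal q) volume ≤ c * eLpNorm (fderiv ℝ g) (ENNReal.ofReal (2 * q / (q + 2))) volume := by
    refine ⟨eLpNormLESNormFDerivOfLeConst ℝ (volume : Measure (ℝ × ℝ)) K (2 * q / (q + 2)).toNNReal q.toNNReal, fun g hg hgs => ?_⟩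
    have := eLpNorm_le_eLpNorm_fderiv_of_le (volume : Measure (ℝ × ℝ)) hg hgs
      (p := (2 * q / (q + 2)).toNNReal) (q := q.toNNReal) ?_ ?_ ?_ hK.isBounded
    · exact this
    · rw [Real.one_le_toNNReal, le_div_iff₀ (by linarith)]; linarith
    · have : (Module.finrank ℝ (ℝ × ℝ)) = 2 := by simp
      rw [this]
      rw [Real.toNNReal_lt_iff_lt_coe (by positivity)]
      rw [div_lt_iff₀ (by linarith)]; push_cast; linarith
    · have : (Module.finrank ℝ (ℝ × ℝ)) = 2 := by simp
      rw [this, NNReal.coe_inv, Real.coe_toNNReal _ (by positivity), Real.coe_toNNReal _ (by positivity)]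
      push_cast
      apply le_of_eq
      field_simp
      ring
  obtain ⟨A, hA, hA'⟩ := LpN_exp (q := 2 * q / (q + 2)) (q' := 2) (by positivity)
    (by rw [div_le_iff₀ (by linarith)]; linarith) hK
  refine ⟨(c + 1) * (A * D'), by positivity, fun f hf => ?_⟩
  have hfd : Continuous (fderiv ℝ f) := hf.continuous_fderiv (by norm_num)
  have hg : ContDiff ℝ 1 (fun y => φ y * f y) := hφ'.mul hf
  have hgs : Function.support (fun y => φ y * f y) ⊆ interior K := by
    intro x hx
    by_contra hxx
    exact hx (by simp [(h0 x).1 hxx])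
  have hgt : tsupport (fun y => φ y * f y) ⊆ K :=
    closure_minimal (hgs.trans interior_subset) hK.isClosed
  have hgd : Continuous (fderiv ℝ (fun y => φ y * f y)) := hg.continuous_fderiv (by norm_num)
  have e0 := hc _ hg (hgs.trans interior_subset)
  have e1 : eLpNorm (fderiv ℝ (fun y => φ y * f y)) (ENNReal.ofReal (2 * q / (q + 2))) volume
      = ENNReal.ofReal (LpN (2 * q / (q + 2)) (fun y => ‖fderiv ℝ (fun y => φ y * f y) y‖) K) := by
    rw [LpN_e (by positivity) hgd.norm hK, eLpNorm_norm]
    rw [eLpNorm_restrict_eq_of_support_subset]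
    exact (support_fderiv_subset ℝ).trans hgt
  have e2 : LpN 2 (fun y => ‖fderiv ℝ (fun y => φ y * f y) y‖) K
      ≤ D' * (LpN 2 f K + LpN 2 (fun y => ‖fderiv ℝ f y‖) K) := by
    have c1 : Continuous (fun y => |f y|) := hf.continuous.abs
    calc _ ≤ LpN 2 (fun y => D' * (|f y| + ‖fderiv ℝ f y‖)) K := by
          apply LpN_mono (by norm_num) hgd.norm (by fun_prop) hK
          intro y hy
          rw [abs_of_nonneg (norm_nonneg _), abs_of_nonneg (by positivity)]
          rw [fderiv_fun_mul (hφ'.differentiable (by norm_num) y) (hf.differentiable (by norm_num) y)]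
          refine (norm_add_le _ _).trans ?_
          rw [norm_smul, norm_smul, Real.norm_eq_abs, Real.norm_eq_abs]
          have a1 : |φ y| ≤ D' := (hφb y).trans (le_max_right _ _)
          have a2 : ‖fderiv ℝ φ y‖ ≤ D' := (hD y hy).trans (le_max_left _ _)
          have := mul_le_mul_of_nonneg_right a1 (norm_nonneg (fderiv ℝ f y))
          have := mul_le_mul_of_nonneg_left a2 (abs_nonneg (f y))
          linarith
      _ = |D'| * LpN 2 (fun y => |f y| + ‖fderiv ℝ f y‖) K := LpN_cmul (by norm_num) (by fun_prop) _ hK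
      _ ≤ D' * (LpN 2 (fun y => |f y|) K + LpN 2 (fun y => ‖fderiv ℝ f y‖) K) := by
          rw [abs_of_nonneg (by positivity)]
          gcongr
          exact LpN_add (by norm_num) c1 hfd.norm hK
      _ = _ := by simp [LpN]
  have hn : 0 ≤ LpN 2 f K + LpN 2 (fun y => ‖fderiv ℝ f y‖) K := add_nonneg (LpN_nonneg _ _ _) (LpN_nonneg _ _ _)
  have e3 : eLpNorm f (ENNReal.ofReal q) (volume.restrict K') ≤
      eLpNorm (fun y => φ y * f y) (ENNReal.ofReal q) volume := by
    calc _ = eLpNorm (fun y => φ y * f y) (ENNReal.ofReal q) (volume.restrict K') := by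
          apply eLpNorm_congr_ae
          filter_upwards [ae_restrict_mem hK'.measurableSet] with y hy
          rw [(h1 y).1 hy, one_mul]
      _ ≤ _ := eLpNorm_mono_measure _ Measure.restrict_le_self
  rw [LpN_le_iff (by linarith) hf.continuous hK' (by positivity)]
  refine e3.trans (e0.trans ?_)
  rw [e1]
  have : (c : ENNReal) = ENNReal.ofReal (c : ℝ) := by simp
  rw [this, ← ENNReal.ofReal_mul (by positivity)]
  apply ENNReal.ofReal_le_ofReal
  calc (c : ℝ) * _ ≤ c * (A * (D' * (LpN 2 f K + LpN 2 (fun y => ‖fderiv ℝ f y‖) K))) := by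
        gcongr
        exact (hA' _ hgd.norm).trans (by gcongr)
    _ ≤ (c + 1) * (A * (D' * (LpN 2 f K + LpN 2 (fun y => ‖fderiv ℝ f y‖) K))) := by
        gcongr; linarith
    _ = _ := by ring

lemma sob {K K' : Set (ℝ × ℝ)} (hK : IsCompact K) (hK' : IsCompact K') (hsub : K' ⊆ interior K) {q : ℝ}
    (hq : 1 ≤ q) : ∃ A : ℝ, 0 < A ∧ ∀ f : ℝ × ℝ → ℝ, ContDiff ℝ 1 f →
      LpN q f K' ≤ A * (LpN 2 f K + LpN 2 (fun y => ‖fderiv ℝ f y‖) K) := by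
  obtain ⟨A, hA, h⟩ := sob2 hK hK' hsub (le_max_right q 2)
  obtain ⟨A2, hA2, h2⟩ := LpN_exp (q := q) (q' := max q 2) (by linarith) (le_max_left _ _) hK'
  refine ⟨A2 * A, by positivity, fun f hf => (h2 f hf.continuous).trans ?_⟩
  rw [mul_assoc]
  gcongr
  exact h f hf

lemma arithR {L P R v y b1 b2 : ℝ} (hb1 : |b1| ≤ L) (hb2 : |b2| ≤ L) (hc : P - R = b1 * v + b2 * y) :
    |R| ≤ |P| + L * (|v| + |y|) ∧ |P| ≤ |R| + L * (|v| + |y|) := by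
  have h1 : |b1 * v + b2 * y| ≤ L * (|v| + |y|) := by
    calc _ ≤ |b1 * v| + |b2 * y| := abs_add_le _ _
      _ = |b1| * |v| + |b2| * |y| := by rw [abs_mul, abs_mul]
      _ ≤ L * |v| + L * |y| := by gcongr
      _ = _ := by ring
  rw [← hc] at h1
  have h2 := abs_sub_abs_le_abs_sub P R
  have h3 := abs_sub_abs_le_abs_sub R P
  rw [abs_sub_comm] at h3
  constructor <;> linarith

lemma arithD {L ε D P Q R a11 a12 a22 G : ℝ} (hL : 1 ≤ L) (hε : 0 < ε) (ha : 1 ≤ L * a11) (h12 : |a12| ≤ L) (h22 : |a22| ≤ L)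
    (he : a11 * D + a12 * (ε * P) + a12 * (ε * R) + a22 * (ε * Q) = 0) (hP : |P| ≤ G) (hR : |R| ≤ G) (hQ : |Q| ≤ G) :
    |D| + |ε * P| + |ε * R| + |ε * Q| ≤ 6 * L ^ 2 * (ε * G) := by
  have hG : 0 ≤ G := (abs_nonneg _).trans hP
  have e : ∀ {x : ℝ}, |x| ≤ G → |ε * x| ≤ ε * G := fun {x} hx => by
    rw [abs_mul, abs_of_pos hε]; gcongr
  have p := e hP
  have q := e hQ
  have r := e hR
  have h1 : |a11 * D| ≤ 3 * (L * (ε * G)) := by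
    have : a11 * D = -(a12 * (ε * P) + a12 * (ε * R) + a22 * (ε * Q)) := by linarith
    rw [this, abs_neg]
    have k1 : |a12 * (ε * P)| ≤ L * (ε * G) := by rw [abs_mul]; gcongr
    have k2 : |a12 * (ε * R)| ≤ L * (ε * G) := by rw [abs_mul]; gcongr
    have k3 : |a22 * (ε * Q)| ≤ L * (ε * G) := by rw [abs_mul]; gcongr
    have := abs_add_three (a12 * (ε * P)) (a12 * (ε * R)) (a22 * (ε * Q))
    linarith
  have h2 : |D| ≤ 3 * L ^ 2 * (ε * G) := by
    have k : |D| ≤ L * |a11 * D| := by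
      rw [abs_mul]
      have : 1 * |D| ≤ (L * |a11|) * |D| := by
        gcongr
        exact ha.trans (by gcongr; exact le_abs_self _)
      linarith
    calc |D| ≤ L * |a11 * D| := k
      _ ≤ L * (3 * (L * (ε * G))) := by gcongr
      _ = _ := by ring
  have h3 : ε * G ≤ L ^ 2 * (ε * G) := le_mul_of_one_le_left (by positivity) (one_le_pow₀ hL)
  linarith

/-- uniform pointwise bounds -/
lemma opn {l : ℝ × ℝ →L[ℝ] ℝ} {S T : ℝ × ℝ} {L : ℝ} (hS : ‖S‖ ≤ L) (hT : ‖T‖ ≤ L)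
    (hd : 1 ≤ L * |S.1 * T.2 - S.2 * T.1|) : ‖l‖ ≤ 2 * L ^ 2 * (|l S| + |l T|) := by
  apply l.opNorm_le_bound (by positivity)
  intro w
  have := dirB l S T w hS hT hd
  rw [Real.norm_eq_abs]
  linarith

lemma X1_cmul {s11 s12 : ℝ × ℝ × ℝ → ℝ} {u f : ℝ × ℝ → ℝ} (hf : ContDiff ℝ 1 f) (ε : ℝ) (y : ℝ × ℝ) :
    X1 s11 s12 u (fun p => ε * f p) y = ε * X1 s11 s12 u f y := by
  rw [X1_eq, X1_eq, fderiv_const_mul (hf.differentiable (by simp) y)]; simp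

lemma Yf_cmul {s11 s12 : ℝ × ℝ × ℝ → ℝ} {u f : ℝ × ℝ → ℝ} (hf : ContDiff ℝ 1 f) (ε : ℝ) (y : ℝ × ℝ) :
    Yf s11 s12 u (fun p => ε * f p) y = ε * Yf s11 s12 u f y := by
  rw [Yf_eq, Yf_eq, fderiv_const_mul (hf.differentiable (by simp) y)]; simp

lemma ptw {s11 s12 : ℝ × ℝ × ℝ → ℝ} (h1 : ContDiff ℝ (⊤ : ℕ∞) s11) (h2 : ContDiff ℝ (⊤ : ℕ∞) s12)
    (hr : RankCond s11 s12) {M α C ε L : ℝ} {K : Set (ℝ × ℝ)} {u z : ℝ × ℝ → ℝ} (H : Hyp s11 s12 M α C ε K u z) (hL : 1 ≤ L)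
    {y : ℝ × ℝ} (hy : y ∈ K)
    (hb : ‖SS s11 s12 u y‖ ≤ L ∧ ‖SS (pd3 s11) (pd3 s12) u y‖ ≤ L ∧
        1 ≤ L * |(SS s11 s12 u y).1 * (SS (pd3 s11) (pd3 s12) u y).2 - (SS s11 s12 u y).2 * (SS (pd3 s11) (pd3 s12) u y).1| ∧
        |be1 s11 s12 (Phi s11 s12 u y)| ≤ L ∧ |be2 s11 s12 (Phi s11 s12 u y)| ≤ L ∧
        1 ≤ L * a11f (nu s11 s12 ε u y) ∧ |a12f (nu s11 s12 ε u y)| ≤ L ∧ |a22f (nu s11 s12 ε u y)| ≤ L) :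
    ‖fderiv ℝ z y‖ ≤ 2 * L ^ 2 * (|X1 s11 s12 u z y| + |Yf s11 s12 u z y|) ∧
    ‖fderiv ℝ (X1 s11 s12 u z) y‖ ≤ 2 * L ^ 2 * (|X1 s11 s12 u (X1 s11 s12 u z) y| +
      (|X1 s11 s12 u (Yf s11 s12 u z) y| + L * (|X1 s11 s12 u z y| + |Yf s11 s12 u z y|))) ∧
    ‖fderiv ℝ (X2 s11 s12 ε u z) y‖ ≤ 2 * L ^ 2 * (|X1 s11 s12 u (Yf s11 s12 u z) y| +
      |X2 s11 s12 ε u (Yf s11 s12 u z) y|) ∧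
    Dd (SS s11 s12 u) (SS (pd3 s11) (pd3 s12) u) ε (X1 s11 s12 u z) (X2 s11 s12 ε u z) y ≤
      6 * L ^ 3 * (ε * |(|X1 s11 s12 u (Yf s11 s12 u z) y| + |X2 s11 s12 ε u (Yf s11 s12 u z) y| : ℝ)|
        + (ε * |X1 s11 s12 u z y| + |X2 s11 s12 ε u z y|)) ∧
    Dd (SS s11 s12 u) (SS (pd3 s11) (pd3 s12) u) ε (X1 s11 s12 u z) (X2 s11 s12 ε u z) y ≤
      6 * L ^ 3 * (ε * |(|Yf s11 s12 u (X1 s11 s12 u z) y| + |Yf s11 s12 u (X2 s11 s12 ε u z) y| : ℝ)|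
        + (ε * |X1 s11 s12 u z y| + |X2 s11 s12 ε u z y|)) := by
  obtain ⟨b1, b2, b3, b4, b5, b6, b7, b8⟩ := hb
  have g1 := c1 (pd3_contDiff h1)
  have g2 := c1 (pd3_contDiff h2)
  have hε := H.hε
  have hvY : ContDiff ℝ 1 (Yf s11 s12 u z) := VF_contDiff g1 g2 H.hu H.hz
  have e2 : X2 s11 s12 ε u z = fun p => ε * Yf s11 s12 u z p := rfl
  have i1 : X1 s11 s12 u (X2 s11 s12 ε u z) y = ε * X1 s11 s12 u (Yf s11 s12 u z) y := by rw [e2, X1_cmul hvY]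
  have i2 : Yf s11 s12 u (X2 s11 s12 ε u z) y = X2 s11 s12 ε u (Yf s11 s12 u z) y := by rw [e2, Yf_cmul hvY]; rfl
  have i3 : X2 s11 s12 ε u (X1 s11 s12 u z) y = ε * Yf s11 s12 u (X1 s11 s12 u z) y := rfl
  have i4 : X2 s11 s12 ε u (X2 s11 s12 ε u z) y = ε * X2 s11 s12 ε u (Yf s11 s12 u z) y := by rw [← i2]; rfl
  have i5 : |X2 s11 s12 ε u z y| = ε * |Yf s11 s12 u z y| := by rw [e2]; simp [abs_mul, abs_of_pos hε]
  have hc := commXY h1 h2 hr H.hu H.hz y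
  have he := H.eqn y hy
  rw [eqn_expand, i1, i3, i4] at he
  obtain ⟨r1, r2⟩ := arithR b4 b5 hc
  have hD : Dd (SS s11 s12 u) (SS (pd3 s11) (pd3 s12) u) ε (X1 s11 s12 u z) (X2 s11 s12 ε u z) y =
      |X1 s11 s12 u (X1 s11 s12 u z) y| + |ε * X1 s11 s12 u (Yf s11 s12 u z) y| + |ε * Yf s11 s12 u (X1 s11 s12 u z) y|
       + |ε * X2 s11 s12 ε u (Yf s11 s12 u z) y| := by
    unfold Dd
    rw [← X1_eq, ← X1_eq, ← Yf_eq, ← Yf_eq, i1, i2]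
  have o1 := opn (l := fderiv ℝ z y) b1 b2 b3
  have o2 := opn (l := fderiv ℝ (X1 s11 s12 u z) y) b1 b2 b3
  have o3 := opn (l := fderiv ℝ (X2 s11 s12 ε u z) y) b1 b2 b3
  rw [← X1_eq, ← Yf_eq] at o1 o2 o3
  rw [i1, i2] at o3
  have kk : ∀ a b : ℝ, |(|a| + |b| : ℝ)| = |a| + |b| := fun a b => abs_of_nonneg (by positivity)
  rw [hD, i5, i2]
  refine ⟨o1, o2.trans (by gcongr), o3.trans ?_, ?_, ?_⟩
  · refine mul_le_mul_of_nonneg_left (add_le_add_left ?_ _) (by positivity)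
    rw [abs_mul, abs_of_pos hε]
    exact mul_le_of_le_one_left (abs_nonneg _) H.hε1
  all_goals
    rw [kk]
  · set G := L * ((|X1 s11 s12 u (Yf s11 s12 u z) y| + |X2 s11 s12 ε u (Yf s11 s12 u z) y|) + (|X1 s11 s12 u z y| + |Yf s11 s12 u z y|)) with hG
    have m1 : |X1 s11 s12 u (Yf s11 s12 u z) y| ≤ L * |X1 s11 s12 u (Yf s11 s12 u z) y| := le_mul_of_one_le_left (abs_nonneg _) hL
    have m2 : |X2 s11 s12 ε u (Yf s11 s12 u z) y| ≤ L * |X2 s11 s12 ε u (Yf s11 s12 u z) y| := le_mul_of_one_le_left (abs_nonneg _) hL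
    have n1 : 0 ≤ L * (|X1 s11 s12 u z y| + |Yf s11 s12 u z y|) := by positivity
    have n2 := abs_nonneg (X1 s11 s12 u (Yf s11 s12 u z) y)
    have n3 := abs_nonneg (X2 s11 s12 ε u (Yf s11 s12 u z) y)
    refine (arithD (G := G) hL hε b6 b7 b8 he ?_ ?_ ?_).trans (le_of_eq ?_)
    · linarith
    · linarith
    · linarith
    · rw [hG]; ring
  · set G := L * ((|Yf s11 s12 u (X1 s11 s12 u z) y| + |X2 s11 s12 ε u (Yf s11 s12 u z) y|) + (|X1 s11 s12 u z y| + |Yf s11 s12 u z y|)) with hG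
    have m1 : |Yf s11 s12 u (X1 s11 s12 u z) y| ≤ L * |Yf s11 s12 u (X1 s11 s12 u z) y| := le_mul_of_one_le_left (abs_nonneg _) hL
    have m2 : |X2 s11 s12 ε u (Yf s11 s12 u z) y| ≤ L * |X2 s11 s12 ε u (Yf s11 s12 u z) y| := le_mul_of_one_le_left (abs_nonneg _) hL
    have n1 : 0 ≤ L * (|X1 s11 s12 u z y| + |Yf s11 s12 u z y|) := by positivity
    have n2 := abs_nonneg (Yf s11 s12 u (X1 s11 s12 u z) y)
    have n3 := abs_nonneg (X2 s11 s12 ε u (Yf s11 s12 u z) y)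
    refine (arithD (G := G) hL hε b6 b7 b8 he ?_ ?_ ?_).trans (le_of_eq ?_)
    · linarith
    · linarith
    · linarith
    · rw [hG]; ring

lemma it_le (s11 s12 : ℝ × ℝ × ℝ → ℝ) (ε : ℝ) (u : ℝ × ℝ → ℝ) (k : ℕ) (z : ℝ × ℝ → ℝ) (y : ℝ × ℝ) (I : Fin k → Fin 2) :
    |iterX s11 s12 ε u k I z y| ≤ gradkN s11 s12 ε u k z y := by
  apply Real.abs_le_sqrt
  exact Finset.single_le_sum (f := fun I => (iterX s11 s12 ε u k I z y) ^ 2) (fun i _ => sq_nonneg _) (Finset.mem_univ I)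

lemma gk_nn (s11 s12 : ℝ × ℝ × ℝ → ℝ) (ε : ℝ) (u : ℝ × ℝ → ℝ) (k : ℕ) (z : ℝ × ℝ → ℝ) (y : ℝ × ℝ) :
    0 ≤ gradkN s11 s12 ε u k z y := Real.sqrt_nonneg _

lemma le_it {s11 s12 : ℝ × ℝ × ℝ → ℝ} {ε : ℝ} {u : ℝ × ℝ → ℝ} {k : ℕ} {z : ℝ × ℝ → ℝ} {y : ℝ × ℝ} {G : ℝ}
    (h : ∀ I, |iterX s11 s12 ε u k I z y| ≤ G) : gradkN s11 s12 ε u k z y ≤ 2 ^ k * G := by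
  have hG : 0 ≤ G := (abs_nonneg _).trans (h fun _ => 0)
  unfold gradkN
  rw [Real.sqrt_le_left (by positivity)]
  calc _ ≤ ∑ _I : Fin k → Fin 2, G ^ 2 := by
        apply Finset.sum_le_sum
        intro I _
        rw [← sq_abs]; exact pow_le_pow_left₀ (abs_nonneg _) (h I) 2
    _ = 2 ^ k * G ^ 2 := by simp
    _ ≤ (2 ^ k) ^ 2 * G ^ 2 := by
        gcongr
        have : (1 : ℝ) ≤ 2 ^ k := one_le_pow₀ (by norm_num)
        nlinarith
    _ = _ := by ring

lemma grad_cont {s11 s12 : ℝ × ℝ × ℝ → ℝ} {ε : ℝ} {u : ℝ × ℝ → ℝ} {k : ℕ} {z : ℝ × ℝ → ℝ}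
    (h : ∀ I, Continuous (iterX s11 s12 ε u k I z)) : Continuous (gradkN s11 s12 ε u k z) := by
  unfold gradkN
  exact (continuous_finset_sum _ fun I _ => (h I).pow 2).sqrt

section
variable {s11 s12 : ℝ × ℝ × ℝ → ℝ} {u z : ℝ × ℝ → ℝ}

lemma XX_c1 (h1 : ContDiff ℝ (⊤ : ℕ∞) s11) (h2 : ContDiff ℝ (⊤ : ℕ∞) s12)
    (hu : ContDiff ℝ 1 u) (hz : ContDiff ℝ 2 z) (ε : ℝ) (i : Fin 2) : ContDiff ℝ 1 (XX s11 s12 ε u i z) := by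
  have a1 : ContDiff ℝ 1 (X1 s11 s12 u z) := VF_contDiff (c1 h1) (c1 h2) hu hz
  have a2 : ContDiff ℝ 1 (Yf s11 s12 u z) := VF_contDiff (c1 (pd3_contDiff h1)) (c1 (pd3_contDiff h2)) hu hz
  have a3 : ContDiff ℝ 1 (X2 s11 s12 ε u z) := contDiff_const.mul a2
  fin_cases i
  · exact a1
  · exact a3

lemma XX_c0 (h1 : ContDiff ℝ (⊤ : ℕ∞) s11) (h2 : ContDiff ℝ (⊤ : ℕ∞) s12)
    (hu : ContDiff ℝ 1 u) (hz : ContDiff ℝ 1 z) (ε : ℝ) (i : Fin 2) : Continuous (XX s11 s12 ε u i z) := by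
  have a1 : Continuous (X1 s11 s12 u z) := VF_cont (c1 h1) (c1 h2) hu hz
  have a2 : Continuous (Yf s11 s12 u z) := VF_cont (c1 (pd3_contDiff h1)) (c1 (pd3_contDiff h2)) hu hz
  have a3 : Continuous (X2 s11 s12 ε u z) := continuous_const.mul a2
  fin_cases i
  · exact a1
  · exact a3

lemma g0 {ε : ℝ} (hz : Continuous z) : Continuous (gradkN s11 s12 ε u 0 z) := grad_cont fun _ => hz
lemma g1 (h1 : ContDiff ℝ (⊤ : ℕ∞) s11) (h2 : ContDiff ℝ (⊤ : ℕ∞) s12)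
    (hu : ContDiff ℝ 1 u) (hz : ContDiff ℝ 1 z) {ε : ℝ} : Continuous (gradkN s11 s12 ε u 1 z) :=
  grad_cont fun I => XX_c0 h1 h2 hu hz ε (I 0)
lemma g2 (h1 : ContDiff ℝ (⊤ : ℕ∞) s11) (h2 : ContDiff ℝ (⊤ : ℕ∞) s12)
    (hu : ContDiff ℝ 1 u) (hz : ContDiff ℝ 2 z) {ε : ℝ} : Continuous (gradkN s11 s12 ε u 2 z) :=
  grad_cont fun I => XX_c0 h1 h2 hu (XX_c1 h1 h2 hu hz ε (I 1)) ε (I 0)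

lemma ex1 (h1 : ContDiff ℝ (⊤ : ℕ∞) s11) (h2 : ContDiff ℝ (⊤ : ℕ∞) s12)
    (hu : ContDiff ℝ 1 u) (hz : ContDiff ℝ 1 z) {ε q C : ℝ} (hq : 0 < q) {K : Set (ℝ × ℝ)} (hK : IsCompact K)
    (h : WN s11 s12 ε u 1 q z K ≤ C) :
    LpN q z K ≤ C ∧ LpN q (X1 s11 s12 u z) K ≤ C ∧ LpN q (X2 s11 s12 ε u z) K ≤ C := by
  unfold WN at h
  rw [Finset.sum_range_succ, Finset.sum_range_one] at h
  have n0 := LpN_nonneg q (gradkN s11 s12 ε u 0 z) K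
  have n1 := LpN_nonneg q (gradkN s11 s12 ε u 1 z) K
  have k1 := g1 h1 h2 hu hz (ε := ε)
  refine ⟨(LpN_mono hq hz.continuous (g0 hz.continuous) hK fun y _ => ?_).trans (by linarith : LpN q (gradkN s11 s12 ε u 0 z) K ≤ C),
    (LpN_mono hq (XX_c0 h1 h2 hu hz ε 0) k1 hK fun y _ => ?_).trans (by linarith : LpN q (gradkN s11 s12 ε u 1 z) K ≤ C),
    (LpN_mono hq (XX_c0 h1 h2 hu hz ε 1) k1 hK fun y _ => ?_).trans (by linarith : LpN q (gradkN s11 s12 ε u 1 z) K ≤ C)⟩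
  · exact (it_le s11 s12 ε u 0 z y (fun _ => 0)).trans (le_abs_self _)
  · exact (it_le s11 s12 ε u 1 z y (fun _ => 0)).trans (le_abs_self _)
  · exact (it_le s11 s12 ε u 1 z y (fun _ => 1)).trans (le_abs_self _)

lemma ex2 (h1 : ContDiff ℝ (⊤ : ℕ∞) s11) (h2 : ContDiff ℝ (⊤ : ℕ∞) s12)
    (hu : ContDiff ℝ 1 u) (hz : ContDiff ℝ 2 z) {ε q C : ℝ} (hq : 0 < q) {K : Set (ℝ × ℝ)} (hK : IsCompact K)
    (h : WN s11 s12 ε u 2 q z K ≤ C) :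
    LpN q z K ≤ C ∧ LpN q (X1 s11 s12 u z) K ≤ C ∧ LpN q (X2 s11 s12 ε u z) K ≤ C ∧
      LpN q (X1 s11 s12 u (X1 s11 s12 u z)) K ≤ C := by
  have hz1 : ContDiff ℝ 1 z := hz.of_le (by norm_num)
  have h' : WN s11 s12 ε u 1 q z K + LpN q (gradkN s11 s12 ε u 2 z) K ≤ C := by
    unfold WN at h ⊢
    rwa [Finset.sum_range_succ] at h
  have n0 : 0 ≤ WN s11 s12 ε u 1 q z K := Finset.sum_nonneg fun _ _ => LpN_nonneg _ _ _
  have n2 := LpN_nonneg q (gradkN s11 s12 ε u 2 z) K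
  obtain ⟨a, b, c⟩ := ex1 h1 h2 hu hz1 hq hK (by linarith : WN s11 s12 ε u 1 q z K ≤ C)
  refine ⟨a, b, c, (LpN_mono hq (XX_c0 h1 h2 hu (XX_c1 h1 h2 hu hz ε 0) ε 0) (g2 h1 h2 hu hz (ε := ε)) hK fun y _ => ?_).trans
    (by linarith : LpN q (gradkN s11 s12 ε u 2 z) K ≤ C)⟩
  exact (it_le s11 s12 ε u 2 z y (fun _ => 0)).trans (le_abs_self _)

end

lemma LpN_abs {q : ℝ} {f : ℝ × ℝ → ℝ} {K : Set (ℝ × ℝ)} : LpN q (fun y => |f y|) K = LpN q f K := by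
  simp [LpN]

/-- assembly of the conclusion -/
lemma concl {s11 s12 : ℝ × ℝ × ℝ → ℝ} (h1 : ContDiff ℝ (⊤ : ℕ∞) s11) (h2 : ContDiff ℝ (⊤ : ℕ∞) s12)
    {u z : ℝ × ℝ → ℝ} (hu : ContDiff ℝ 1 u) (hz : ContDiff ℝ 2 z) {ε q A B : ℝ} (hq : 1 ≤ q) {K : Set (ℝ × ℝ)} (hK : IsCompact K)
    (a0 : LpN q z K ≤ A) (a1 : LpN q (X1 s11 s12 u z) K ≤ A) (a2 : LpN q (X2 s11 s12 ε u z) K ≤ A)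
    (a3 : LpN q (Dd (SS s11 s12 u) (SS (pd3 s11) (pd3 s12) u) ε (X1 s11 s12 u z) (X2 s11 s12 ε u z)) K ≤ B) :
    WN s11 s12 ε u 2 q z K ≤ 5 * A + 4 * B := by
  have hq0 : 0 < q := by linarith
  have hz1 : ContDiff ℝ 1 z := hz.of_le (by norm_num)
  have c1' := (XX_c1 h1 h2 hu hz ε 0)
  have c2' := (XX_c1 h1 h2 hu hz ε 1)
  change ContDiff ℝ 1 (X1 s11 s12 u z) at c1'
  change ContDiff ℝ 1 (X2 s11 s12 ε u z) at c2'
  unfold WN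
  rw [Finset.sum_range_succ, Finset.sum_range_succ, Finset.sum_range_one]
  have e0 : LpN q (gradkN s11 s12 ε u 0 z) K ≤ A := by
    refine (LpN_mono hq0 (g0 hz.continuous) hz.continuous hK fun y _ => ?_).trans a0
    rw [abs_of_nonneg (gk_nn _ _ _ _ _ _ _)]
    refine (le_it (G := |z y|) fun I => le_rfl).trans (by simp)
  have e1 : LpN q (gradkN s11 s12 ε u 1 z) K ≤ 4 * A := by
    have cc1 : Continuous (fun y => |X1 s11 s12 u z y|) := c1'.continuous.abs
    have cc2 : Continuous (fun y => |X2 s11 s12 ε u z y|) := c2'.continuous.abs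
    calc _ ≤ LpN q (fun y => 2 * (|X1 s11 s12 u z y| + |X2 s11 s12 ε u z y|)) K := by
          apply LpN_mono hq0 (g1 h1 h2 hu hz1) (by fun_prop) hK
          intro y _
          rw [abs_of_nonneg (gk_nn _ _ _ _ _ _ _)]
          refine le_trans (le_it (G := |X1 s11 s12 u z y| + |X2 s11 s12 ε u z y|) fun I => ?_) ?_
          · have : ∀ i : Fin 2, |XX s11 s12 ε u i z y| ≤ |X1 s11 s12 u z y| + |X2 s11 s12 ε u z y| := by
              intro i
              fin_cases i
              · exact le_add_of_nonneg_right (abs_nonneg _)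
              · exact le_add_of_nonneg_left (abs_nonneg _)
            exact this (I 0)
          · rw [pow_one]; exact le_abs_self _
      _ = |2| * LpN q (fun y => (|X1 s11 s12 u z y| + |X2 s11 s12 ε u z y|)) K := LpN_cmul hq0 (by fun_prop) _ hK
      _ ≤ 2 * (A + A) := by
          rw [abs_two]
          gcongr
          refine (LpN_add hq cc1 cc2 hK).trans ?_
          rw [LpN_abs, LpN_abs]; linarith
      _ = _ := by ring
  have cS : Continuous (SS s11 s12 u) := (SS_contDiff (c1 h1) (c1 h2) hu).continuous
  have cT : Continuous (SS (pd3 s11) (pd3 s12) u) := (SS_contDiff (c1 (pd3_contDiff h1)) (c1 (pd3_contDiff h2)) hu).continuous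
  have cD := Dd_cont ε cS cT c1' c2'
  have e2 : LpN q (gradkN s11 s12 ε u 2 z) K ≤ 4 * B := by
    calc _ ≤ LpN q (fun y => 4 * Dd (SS s11 s12 u) (SS (pd3 s11) (pd3 s12) u) ε (X1 s11 s12 u z) (X2 s11 s12 ε u z) y) K := by
          apply LpN_mono hq0 (g2 h1 h2 hu hz) (by fun_prop) hK
          intro y _
          rw [abs_of_nonneg (gk_nn _ _ _ _ _ _ _)]
          refine le_trans (le_it (G := Dd (SS s11 s12 u) (SS (pd3 s11) (pd3 s12) u) ε (X1 s11 s12 u z) (X2 s11 s12 ε u z) y) fun I => ?_) ?_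
          · have : ∀ i j : Fin 2, |XX s11 s12 ε u i (XX s11 s12 ε u j z) y| ≤ Dd (SS s11 s12 u) (SS (pd3 s11) (pd3 s12) u) ε (X1 s11 s12 u z) (X2 s11 s12 ε u z) y := by
              intro i j
              unfold Dd
              rw [← X1_eq, ← X1_eq, ← X2_eq, ← X2_eq]
              have n1 := abs_nonneg (X1 s11 s12 u (X1 s11 s12 u z) y)
              have n2 := abs_nonneg (X1 s11 s12 u (X2 s11 s12 ε u z) y)
              have n3 := abs_nonneg (X2 s11 s12 ε u (X1 s11 s12 u z) y)
              have n4 := abs_nonneg (X2 s11 s12 ε u (X2 s11 s12 ε u z) y)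
              fin_cases i <;> fin_cases j <;> simp only [XX, Fin.zero_eta, Fin.mk_one, Matrix.cons_val_zero, Matrix.cons_val_one] <;> linarith
            exact this (I 0) (I 1)
          · refine le_trans (le_of_eq ?_) (le_abs_self _); norm_num
      _ = |4| * LpN q (Dd (SS s11 s12 u) (SS (pd3 s11) (pd3 s12) u) ε (X1 s11 s12 u z) (X2 s11 s12 ε u z)) K := LpN_cmul hq0 cD _ hK
      _ ≤ 4 * B := by
          rw [abs_of_pos (by norm_num : (0:ℝ) < 4)]; gcongr
  linarith

lemma interp103 {K : Set (ℝ × ℝ)} (hK : IsCompact K) {f : ℝ × ℝ → ℝ} (hf : Continuous f) {A B ε : ℝ} (hε : 0 < ε) (hε1 : ε ≤ 1)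
    (hA : 0 < A) (hB : 0 < B) (h0 : ∀ y ∈ K, 0 ≤ f y) (h : ∀ y ∈ K, f y ≤ A * ε ^ (-(1 / 2) : ℝ)) (h2 : LpN 2 f K ≤ B * ε) :
    LpN (10 / 3) f K ≤ (A ^ (4 / 3 : ℝ) * B ^ 2) ^ (1 / (10 / 3) : ℝ) := by
  unfold LpN at h2 ⊢
  have i0 : 0 ≤ ∫ p in K, |f p| ^ (2 : ℝ) := by positivity
  have j : ∫ p in K, |f p| ^ (2 : ℝ) ≤ (B * ε) ^ 2 := by
    have := pow_le_pow_left₀ (by positivity) h2 2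
    rwa [← Real.rpow_natCast, ← Real.rpow_mul i0, show (1 / 2 : ℝ) * ((2 : ℕ) : ℝ) = 1 by norm_num, Real.rpow_one] at this
  apply Real.rpow_le_rpow (by positivity) _ (by norm_num)
  calc ∫ p in K, |f p| ^ (10 / 3 : ℝ) ≤ ∫ p in K, (A * ε ^ (-(1 / 2) : ℝ)) ^ (4 / 3 : ℝ) * |f p| ^ (2 : ℝ) := by
        apply setIntegral_mono_on (int_abs_rpow hf (by norm_num) hK) ((int_abs_rpow hf (by norm_num) hK).const_mul _) hK.measurableSet
        intro y hy
        have hy0 := h0 y hy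
        rw [abs_of_nonneg hy0, show (10 / 3 : ℝ) = 4 / 3 + 2 by norm_num, Real.rpow_add_of_nonneg hy0 (by norm_num) (by norm_num)]
        gcongr
        exact h y hy
    _ = (A * ε ^ (-(1 / 2) : ℝ)) ^ (4 / 3 : ℝ) * ∫ p in K, |f p| ^ (2 : ℝ) := integral_const_mul _ _
    _ ≤ (A * ε ^ (-(1 / 2) : ℝ)) ^ (4 / 3 : ℝ) * (B * ε) ^ 2 := by gcongr
    _ = (A ^ (4 / 3 : ℝ) * B ^ 2) * ε ^ (4 / 3 : ℝ) := by
        rw [Real.mul_rpow hA.le (by positivity), ← Real.rpow_mul hε.le, mul_pow, ← Real.rpow_natCast ε 2]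
        have : ε ^ (4 / 3 : ℝ) = ε ^ (-(1 / 2) * (4 / 3) : ℝ) * ε ^ ((2 : ℕ) : ℝ) := by
          rw [← Real.rpow_add hε]; norm_num
        rw [this]; ring
    _ ≤ (A ^ (4 / 3 : ℝ) * B ^ 2) * 1 := by
        gcongr
        exact Real.rpow_le_one hε.le hε1 (by norm_num)
    _ = _ := mul_one _

lemma add_bd {q a b : ℝ} (hq : 1 ≤ q) {f g : ℝ × ℝ → ℝ} (hf : Continuous f) (hg : Continuous g)
    {K : Set (ℝ × ℝ)} (hK : IsCompact K) (h1 : LpN q f K ≤ a) (h2 : LpN q g K ≤ b) :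
    LpN q (fun y => f y + g y) K ≤ a + b := (LpN_add hq hf hg hK).trans (add_le_add h1 h2)

lemma cmul_bd {q a c : ℝ} (hq : 1 ≤ q) (hc : 0 ≤ c) {f : ℝ × ℝ → ℝ} (hf : Continuous f)
    {K : Set (ℝ × ℝ)} (hK : IsCompact K) (h1 : LpN q f K ≤ a) :
    LpN q (fun y => c * f y) K ≤ c * a := by
  rw [LpN_cmul (by linarith) hf c hK, abs_of_nonneg hc]; gcongr

lemma mono_bd {q a : ℝ} (hq : 1 ≤ q) {f g : ℝ × ℝ → ℝ} (hf : Continuous f) (hg : Continuous g)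
    {K : Set (ℝ × ℝ)} (hK : IsCompact K) (h : ∀ y ∈ K, 0 ≤ f y) (h' : ∀ y ∈ K, f y ≤ g y) (h1 : LpN q g K ≤ a) :
    LpN q f K ≤ a := by
  refine (LpN_mono (by linarith) hf hg hK fun y hy => ?_).trans h1
  rw [abs_of_nonneg (h y hy)]; exact (h' y hy).trans (le_abs_self _)

lemma abs_bd {q a : ℝ} {f : ℝ × ℝ → ℝ} {K : Set (ℝ × ℝ)} (h : LpN q f K ≤ a) : LpN q (fun y => |f y|) K ≤ a := by
  rwa [LpN_abs]

lemma main1 {s11 s12 : ℝ × ℝ × ℝ → ℝ} (h1 : ContDiff ℝ (⊤ : ℕ∞) s11) (h2 : ContDiff ℝ (⊤ : ℕ∞) s12)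
    (hr : RankCond s11 s12) (M α C : ℝ) (hα : 0 < α) (hα1 : α < 1) (hC : 0 < C) {K K' : Set (ℝ × ℝ)} (hK : IsCompact K)
    (hK' : IsCompact K') (hs : K' ⊆ interior K) :
    ∃ L : ℝ, 1 ≤ L ∧ (∀ q : ℝ, 1 ≤ q → ∃ A : ℝ, 0 < A ∧ ∀ (ε : ℝ) (u z : ℝ × ℝ → ℝ), Hyp s11 s12 M α C ε K u z →
      WN s11 s12 ε u 1 2 (Yf s11 s12 u z) K ≤ C → WN s11 s12 ε u 2 2 z K ≤ C →
      LpN q z K' ≤ A ∧ LpN q (X1 s11 s12 u z) K' ≤ A ∧ LpN q (X2 s11 s12 ε u z) K' ≤ A) ∧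
     (∀ (ε : ℝ) (u z : ℝ × ℝ → ℝ), Hyp s11 s12 M α C ε K u z →
      WN s11 s12 ε u 1 2 (Yf s11 s12 u z) K ≤ C → WN s11 s12 ε u 2 2 z K ≤ C →
      LpN 2 (Dd (SS s11 s12 u) (SS (pd3 s11) (pd3 s12) u) ε (X1 s11 s12 u z) (X2 s11 s12 ε u z)) K' ≤ L * ε) ∧
     (∀ (s B pp : ℝ), 2 ≤ s → 10 / 3 ≤ pp → ∃ C6 : ℝ, 0 < C6 ∧ ∀ (ε : ℝ) (u z F : ℝ × ℝ → ℝ), Hyp s11 s12 M α C ε K u z →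
      WN s11 s12 ε u 1 2 (Yf s11 s12 u z) K ≤ C → WN s11 s12 ε u 2 2 z K ≤ C → LpN pp (Yf s11 s12 u z) K ≤ C →
      Continuous F → LpN s F K ≤ B →
      ((F = fun y => |X1 s11 s12 u (Yf s11 s12 u z) y| + |X2 s11 s12 ε u (Yf s11 s12 u z) y|) ∨
        (F = fun y => |Yf s11 s12 u (X1 s11 s12 u z) y| + |Yf s11 s12 u (X2 s11 s12 ε u z) y|)) →
      ∀ x ∈ K', omg K' x * Dd (SS s11 s12 u) (SS (pd3 s11) (pd3 s12) u) ε (X1 s11 s12 u z) (X2 s11 s12 ε u z) x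
         ≤ C6 * (ε ^ (1 - 3 / s) + 1)) := by
  obtain ⟨L, hL, huni⟩ := uni h1 h2 hr M α C hα hα1 hC hK
  have hsK : K' ⊆ K := hs.trans interior_subset
  have low : ∀ q : ℝ, 1 ≤ q → ∃ A : ℝ, 0 < A ∧ ∀ (ε : ℝ) (u z : ℝ × ℝ → ℝ), Hyp s11 s12 M α C ε K u z →
      WN s11 s12 ε u 1 2 (Yf s11 s12 u z) K ≤ C → WN s11 s12 ε u 2 2 z K ≤ C →
      LpN q z K' ≤ A ∧ LpN q (X1 s11 s12 u z) K' ≤ A ∧ LpN q (X2 s11 s12 ε u z) K' ≤ A := by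
    intro q hq
    obtain ⟨A, hA, hsob⟩ := sob hK hK' hs hq
    refine ⟨A * (C + 2 * L ^ 2 * (C + (C + L * (C + C)))), by positivity, fun ε u z H hW1 hW2 => ?_⟩
    have hz1 : ContDiff ℝ 1 z := H.hz.of_le (by norm_num)
    have k1 : ContDiff ℝ 1 (X1 s11 s12 u z) := XX_c1 h1 h2 H.hu H.hz ε 0
    have k2 : ContDiff ℝ 1 (X2 s11 s12 ε u z) := XX_c1 h1 h2 H.hu H.hz ε 1
    have kY : ContDiff ℝ 1 (Yf s11 s12 u z) := VF_contDiff (c1 (pd3_contDiff h1)) (c1 (pd3_contDiff h2)) H.hu H.hz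
    have k11 : Continuous (X1 s11 s12 u (X1 s11 s12 u z)) := XX_c0 h1 h2 H.hu k1 ε 0
    have k1Y : Continuous (X1 s11 s12 u (Yf s11 s12 u z)) := XX_c0 h1 h2 H.hu kY ε 0
    have k2Y : Continuous (X2 s11 s12 ε u (Yf s11 s12 u z)) := XX_c0 h1 h2 H.hu kY ε 1
    obtain ⟨w1, w2, w3⟩ := ex1 h1 h2 H.hu kY (by norm_num) hK hW1
    obtain ⟨w4, w5, w6, w7⟩ := ex2 h1 h2 H.hu H.hz (by norm_num) hK hW2
    have a1 := k1.continuous.abs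
    have aY := kY.continuous.abs
    have P := fun y hy => ptw h1 h2 hr H hL hy ((huni ε u z H).1 y hy)
    have d1 : LpN 2 (fun y => ‖fderiv ℝ z y‖) K ≤ 2 * L ^ 2 * (C + C) := by
      refine mono_bd (by norm_num) (hz1.continuous_fderiv (by simp)).norm ?_ hK (fun _ _ => norm_nonneg _) (fun y hy => (P y hy).1) ?_
      · fun_prop
      · exact cmul_bd (by norm_num) (by positivity) (by fun_prop) hK (add_bd (by norm_num) a1 aY hK (abs_bd w5) (abs_bd w1))
    have d2 : LpN 2 (fun y => ‖fderiv ℝ (X1 s11 s12 u z) y‖) K ≤ 2 * L ^ 2 * (C + (C + L * (C + C))) := by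
      refine mono_bd (by norm_num) (k1.continuous_fderiv (by simp)).norm ?_ hK (fun _ _ => norm_nonneg _) (fun y hy => (P y hy).2.1) ?_
      · fun_prop
      · refine cmul_bd (by norm_num) (by positivity) (by fun_prop) hK (add_bd (by norm_num) (by fun_prop) (by fun_prop) hK (abs_bd w7) ?_)
        refine add_bd (by norm_num) (by fun_prop) (by fun_prop) hK (abs_bd w2) ?_
        exact cmul_bd (by norm_num) (by positivity) (by fun_prop) hK (add_bd (by norm_num) a1 aY hK (abs_bd w5) (abs_bd w1))
    have d3 : LpN 2 (fun y => ‖fderiv ℝ (X2 s11 s12 ε u z) y‖) K ≤ 2 * L ^ 2 * (C + C) := by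
      refine mono_bd (by norm_num) (k2.continuous_fderiv (by simp)).norm ?_ hK (fun _ _ => norm_nonneg _) (fun y hy => (P y hy).2.2.1) ?_
      · fun_prop
      · exact cmul_bd (by norm_num) (by positivity) (by fun_prop) hK (add_bd (by norm_num) k1Y.abs k2Y.abs hK (abs_bd w2) (abs_bd w3))
    have e : 2 * L ^ 2 * (C + C) ≤ 2 * L ^ 2 * (C + (C + L * (C + C))) := by
      have : 0 ≤ L * (C + C) := by positivity
      gcongr; linarith
    refine ⟨(hsob z hz1).trans ?_, (hsob _ k1).trans ?_, (hsob _ k2).trans ?_⟩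
    · exact mul_le_mul_of_nonneg_left (add_le_add w4 (d1.trans e)) hA.le
    · exact mul_le_mul_of_nonneg_left (add_le_add w5 d2) hA.le
    · exact mul_le_mul_of_nonneg_left (add_le_add w6 (d3.trans e)) hA.le
  have hL3 : 1 ≤ 6 * L ^ 3 := by
    have : 1 ≤ L ^ 3 := one_le_pow₀ hL
    linarith
  refine ⟨6 * L ^ 3 * ((C + C) + (C + C)) + 1, by
    have : 0 ≤ 6 * L ^ 3 * ((C + C) + (C + C)) := by positivity
    linarith, low, ?_, ?_⟩
  · intro ε u z H hW1 hW2
    have hε := H.hε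
    have k1 : ContDiff ℝ 1 (X1 s11 s12 u z) := XX_c1 h1 h2 H.hu H.hz ε 0
    have k2 : ContDiff ℝ 1 (X2 s11 s12 ε u z) := XX_c1 h1 h2 H.hu H.hz ε 1
    have kY : ContDiff ℝ 1 (Yf s11 s12 u z) := VF_contDiff (c1 (pd3_contDiff h1)) (c1 (pd3_contDiff h2)) H.hu H.hz
    have k1Y : Continuous (X1 s11 s12 u (Yf s11 s12 u z)) := XX_c0 h1 h2 H.hu kY ε 0
    have k2Y : Continuous (X2 s11 s12 ε u (Yf s11 s12 u z)) := XX_c0 h1 h2 H.hu kY ε 1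
    obtain ⟨w1, w2, w3⟩ := ex1 h1 h2 H.hu kY (by norm_num) hK hW1
    obtain ⟨w4, w5, w6, w7⟩ := ex2 h1 h2 H.hu H.hz (by norm_num) hK hW2
    have a1 := k1.continuous.abs
    have aY := kY.continuous.abs
    have cS : Continuous (SS s11 s12 u) := (SS_contDiff (c1 h1) (c1 h2) H.hu).continuous
    have cT : Continuous (SS (pd3 s11) (pd3 s12) u) := (SS_contDiff (c1 (pd3_contDiff h1)) (c1 (pd3_contDiff h2)) H.hu).continuous
    have cD := Dd_cont ε cS cT k1 k2
    refine (LpN_sub (by norm_num) cD hK hK' hsK).trans ?_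
    have : LpN 2 (Dd (SS s11 s12 u) (SS (pd3 s11) (pd3 s12) u) ε (X1 s11 s12 u z) (X2 s11 s12 ε u z)) K
       ≤ (6 * L ^ 3 * ε) * ((C + C) + (C + C)) := by
      refine mono_bd (g := fun y => (6 * L ^ 3 * ε) * ((|X1 s11 s12 u (Yf s11 s12 u z) y| + |X2 s11 s12 ε u (Yf s11 s12 u z) y|)
        + (|X1 s11 s12 u z y| + |Yf s11 s12 u z y|))) (by norm_num) cD ?_ hK (fun y _ => Dd_nonneg _ _ _ _ _ _) (fun y hy => ?_) ?_
      · fun_prop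
      · refine (ptw h1 h2 hr H hL hy ((huni ε u z H).1 y hy)).2.2.2.1.trans (le_of_eq ?_)
        have i5 : |X2 s11 s12 ε u z y| = ε * |Yf s11 s12 u z y| := by unfold X2; rw [abs_mul, abs_of_pos hε]
        have kk : ∀ a b : ℝ, |(|a| + |b| : ℝ)| = |a| + |b| := fun a b => abs_of_nonneg (by positivity)
        rw [i5, kk]; ring
      · exact cmul_bd (by norm_num) (by positivity) (by fun_prop) hK (add_bd (by norm_num) (by fun_prop) (by fun_prop) hK
          (add_bd (by norm_num) k1Y.abs k2Y.abs hK (abs_bd w2) (abs_bd w3)) (add_bd (by norm_num) a1 aY hK (abs_bd w5) (abs_bd w1)))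
    refine this.trans ?_
    have e : (6 * L ^ 3 * ((C + C) + (C + C)) + 1) * ε = (6 * L ^ 3 * ε) * ((C + C) + (C + C)) + ε := by ring
    rw [e]; linarith
  · intro s B pp hs2 hpp
    obtain ⟨A, hA, hlow⟩ := low pp (by linarith)
    set B' := 6 * L ^ 3 + |B| + A + C with hB'
    have hB1 : 1 ≤ B' := by have := abs_nonneg B; linarith
    obtain ⟨C6, hC6, hg⟩ := glob (γ := α / 10) (L := L) (B := B') (s := s) (pp := pp) (by positivity) (by linarith) hL hB1 hs2 hpp
    refine ⟨C6, hC6, fun ε u z F H hW1 hW2 hYp hF hFB hFF => ?_⟩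
    have hε := H.hε
    have k1 : ContDiff ℝ 1 (X1 s11 s12 u z) := XX_c1 h1 h2 H.hu H.hz ε 0
    have k2 : ContDiff ℝ 1 (X2 s11 s12 ε u z) := XX_c1 h1 h2 H.hu H.hz ε 1
    have kY : ContDiff ℝ 1 (Yf s11 s12 u z) := VF_contDiff (c1 (pd3_contDiff h1)) (c1 (pd3_contDiff h2)) H.hu H.hz
    have a1 := k1.continuous.abs
    have aY := kY.continuous.abs
    have cS : Continuous (SS s11 s12 u) := (SS_contDiff (c1 h1) (c1 h2) H.hu).continuous
    have cT : Continuous (SS (pd3 s11) (pd3 s12) u) := (SS_contDiff (c1 (pd3_contDiff h1)) (c1 (pd3_contDiff h2)) H.hu).continuous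
    refine hg ε K' (SS s11 s12 u) (SS (pd3 s11) (pd3 s12) u) (fun y => a11f (nu s11 s12 ε u y))
        (fun y => a12f (nu s11 s12 ε u y)) (fun y => a22f (nu s11 s12 ε u y)) (fun y => be1 s11 s12 (Phi s11 s12 u y))
        (fun y => be2 s11 s12 (Phi s11 s12 u y)) (X1 s11 s12 u z) (X2 s11 s12 ε u z) F hε H.hε1 hK' cS cT k1 k2 hF ?_ ?_ ?_ ?_
    · intro x ω hω hω1 hb hd
      exact (huni ε u z H).2 x ω hω hω1 (hb.trans hsK) hd
    · intro y hy
      have hb6 : 6 * L ^ 3 ≤ B' := by have := abs_nonneg B; linarith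
      have p := ptw h1 h2 hr H hL (hsK hy) ((huni ε u z H).1 y (hsK hy))
      have : Dd (SS s11 s12 u) (SS (pd3 s11) (pd3 s12) u) ε (X1 s11 s12 u z) (X2 s11 s12 ε u z) y ≤
         6 * L ^ 3 * (ε * |F y| + (ε * |X1 s11 s12 u z y| + |X2 s11 s12 ε u z y|)) := by
        rcases hFF with rfl | rfl
        · exact p.2.2.2.1
        · exact p.2.2.2.2
      refine this.trans ?_
      gcongr
    · refine (LpN_sub (by linarith) hF hK hK' hsK).trans (hFB.trans ?_)
      have := le_abs_self B
      have : 0 ≤ 6 * L ^ 3 := by positivity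
      linarith
    · have h3 : (fun y => ε * |X1 s11 s12 u z y| + |X2 s11 s12 ε u z y|) = fun y => ε * (|X1 s11 s12 u z y| + |Yf s11 s12 u z y|) := by
        funext y
        unfold X2; rw [abs_mul, abs_of_pos hε]; ring
      rw [h3]
      have := cmul_bd (q := pp) (c := ε) (by linarith) hε.le (by fun_prop) hK' (add_bd (q := pp) (by linarith) a1 aY hK'
        (abs_bd (hlow ε u z H hW1 hW2).2.1) (abs_bd ((LpN_sub (by linarith) kY.continuous hK hK' hsK).trans hYp)))
      refine this.trans ?_
      rw [mul_comm]
      gcongr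
      have := abs_nonneg B
      have : 0 ≤ 6 * L ^ 3 := by positivity
      linarith

lemma omg_low {K K1 : Set (ℝ × ℝ)} (hK : IsCompact K) (hK1 : IsCompact K1) (h : K1 ⊆ interior K) :
    ∃ c : ℝ, 0 < c ∧ ∀ x ∈ K1, c ≤ omg K x := by
  rcases K1.eq_empty_or_nonempty with rfl | hne
  · exact ⟨1, one_pos, by simp⟩
  obtain ⟨x0, hx0, hm⟩ := hK1.exists_isMinOn hne (omg_cont K).continuousOn
  refine ⟨omg K x0, ?_, fun x hx => hm hx⟩
  refine lt_min one_pos ?_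
  have hne' : (Kᶜ).Nonempty := by
    by_contra hc
    rw [Set.not_nonempty_iff_eq_empty, Set.compl_empty_iff] at hc
    exact noncompact_univ (ℝ × ℝ) (hc ▸ hK)
  rw [← Metric.infDist_pos_iff_notMem_closure hne'] at *
  rw [closure_compl]
  exact fun hc => hc (h hx0)

theorem stmt_9
    (Ω : Set (ℝ × ℝ)) (hΩo : IsOpen Ω) (hΩb : Bornology.IsBounded Ω)
    (s11 s12 : ℝ × ℝ × ℝ → ℝ) (hs11 : ContDiff ℝ (⊤ : ℕ∞) s11) (hs12 : ContDiff ℝ (⊤ : ℕ∞) s12)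
    (hrank : RankCond s11 s12)
    (M : ℝ) (α : ℝ) (hα0 : 0 < α) (hα1 : α < 1)
    (pp : ℝ) (hpp : 10 / 3 < pp)
    (K : Set (ℝ × ℝ)) (hK : IsCompact K) (hKΩ : K ⊆ Ω) (C : ℝ) (hC : 0 < C) :
    (∀ K1 : Set (ℝ × ℝ), IsCompact K1 → K1 ⊆ interior K →
      ∃ C1 : ℝ, 0 < C1 ∧
        ∀ ε : ℝ, 0 < ε → ε ≤ 1 →
        ∀ u : ℝ × ℝ → ℝ, ContDiff ℝ 1 u → LipBound s11 s12 Ω u M →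
        ∀ z : ℝ × ℝ → ℝ, ContDiff ℝ 2 z →
        (∀ q ∈ Ω, ∑ i : Fin 2, ∑ j : Fin 2,
            aC s11 s12 ε u i j q * XX s11 s12 ε u i (XX s11 s12 ε u j z) q = 0) →
        (∀ q ∈ K, |u q| + |X1 s11 s12 u u q| + |X2 s11 s12 ε u u q| ≤ C) →
        (∀ q ∈ K, ∀ r ∈ K,
          |X1 s11 s12 u u q - X1 s11 s12 u u r| +
            |X2 s11 s12 ε u u q - X2 s11 s12 ε u u r| ≤ C * dist q r ^ α) →
        LpN pp (Yf s11 s12 u z) K ≤ C →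
        WN s11 s12 ε u 1 2 (Yf s11 s12 u z) K ≤ C →
        WN s11 s12 ε u 2 2 z K ≤ C →
          WN s11 s12 ε u 2 (10 / 3) z K1 ≤ C1) ∧
    (∀ K1 : Set (ℝ × ℝ), IsCompact K1 → K1 ⊆ interior K →
      ∀ p2 : ℝ, 1 < p2 → ∀ C' : ℝ, 0 < C' →
      ∃ C2 : ℝ, 0 < C2 ∧
        ∀ ε : ℝ, 0 < ε → ε ≤ 1 →
        ∀ u : ℝ × ℝ → ℝ, ContDiff ℝ 1 u → LipBound s11 s12 Ω u M →
        ∀ z : ℝ × ℝ → ℝ, ContDiff ℝ 2 z →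
        (∀ q ∈ Ω, ∑ i : Fin 2, ∑ j : Fin 2,
            aC s11 s12 ε u i j q * XX s11 s12 ε u i (XX s11 s12 ε u j z) q = 0) →
        (∀ q ∈ K, |u q| + |X1 s11 s12 u u q| + |X2 s11 s12 ε u u q| ≤ C) →
        (∀ q ∈ K, ∀ r ∈ K,
          |X1 s11 s12 u u q - X1 s11 s12 u u r| +
            |X2 s11 s12 ε u u q - X2 s11 s12 ε u u r| ≤ C * dist q r ^ α) →
        LpN pp (Yf s11 s12 u z) K ≤ C →
        WN s11 s12 ε u 1 2 (Yf s11 s12 u z) K ≤ C →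
        WN s11 s12 ε u 2 2 z K ≤ C →
        (1 / 4 ≤ α) →
        (∀ k : Fin 2, LpN 4 (Yf s11 s12 u (XX s11 s12 ε u k z)) K ≤ C') →
          WN s11 s12 ε u 2 p2 z K1 ≤ C2) := by
  constructor
  · intro K1 hK1 hs1
    obtain ⟨K', hK', hs2, hs3⟩ := exists_compact_between hK1 isOpen_interior hs1
    obtain ⟨L, hL, hlow, hL2, hsup⟩ := main1 hs11 hs12 hrank M α C hα0 hα1 hC hK hK' hs3
    have hsK : K1 ⊆ K' := hs2.trans interior_subset
    obtain ⟨A, hA, hlowA⟩ := hlow (10 / 3) (by norm_num)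
    obtain ⟨C6, hC6, hsup6⟩ := hsup 2 (C + C) pp le_rfl hpp.le
    obtain ⟨c, hc, hcw⟩ := omg_low hK' hK1 hs2
    refine ⟨5 * A + 4 * ((2 * C6 / c) ^ (4 / 3 : ℝ) * L ^ 2) ^ (1 / (10 / 3) : ℝ), by positivity, ?_⟩
    intro ε hε hε1 u hu hlip z hz heq hbd hhol hYp hW1 hW2
    have H : Hyp s11 s12 M α C ε K u z := ⟨hε, hε1, hu, hz, fun p hp => hlip p (hKΩ hp), fun q hq => heq q (hKΩ hq), hbd, hhol⟩
    have k1 : ContDiff ℝ 1 (X1 s11 s12 u z) := XX_c1 hs11 hs12 hu hz ε 0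
    have k2 : ContDiff ℝ 1 (X2 s11 s12 ε u z) := XX_c1 hs11 hs12 hu hz ε 1
    have kY : ContDiff ℝ 1 (Yf s11 s12 u z) := VF_contDiff (c1 (pd3_contDiff hs11)) (c1 (pd3_contDiff hs12)) hu hz
    have k1Y : Continuous (X1 s11 s12 u (Yf s11 s12 u z)) := XX_c0 hs11 hs12 hu kY ε 0
    have k2Y : Continuous (X2 s11 s12 ε u (Yf s11 s12 u z)) := XX_c0 hs11 hs12 hu kY ε 1
    have cS : Continuous (SS s11 s12 u) := (SS_contDiff (c1 hs11) (c1 hs12) hu).continuous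
    have cT : Continuous (SS (pd3 s11) (pd3 s12) u) := (SS_contDiff (c1 (pd3_contDiff hs11)) (c1 (pd3_contDiff hs12)) hu).continuous
    have cD := Dd_cont ε cS cT k1 k2
    obtain ⟨w1, w2, w3⟩ := ex1 hs11 hs12 hu kY (by norm_num) hK hW1
    obtain ⟨l0, l1, l2⟩ := hlowA ε u z H hW1 hW2
    have hb := hsup6 ε u z _ H hW1 hW2 hYp (by fun_prop) (add_bd (by norm_num) k1Y.abs k2Y.abs hK (abs_bd w2) (abs_bd w3)) (Or.inl rfl)
    refine concl hs11 hs12 hu hz (by norm_num) hK1 ((LpN_sub (by norm_num) hz.continuous hK' hK1 hsK).trans l0)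
      ((LpN_sub (by norm_num) k1.continuous hK' hK1 hsK).trans l1) ((LpN_sub (by norm_num) k2.continuous hK' hK1 hsK).trans l2) ?_
    refine interp103 hK1 cD hε hε1 (by positivity) (by linarith) (fun y _ => Dd_nonneg _ _ _ _ _ _) (fun y hy => ?_)
      ((LpN_sub (by norm_num) cD hK' hK1 hsK).trans (hL2 ε u z H hW1 hW2))
    have e1 := hb y (hsK hy)
    have e2 := mul_le_mul_of_nonneg_right (hcw y hy) (Dd_nonneg (SS s11 s12 u) (SS (pd3 s11) (pd3 s12) u) (X1 s11 s12 u z) (X2 s11 s12 ε u z) ε y)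
    have e3 : (1 : ℝ) ≤ ε ^ (-(1 / 2) : ℝ) := Real.one_le_rpow_of_pos_of_le_one_of_nonpos hε hε1 (by norm_num)
    have e4 : ε ^ (1 - 3 / 2 : ℝ) = ε ^ (-(1 / 2) : ℝ) := by norm_num
    rw [e4] at e1
    have e5 : C6 * (ε ^ (-(1 / 2) : ℝ) + 1) ≤ C6 * (2 * ε ^ (-(1 / 2) : ℝ)) := by gcongr; linarith
    rw [show 2 * C6 / c * ε ^ (-(1 / 2) : ℝ) = (C6 * (2 * ε ^ (-(1 / 2) : ℝ))) / c by ring, le_div_iff₀ hc]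
    linarith
  · intro K1 hK1 hs1 p2 hp2 C' hC'
    obtain ⟨K', hK', hs2, hs3⟩ := exists_compact_between hK1 isOpen_interior hs1
    obtain ⟨L, hL, hlow, hL2, hsup⟩ := main1 hs11 hs12 hrank M α C hα0 hα1 hC hK hK' hs3
    have hsK : K1 ⊆ K' := hs2.trans interior_subset
    obtain ⟨A, hA, hlowA⟩ := hlow p2 hp2.le
    obtain ⟨C6, hC6, hsup6⟩ := hsup 4 (C' + C') pp (by norm_num) hpp.le
    obtain ⟨c, hc, hcw⟩ := omg_low hK' hK1 hs2
    have hn := LpN_nonneg p2 (fun _ => 2 * C6 / c) K1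
    refine ⟨5 * A + 4 * LpN p2 (fun _ => 2 * C6 / c) K1, by positivity, ?_⟩
    intro ε hε hε1 u hu hlip z hz heq hbd hhol hYp hW1 hW2 _ hY4
    have H : Hyp s11 s12 M α C ε K u z := ⟨hε, hε1, hu, hz, fun p hp => hlip p (hKΩ hp), fun q hq => heq q (hKΩ hq), hbd, hhol⟩
    have k1 : ContDiff ℝ 1 (X1 s11 s12 u z) := XX_c1 hs11 hs12 hu hz ε 0
    have k2 : ContDiff ℝ 1 (X2 s11 s12 ε u z) := XX_c1 hs11 hs12 hu hz ε 1
    have kY1 : Continuous (Yf s11 s12 u (X1 s11 s12 u z)) := VF_cont (c1 (pd3_contDiff hs11)) (c1 (pd3_contDiff hs12)) hu k1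
    have kY2 : Continuous (Yf s11 s12 u (X2 s11 s12 ε u z)) := VF_cont (c1 (pd3_contDiff hs11)) (c1 (pd3_contDiff hs12)) hu k2
    have cS : Continuous (SS s11 s12 u) := (SS_contDiff (c1 hs11) (c1 hs12) hu).continuous
    have cT : Continuous (SS (pd3 s11) (pd3 s12) u) := (SS_contDiff (c1 (pd3_contDiff hs11)) (c1 (pd3_contDiff hs12)) hu).continuous
    have cD := Dd_cont ε cS cT k1 k2
    obtain ⟨l0, l1, l2⟩ := hlowA ε u z H hW1 hW2
    have y1 : LpN 4 (Yf s11 s12 u (X1 s11 s12 u z)) K ≤ C' := hY4 0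
    have y2 : LpN 4 (Yf s11 s12 u (X2 s11 s12 ε u z)) K ≤ C' := hY4 1
    have hb := hsup6 ε u z _ H hW1 hW2 hYp (by fun_prop) (add_bd (by norm_num) kY1.abs kY2.abs hK (abs_bd y1) (abs_bd y2)) (Or.inr rfl)
    have hp0 : 0 < p2 := by linarith
    refine concl hs11 hs12 hu hz hp2.le hK1 ((LpN_sub hp0 hz.continuous hK' hK1 hsK).trans l0)
      ((LpN_sub hp0 k1.continuous hK' hK1 hsK).trans l1) ((LpN_sub hp0 k2.continuous hK' hK1 hsK).trans l2) ?_
    refine mono_bd hp2.le cD continuous_const hK1 (fun y _ => Dd_nonneg _ _ _ _ _ _) (fun y hy => ?_) le_rfl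
    have e1 := hb y (hsK hy)
    have e2 := mul_le_mul_of_nonneg_right (hcw y hy) (Dd_nonneg (SS s11 s12 u) (SS (pd3 s11) (pd3 s12) u) (X1 s11 s12 u z) (X2 s11 s12 ε u z) ε y)
    have e3 : ε ^ (1 - 3 / 4 : ℝ) ≤ 1 := Real.rpow_le_one hε.le hε1 (by norm_num)
    have e5 : C6 * (ε ^ (1 - 3 / 4 : ℝ) + 1) ≤ C6 * 2 := by gcongr; linarith
    rw [le_div_iff₀ hc]
    linarith

end
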